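/- Assume 0 < γ ≤ 1 and that b(cos θ) is a positive constant ((H4)), and let f be a conservative mild solution of the Boltzmann–Fermi–Dirac equation with initial datum f₀. Suppose f₀ ∈ L¹₂(ℝ³) and esssup_{v} (1+|v|²)^{s/2} f₀(v) < ∞ for some s > 2. Let s' := s if s ≤ 5, and let s' be an arbitrary number with 2 < s' < s if s > 5. Then there exists a constant C₄(s') > 0 such that esssup_{v ∈ ℝ³} (1+|v|)^{s'} f(t,v) ≤ C₄(s') for all t ≥ 0. -/

import Mathlib

noncomputable section

open MeasureTheory Real Set
open scoped RealInnerProductSpace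

/-- `ℝ³` as a Euclidean space. -/
abbrev R3 : Type := EuclideanSpace ℝ (Fin 3)

/-- The unit sphere `𝕊²` in `ℝ³`. -/
abbrev S2 : Type := Metric.sphere (0 : R3) 1

/-- The surface measure on the unit sphere in `ℝ³` (total mass `4π`). -/
def sphMeasure : Measure S2 := Measure.toSphere (volume : Measure R3)

/-- Post-collision velocity `v' = (v+v_*)/2 + (|v-v_*|/2)σ`. -/
def vOut (v w : R3) (σ : S2) : R3 := (2⁻¹ : ℝ) • (v + w) + (‖v - w‖ / 2) • (σ : R3)

/-- Post-collision velocity `v'_* = (v+v_*)/2 - (|v-v_*|/2)σ`. -/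
def vOutStar (v w : R3) (σ : S2) : R3 := (2⁻¹ : ℝ) • (v + w) - (‖v - w‖ / 2) • (σ : R3)

/-- `cos θ = ((v - v_*)/|v - v_*|) · σ`. -/
def cosAngle (v w : R3) (σ : S2) : ℝ := ⟪‖v - w‖⁻¹ • (v - w), (σ : R3)⟫

/-- The collision kernel `B(v - v_*, σ) = |v - v_*|^γ b(cos θ)`. -/
def Bker (γ : ℝ) (b : ℝ → ℝ) (v w : R3) (σ : S2) : ℝ := ‖v - w‖ ^ γ * b (cosAngle v w σ)

/-- Grad's angular cutoff assumption (H1), with the standing assumptions on `b`: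
`b` is measurable, nonnegative, symmetric (`b(cos(π-θ)) = b(cos θ)`), and
`0 < C_b = 2π∫₀^π b(cos θ) sin θ dθ < ∞`. -/
structure GradCutoff (b : ℝ → ℝ) : Prop where
  measurable : Measurable b
  nonneg : ∀ x : ℝ, 0 ≤ b x
  symm : ∀ θ : ℝ, b (Real.cos (π - θ)) = b (Real.cos θ)
  integrable : IntervalIntegrable (fun θ : ℝ => b (Real.cos θ) * Real.sin θ) volume 0 π
  pos : 0 < ∫ θ in (0:ℝ)..π, b (Real.cos θ) * Real.sin θ

/-- `C_b = 2π ∫₀^π b(cos θ) sin θ dθ`. -/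
def Cb (b : ℝ → ℝ) : ℝ := 2 * π * ∫ θ in (0:ℝ)..π, b (Real.cos θ) * Real.sin θ

/-- `C_{b,2} = 2π ∫₀^π b(cos θ) sin³ θ dθ`. -/
def Cb2 (b : ℝ → ℝ) : ℝ := 2 * π * ∫ θ in (0:ℝ)..π, b (Real.cos θ) * Real.sin θ ^ 3

/-- `φ(ε) = ∫_{𝕊²} b(cos θ)(1_{0<θ<ε} + 1_{π-ε<θ<π}) dσ`,
written via the polar-angle parametrization of the sphere. -/
def phiAng (b : ℝ → ℝ) (ε : ℝ) : ℝ :=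
  2 * π * ((∫ θ in (0:ℝ)..ε, b (Real.cos θ) * Real.sin θ)
    + ∫ θ in (π - ε)..π, b (Real.cos θ) * Real.sin θ)

/-- Weighted `L¹` norm `‖f‖_{1,s} = ∫ |f(v)| (1+|v|²)^{s/2} dv`. -/
def wnorm (s : ℝ) (f : R3 → ℝ) : ℝ := ∫ v : R3, |f v| * (1 + ‖v‖ ^ 2) ^ (s / 2)

/-- Membership in the weighted space `L¹_s`. -/
def MemL1s (s : ℝ) (f : R3 → ℝ) : Prop :=
  Integrable (fun v : R3 => |f v| * (1 + ‖v‖ ^ 2) ^ (s / 2))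

/-- The Boltzmann–Fermi–Dirac collision operator `Q_FD(f,f)`. -/
def QFD (γ : ℝ) (b : ℝ → ℝ) (f : R3 → ℝ) (v : R3) : ℝ :=
  ∫ w : R3, ∫ σ : S2, Bker γ b v w σ *
      (f (vOut v w σ) * f (vOutStar v w σ) * (1 - f v) * (1 - f w)
        - f v * f w * (1 - f (vOut v w σ)) * (1 - f (vOutStar v w σ))) ∂sphMeasure

/-- `Q₁(f₁,f₂,f₃)(v) = ∫∫ B f₁(v') f₂(v'_*) f₃(v_*) dσ dv_*`. -/
def Q1 (γ : ℝ) (b : ℝ → ℝ) (f₁ f₂ f₃ : R3 → ℝ) (v : R3) : ℝ :=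
  ∫ w : R3, ∫ σ : S2, Bker γ b v w σ *
      (f₁ (vOut v w σ) * f₂ (vOutStar v w σ) * f₃ w) ∂sphMeasure

/-- `L_FD(f, 1-f, 1-f)(v) = ∫∫ B f(v_*)(1-f(v'))(1-f(v'_*)) dσ dv_*`. -/
def LFD (γ : ℝ) (b : ℝ → ℝ) (f : R3 → ℝ) (v : R3) : ℝ :=
  ∫ w : R3, ∫ σ : S2, Bker γ b v w σ *
      (f w * (1 - f (vOut v w σ)) * (1 - f (vOutStar v w σ))) ∂sphMeasure

/-- The Fermi–Dirac entropy `S(f)` (with `0·ln 0 = 0`, as `Real.log 0 = 0`). -/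
def entropy (f : R3 → ℝ) : ℝ :=
  -∫ v : R3, (f v * Real.log (f v) + (1 - f v) * Real.log (1 - f v))

/-- A conservative mild solution of the Boltzmann–Fermi–Dirac equation with
initial datum `f₀`. -/
structure IsFDSolution (γ : ℝ) (b : ℝ → ℝ) (f₀ : R3 → ℝ) (f : ℝ → R3 → ℝ) : Prop where
  measurable : ∀ t : ℝ, Measurable (f t)
  nonneg : ∀ t : ℝ, 0 ≤ t → ∀ v : R3, 0 ≤ f t v
  le_one : ∀ t : ℝ, 0 ≤ t → ∀ v : R3, f t v ≤ 1
  memL12 : ∀ t : ℝ, 0 ≤ t → MemL1s 2 (f t)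
  contL12 : ∀ t : ℝ, 0 ≤ t → ∀ ε : ℝ, 0 < ε → ∃ δ > 0, ∀ s : ℝ, 0 ≤ s →
      |s - t| < δ → wnorm 2 (fun v => f s v - f t v) < ε
  mild : ∃ Z : Set R3, volume Z = 0 ∧ ∀ t : ℝ, 0 ≤ t → ∀ v : R3, v ∉ Z →
      f t v = f₀ v + ∫ τ in (0:ℝ)..t, QFD γ b (f τ) v
  mass : ∀ t : ℝ, 0 ≤ t → ∫ v : R3, f t v = ∫ v : R3, f₀ v
  momentum : ∀ t : ℝ, 0 ≤ t → ∫ v : R3, f t v • v = ∫ v : R3, f₀ v • v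
  energy : ∀ t : ℝ, 0 ≤ t → ∫ v : R3, f t v * ‖v‖ ^ 2 = ∫ v : R3, f₀ v * ‖v‖ ^ 2

section Part1

instance sph_fin : IsFiniteMeasure sphMeasure := by unfold sphMeasure; infer_instance

abbrev E2 : Type := EuclideanSpace ℝ (Fin 2)

theorem lintegral_polar_gen {E : Type*} [NormedAddCommGroup E] [NormedSpace ℝ E]
    [MeasurableSpace E] [BorelSpace E] [FiniteDimensional ℝ E] [Nontrivial E]
    (μ : Measure E) [μ.IsAddHaarMeasure] (h : E → ENNReal) (hh : Measurable h) :
    ∫⁻ x, h x ∂μ = ∫⁻ σ, (∫⁻ r in Ioi (0:ℝ),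
      ENNReal.ofReal (r ^ (Module.finrank ℝ E - 1)) * h (r • (σ : E))) ∂μ.toSphere := by
  have h1 : ∫⁻ x, h x ∂μ = ∫⁻ x : ({(0)}ᶜ : Set E), h x.1 ∂(μ.comap (↑)) := by
    rw [lintegral_subtype_comap (measurableSet_singleton _).compl,
        restrict_compl_singleton]
  have hm : Measurable (fun p : Metric.sphere (0:E) 1 × Ioi (0:ℝ) => h ((p.2:ℝ) • (p.1 : E))) := by
    apply hh.comp
    fun_prop
  have h2 := μ.measurePreserving_homeomorphUnitSphereProd.lintegral_comp hm
  rw [h1]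
  have h3 : ∫⁻ x : ({(0)}ᶜ : Set E), h x.1 ∂(μ.comap (↑)) =
    ∫⁻ x : ({(0)}ᶜ : Set E), h (((homeomorphUnitSphereProd E x).2:ℝ) • ((homeomorphUnitSphereProd E x).1 : E)) ∂(μ.comap (↑)) := by
    congr 1
    ext x
    have hx : ‖(x:E)‖ ≠ 0 := norm_ne_zero_iff.2 x.2
    congr 1
    simp [smul_smul, hx]
  rw [h3, h2, lintegral_prod _ hm.aemeasurable]
  congr 1
  ext σ
  rw [Measure.volumeIoiPow, lintegral_withDensity_eq_lintegral_mul]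
  · rw [← lintegral_subtype_comap measurableSet_Ioi]
    rfl
  · fun_prop
  · apply hh.comp
    fun_prop

theorem lintegral_polar (h : R3 → ENNReal) (hh : Measurable h) :
    ∫⁻ x, h x = ∫⁻ σ, (∫⁻ r in Ioi (0:ℝ),
      ENNReal.ofReal (r ^ 2) * h (r • (σ : R3))) ∂sphMeasure := by
  have := lintegral_polar_gen (volume : Measure R3) h hh
  simpa [sphMeasure] using this

/-- sphere integral as a ball integral -/
theorem lintegral_sphere_ball (g : R3 → ENNReal) (hg : Measurable g) :
    ∫⁻ σ, g (σ:R3) ∂sphMeasure = 3 * ∫⁻ x : R3, (Metric.ball (0:R3) 1).indicator 1 x * g (‖x‖⁻¹ • x) := by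
  rw [lintegral_polar]
  swap
  · apply Measurable.mul
    · exact measurable_one.indicator measurableSet_ball
    · apply hg.comp; fun_prop
  have : ∀ σ : S2, ∫⁻ r in Ioi (0:ℝ), ENNReal.ofReal (r ^ 2) * ((Metric.ball (0:R3) 1).indicator 1 (r • (σ : R3)) * g (‖(r • (σ : R3))‖⁻¹ • (r • (σ : R3)))) = (∫⁻ r in Ioi (0:ℝ), (Iio (1:ℝ)).indicator (fun r => ENNReal.ofReal (r ^ 2)) r) * g σ := by
    intro σ
    rw [← lintegral_mul_const _ (by apply Measurable.indicator _ measurableSet_Iio; fun_prop)]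
    apply setLIntegral_congr_fun measurableSet_Ioi
    intro r hr
    have hr' : (0:ℝ) < r := hr
    simp only [norm_smul, norm_eq_of_mem_sphere, mul_one, Real.norm_of_nonneg hr'.le, smul_smul, inv_mul_cancel₀ hr'.ne', one_smul]
    by_cases h : r < 1
    · have : r • (σ:R3) ∈ Metric.ball (0:R3) 1 := by simp [norm_smul, abs_of_pos hr', h]
      simp [h, this]
    · have : r • (σ:R3) ∉ Metric.ball (0:R3) 1 := by simp [norm_smul, abs_of_pos hr', not_lt.1 h]
      simp [h, this]
  simp_rw [this]
  rw [lintegral_const_mul _ (by fun_prop)]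
  have h3 : (∫⁻ r in Ioi (0:ℝ), (Iio (1:ℝ)).indicator (fun r => ENNReal.ofReal (r ^ 2)) r) = ENNReal.ofReal (1/3) := by
    rw [setLIntegral_indicator measurableSet_Iio]
    have : Iio (1:ℝ) ∩ Ioi 0 = Ioo 0 1 := by ext; simp [and_comm]
    rw [this, Measure.restrict_congr_set Ioo_ae_eq_Ioc, ← ofReal_integral_eq_lintegral_ofReal]
    · rw [← intervalIntegral.integral_of_le (by norm_num), integral_pow]; norm_num
    · exact (intervalIntegral.intervalIntegrable_pow 2).1
    · filter_upwards with x; positivity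
  rw [h3, ← mul_assoc]
  have : (3:ENNReal) * ENNReal.ofReal (1/3) = 1 := by
    rw [show (3:ENNReal) = ENNReal.ofReal 3 by simp, ← ENNReal.ofReal_mul (by norm_num)]; norm_num
  rw [this, one_mul]

theorem lintegral_sphere_neg (g : R3 → ENNReal) (hg : Measurable g) :
    ∫⁻ σ, g (-(σ:R3)) ∂sphMeasure = ∫⁻ σ, g (σ:R3) ∂sphMeasure := by
  rw [lintegral_sphere_ball g hg, lintegral_sphere_ball (fun x => g (-x)) (by fun_prop)]
  congr 1
  rw [← lintegral_neg_eq_self]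
  congr 1
  ext x
  congr 1
  · simp [indicator]
  · simp

end Part1

section Part2

theorem exists_decomp (a : R3) (ha : ‖a‖ = 1) :
    ∃ ι : E2 →ₗᵢ[ℝ] R3, (∀ z, ⟪a, ι z⟫ = 0) ∧
      ∀ h : R3 → ENNReal, Measurable h → ∫⁻ u, h u = ∫⁻ s : ℝ, ∫⁻ z : E2, h (s • a + ι z) := by
  have hv : Orthonormal ℝ (({0} : Set (Fin 3)).domRestrict (fun _ : Fin 3 => a)) := by
    constructor
    · intro i; exact ha
    · intro i j hij; exact absurd (Subsingleton.elim i j) hij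
  obtain ⟨b, hb⟩ := hv.exists_orthonormalBasis_extension_of_card_eq (by simp)
  have hb0 : b 0 = a := by simpa using hb 0 (by simp)
  have on := b.orthonormal
  have i01 : ⟪b 0, b 1⟫ = 0 := on.2 (by decide)
  have i02 : ⟪b 0, b 2⟫ = 0 := on.2 (by decide)
  have i12 : ⟪b 1, b 2⟫ = 0 := on.2 (by decide)
  let L : E2 →ₗ[ℝ] R3 :=
    { toFun := fun z => z 0 • b 1 + z 1 • b 2
      map_add' := by intro x y; simp [add_smul]; abel
      map_smul' := by intro c x; simp [mul_smul] }
  refine ⟨⟨L, ?_⟩, ?_, ?_⟩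
  · intro z
    have h1 : ‖z 0 • b 1 + z 1 • b 2‖ ^ 2 = ‖z‖ ^ 2 := by
      rw [norm_add_sq_real, EuclideanSpace.norm_sq_eq z]
      simp [norm_smul, on.1, inner_smul_left, inner_smul_right, i12, Fin.sum_univ_two]
    exact (pow_left_inj₀ (norm_nonneg _) (norm_nonneg _) two_ne_zero).1 h1
  · intro z
    change ⟪a, z 0 • b 1 + z 1 • b 2⟫ = 0
    rw [← hb0, inner_add_right, inner_smul_right, inner_smul_right, i01, i02]; simp
  · intro h hh
    have m1 : ∫⁻ u, h u = ∫⁻ x : R3, h (b.repr.symm x) :=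
      (b.repr.symm.measurePreserving.lintegral_comp hh).symm
    have m2 : ∫⁻ x : R3, h (b.repr.symm x) = ∫⁻ x : Fin 3 → ℝ, h (b.repr.symm (WithLp.toLp 2 x)) :=
      ((PiLp.volume_preserving_toLp (Fin 3)).lintegral_comp (by
        apply hh.comp; exact b.repr.symm.continuous.measurable)).symm
    rw [m1, m2]
    have m3 := (volume_preserving_piFinSuccAbove (fun _ : Fin 3 => ℝ) 0).symm
    rw [← m3.lintegral_comp (by apply hh.comp; exact b.repr.symm.continuous.measurable.comp (by fun_prop))]
    rw [Measure.volume_eq_prod, lintegral_prod]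
    swap
    · apply Measurable.aemeasurable
      apply hh.comp
      apply b.repr.symm.continuous.measurable.comp
      exact (WithLp.measurable_toLp 2 _).comp (MeasurableEquiv.measurable _)
    congr 1
    ext s
    rw [← (PiLp.volume_preserving_toLp (Fin 2)).lintegral_comp]
    swap
    · apply hh.comp
      have : Measurable L := (LinearMap.continuous_of_finiteDimensional L).measurable
      exact this.const_add _
    congr 1
    ext z
    congr 1
    rw [← b.repr.symm_apply_apply (s • a + _)]
    congr 1
    change _ = b.repr (s • a + (z 0 • b 1 + z 1 • b 2))
    rw [← hb0]
    ext i
    fin_cases i <;> simp [MeasurableEquiv.piFinSuccAbove, Fin.insertNthEquiv]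
    rfl

def iota (a : S2) : E2 →ₗᵢ[ℝ] R3 := (exists_decomp a (by simp)).choose

theorem inner_iota (a : S2) (z : E2) : ⟪(a:R3), iota a z⟫ = 0 := (exists_decomp a (by simp)).choose_spec.1 z

theorem lintegral_decomp (a : S2) (h : R3 → ENNReal) (hh : Measurable h) :
    ∫⁻ u, h u = ∫⁻ s : ℝ, ∫⁻ z : E2, h (s • (a:R3) + iota a z) :=
  (exists_decomp a (by simp)).choose_spec.2 h hh

theorem norm_decomp (a : S2) (s : ℝ) (z : E2) : ‖s • (a:R3) + iota a z‖ = √(s^2 + ‖z‖^2) := by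
  rw [eq_comm, Real.sqrt_eq_iff_mul_self_eq (by positivity) (norm_nonneg _), ← sq, norm_add_sq_real]
  simp [norm_smul, inner_smul_left, inner_iota]

theorem inner_decomp (a : S2) (s : ℝ) (z : E2) : ⟪(a:R3), s • (a:R3) + iota a z⟫ = s := by
  rw [inner_add_right, inner_iota, inner_smul_right]
  simp

theorem measurable_iota (a : S2) : Measurable (iota a) := (iota a).continuous.measurable

end Part2

section Part3

def Tm (ω x : R3) : R3 := (2 * ⟪ω, x⟫) • x - ‖x‖^2 • ω

def Tm' (ω x : R3) : R3 →L[ℝ] R3 :=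
  (2 * ⟪ω, x⟫) • ContinuousLinearMap.id ℝ R3 + ((2:ℝ) • innerSL ℝ ω).smulRight x - ((2:ℝ) • innerSL ℝ x).smulRight ω

theorem hasFDerivAt_Tm (ω x : R3) : HasFDerivAt (Tm ω) (Tm' ω x) x := by
  unfold Tm
  have h1 : HasFDerivAt (fun x : R3 => 2 * ⟪ω, x⟫) ((2:ℝ) • innerSL ℝ ω) x :=
    ((innerSL ℝ ω).hasFDerivAt).const_mul 2
  have h2 : HasFDerivAt (fun x : R3 => ‖x‖^2) ((2:ℝ) • innerSL ℝ x) x := by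
    have := (hasStrictFDerivAt_norm_sq x).hasFDerivAt
    rwa [← ofNat_smul_eq_nsmul ℝ 2 (innerSL ℝ x)] at this
  exact (h1.smul (hasFDerivAt_id x)).sub (h2.smul_const ω)

theorem det_Tm' (ω x : R3) (hω : ‖ω‖ = 1) : (Tm' ω x).det = 8 * ⟪ω, x⟫ * ‖x‖^2 := by
  have h1 : ω 0 ^ 2 + ω 1 ^ 2 + ω 2 ^ 2 = 1 := by
    have := EuclideanSpace.norm_sq_eq ω
    rw [hω] at this
    simpa [Fin.sum_univ_three] using this.symm
  have h2 : ‖x‖^2 = x 0 ^ 2 + x 1 ^ 2 + x 2 ^ 2 := by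
    rw [EuclideanSpace.norm_sq_eq]; simp [Fin.sum_univ_three]
  have h3 : ⟪ω, x⟫ = ω 0 * x 0 + ω 1 * x 1 + ω 2 * x 2 := by
    simp [PiLp.inner_apply, Fin.sum_univ_three, mul_comm]
  have hc : ∀ i j, (Tm' ω x) (EuclideanSpace.basisFun (Fin 3) ℝ j) i
      = 2 * (ω 0 * x 0 + ω 1 * x 1 + ω 2 * x 2) * (if i = j then 1 else 0) + 2 * ω j * x i - 2 * x j * ω i := by
    intro i j
    simp only [Tm', h3]
    simp [EuclideanSpace.inner_single_right, Pi.single_apply]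
  rw [ContinuousLinearMap.det, ← LinearMap.det_toMatrix (EuclideanSpace.basisFun (Fin 3) ℝ).toBasis, Matrix.det_fin_three]
  simp only [LinearMap.toMatrix_apply]
  simp only [OrthonormalBasis.coe_toBasis, OrthonormalBasis.coe_toBasis_repr_apply, EuclideanSpace.basisFun_repr, ContinuousLinearMap.coe_coe, hc]
  rw [h2, h3]
  simp
  linear_combination (8 * (ω 0 * x 0 + ω 1 * x 1 + ω 2 * x 2) * (x 0 ^ 2 + x 1 ^ 2 + x 2 ^ 2)) * h1

theorem norm_Tm (ω x : R3) (hω : ‖ω‖ = 1) : ‖Tm ω x‖ = ‖x‖^2 := by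
  have : ‖Tm ω x‖^2 = (‖x‖^2)^2 := by
    unfold Tm
    rw [norm_sub_sq_real]
    simp only [norm_smul, inner_smul_left, inner_smul_right, hω, real_inner_comm ω x]
    simp [mul_pow]
    ring
  exact (pow_left_inj₀ (norm_nonneg _) (by positivity) two_ne_zero).1 this

theorem inner_Tm (ω x : R3) (hω : ‖ω‖ = 1) : ⟪ω, Tm ω x⟫ = 2 * ⟪ω, x⟫^2 - ‖x‖^2 := by
  unfold Tm
  rw [inner_sub_right, inner_smul_right, inner_smul_right, real_inner_self_eq_norm_sq, hω]
  ring

theorem injOn_Tm (ω : R3) (hω : ‖ω‖ = 1) : InjOn (Tm ω) {x | 0 < ⟪ω, x⟫} := by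
  intro x hx y hy h
  simp only [mem_ofPred_eq] at hx hy
  have h1 : ‖x‖^2 = ‖y‖^2 := by rw [← norm_Tm ω x hω, h, norm_Tm ω y hω]
  have h2 : ⟪ω, x⟫ ^ 2 = ⟪ω, y⟫ ^ 2 := by
    have := inner_Tm ω x hω
    rw [h, inner_Tm ω y hω] at this
    linarith
  have h3 : ⟪ω, x⟫ = ⟪ω, y⟫ := (pow_left_inj₀ hx.le hy.le two_ne_zero).1 h2
  unfold Tm at h
  rw [h1, h3] at h
  have := sub_left_injective h
  exact smul_right_injective _ (by positivity) this

theorem surj_Tm (ω : R3) (hω : ‖ω‖ = 1) (y : R3) (hy : 0 < ‖y‖ + ⟪ω, y⟫) :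
    y ∈ Tm ω '' {x | 0 < ⟪ω, x⟫} := by
  set d := ‖y‖ + ⟪ω, y⟫ with hd
  set c := (√(2*d))⁻¹ with hc
  have hc0 : 0 < c := by positivity
  have hc2 : c^2 * (2*d) = 1 := by
    rw [hc, inv_pow, Real.sq_sqrt (by positivity)]; field_simp
  have hi : ⟪ω, c • (y + ‖y‖ • ω)⟫ = c * d := by
    rw [inner_smul_right, inner_add_right, inner_smul_right, real_inner_self_eq_norm_sq, hω, hd]; ring
  have hn : ‖c • (y + ‖y‖ • ω)‖^2 = ‖y‖ := by
    rw [norm_smul, mul_pow, norm_add_sq_real, inner_smul_right, norm_smul, hω, real_inner_comm]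
    simp
    have : ⟪ω, y⟫ = d - ‖y‖ := by rw [hd]; ring
    rw [this]
    linear_combination ‖y‖ * hc2
  refine ⟨c • (y + ‖y‖ • ω), ?_, ?_⟩
  · simp only [mem_ofPred_eq]; rw [hi]; positivity
  · unfold Tm
    rw [hi, hn, smul_smul]
    have : 2 * (c * d) * c = 1 := by linear_combination hc2
    rw [this]; simp

theorem image_Tm_ae (ω : R3) (hω : ‖ω‖ = 1) :
    (Tm ω '' {x | 0 < ⟪ω, x⟫} : Set R3) =ᵐ[volume] univ := by
  rw [ae_eq_univ]
  apply measure_mono_null (t := (Submodule.span ℝ {ω} : Set R3))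
  · intro y hy
    by_contra hne
    apply hy
    apply surj_Tm ω hω
    by_contra hle
    apply hne
    have : ‖y + ‖y‖ • ω‖^2 ≤ 0 := by
      rw [norm_add_sq_real, inner_smul_right, norm_smul, hω, real_inner_comm]
      simp
      nlinarith [norm_nonneg y]
    have h0 : y + ‖y‖ • ω = 0 := by
      have := pow_eq_zero_iff two_ne_zero |>.1 (le_antisymm this (by positivity))
      simpa using this
    have : y = (-‖y‖) • ω := by rw [neg_smul]; exact eq_neg_of_add_eq_zero_left h0
    rw [this]
    exact Submodule.smul_mem _ _ (Submodule.mem_span_singleton_self ω)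
  · apply Measure.addHaar_submodule
    intro h
    have := finrank_span_singleton (K := ℝ) (v := ω) (by intro h; simp [h] at hω)
    rw [h] at this
    simp at this

theorem lintegral_sphere_refl (ω : R3) (hω : ‖ω‖ = 1) (g : R3 → ENNReal) (hg : Measurable g) :
    ∫⁻ σ, g (σ:R3) ∂sphMeasure =
      4 * ∫⁻ a, ENNReal.ofReal ⟪ω, (a:R3)⟫ * g ((2 * ⟪ω, (a:R3)⟫) • (a:R3) - ω) ∂sphMeasure := by
  have hTm : Measurable (Tm ω) := by unfold Tm; fun_prop
  rw [lintegral_sphere_ball g hg]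
  have hH : MeasurableSet {x : R3 | 0 < ⟪ω, x⟫} := measurableSet_lt (by fun_prop) (by fun_prop)
  rw [← setLIntegral_univ, ← Measure.restrict_congr_set (image_Tm_ae ω hω),
    lintegral_image_eq_lintegral_abs_det_fderiv_mul volume hH
      (fun x _ => (hasFDerivAt_Tm ω x).hasFDerivWithinAt) (injOn_Tm ω hω), ← lintegral_indicator hH]
  have e1 : ∀ x : R3, {x : R3 | 0 < ⟪ω, x⟫}.indicator (fun x => ENNReal.ofReal |(Tm' ω x).det| *
      ((Metric.ball (0:R3) 1).indicator 1 (Tm ω x) * g (‖Tm ω x‖⁻¹ • Tm ω x))) x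
      = 8 * ((Metric.ball (0:R3) 1).indicator 1 x * (ENNReal.ofReal (⟪ω, x⟫ * ‖x‖^2) * g (Tm ω (‖x‖⁻¹ • x)))) := by
    intro x
    by_cases hx : 0 < ⟪ω, x⟫
    · have hx0 : 0 < ‖x‖ := by
        rw [norm_pos_iff]; rintro rfl; simp at hx
      rw [indicator_of_mem (show x ∈ {x : R3 | 0 < ⟪ω, x⟫} from hx), det_Tm' ω x hω, abs_of_nonneg (by positivity), norm_Tm ω x hω]
      have i1 : (Metric.ball (0:R3) 1).indicator (1 : R3 → ENNReal) (Tm ω x) = (Metric.ball (0:R3) 1).indicator 1 x := by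
        have : Tm ω x ∈ Metric.ball (0:R3) 1 ↔ x ∈ Metric.ball (0:R3) 1 := by
          simp [norm_Tm ω x hω, sq_lt_one_iff₀]
        by_cases hxb : x ∈ Metric.ball (0:R3) 1
        · rw [indicator_of_mem hxb, indicator_of_mem (this.2 hxb)]; rfl
        · rw [indicator_of_notMem hxb, indicator_of_notMem (fun h => hxb (this.1 h))]
      have i2 : (‖x‖^2)⁻¹ • Tm ω x = Tm ω (‖x‖⁻¹ • x) := by
        unfold Tm
        rw [smul_sub, inner_smul_right, smul_smul, smul_smul, smul_smul, norm_smul]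
        congr 2
        · ring
        · simp; field_simp
      rw [i1, i2, mul_assoc 8, ENNReal.ofReal_mul (by norm_num)]
      simp
      ring
    · rw [indicator_of_notMem (show x ∉ {x : R3 | 0 < ⟪ω, x⟫} from hx), ENNReal.ofReal_of_nonpos]
      · simp
      · exact mul_nonpos_of_nonpos_of_nonneg (not_lt.1 hx) (by positivity)
  simp_rw [e1]
  rw [lintegral_const_mul, ← mul_assoc, lintegral_polar]
  rotate_left
  · refine (measurable_one.indicator measurableSet_ball).mul (Measurable.mul (by fun_prop) ?_)
    exact hg.comp (hTm.comp (by fun_prop))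
  · refine (measurable_one.indicator measurableSet_ball).mul (Measurable.mul (by fun_prop) ?_)
    exact hg.comp (hTm.comp (by fun_prop))
  have : ∀ σ : S2, ∫⁻ r in Ioi (0:ℝ), ENNReal.ofReal (r ^ 2) * ((Metric.ball (0:R3) 1).indicator 1 (r • (σ:R3)) * (ENNReal.ofReal (⟪ω, r • (σ:R3)⟫ * ‖r • (σ:R3)‖^2) * g (Tm ω (‖r • (σ:R3)‖⁻¹ • (r • (σ:R3)))))) = (∫⁻ r in Ioi (0:ℝ), (Iio (1:ℝ)).indicator (fun r => ENNReal.ofReal (r ^ 5)) r) * (ENNReal.ofReal ⟪ω, (σ:R3)⟫ * g ((2 * ⟪ω, (σ:R3)⟫) • (σ:R3) - ω)) := by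
    intro σ
    rw [← lintegral_mul_const _ (by apply Measurable.indicator _ measurableSet_Iio; fun_prop)]
    apply setLIntegral_congr_fun measurableSet_Ioi
    intro r hr
    have hr' : (0:ℝ) < r := hr
    have hT : Tm ω (σ:R3) = (2 * ⟪ω, (σ:R3)⟫) • (σ:R3) - ω := by simp [Tm]
    simp only [norm_smul, norm_eq_of_mem_sphere, mul_one, Real.norm_of_nonneg hr'.le, smul_smul, inv_mul_cancel₀ hr'.ne', one_smul, hT]
    by_cases h : r < 1
    · have : r • (σ:R3) ∈ Metric.ball (0:R3) 1 := by simp [norm_smul, abs_of_pos hr', h]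
      simp only [this, indicator_of_mem, Pi.one_apply, one_mul, mem_Iio, h]
      rw [← mul_assoc, ← mul_assoc, ← ENNReal.ofReal_mul (by positivity), ← ENNReal.ofReal_mul (by positivity), inner_smul_right]
      congr 2
      ring
    · have : r • (σ:R3) ∉ Metric.ball (0:R3) 1 := by simp [norm_smul, abs_of_pos hr', not_lt.1 h]
      simp [h, this]
  simp_rw [this]
  rw [lintegral_const_mul _ (by fun_prop)]
  have h3 : (∫⁻ r in Ioi (0:ℝ), (Iio (1:ℝ)).indicator (fun r => ENNReal.ofReal (r ^ 5)) r) = ENNReal.ofReal (1/6) := by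
    rw [setLIntegral_indicator measurableSet_Iio]
    have : Iio (1:ℝ) ∩ Ioi 0 = Ioo 0 1 := by ext; simp [and_comm]
    rw [this, Measure.restrict_congr_set Ioo_ae_eq_Ioc, ← ofReal_integral_eq_lintegral_ofReal]
    · rw [← intervalIntegral.integral_of_le (by norm_num), integral_pow]; norm_num
    · exact (intervalIntegral.intervalIntegrable_pow 5).1
    · filter_upwards [ae_restrict_mem measurableSet_Ioc] with x hx; have := hx.1; positivity
  rw [h3, ← mul_assoc]
  have : (3:ENNReal) * 8 * ENNReal.ofReal (1/6) = 4 := by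
    rw [show (3:ENNReal) = ENNReal.ofReal 3 by simp, show (8:ENNReal) = ENNReal.ofReal 8 by simp, ← ENNReal.ofReal_mul (by norm_num), ← ENNReal.ofReal_mul (by norm_num)]; norm_num
  rw [this]

end Part3

section Part4

theorem mset_and {α : Type*} [MeasurableSpace α] {p q : α → Prop} (hp : MeasurableSet {x | p x})
    (hq : MeasurableSet {x | q x}) : MeasurableSet {x | p x ∧ q x} := hp.inter hq

theorem hat_cov (ρ : ℝ) (hρ : 0 < ρ) (k : ℝ → ENNReal) :
    ∫⁻ s : ℝ, ENNReal.ofReal (ρ^2 / (√(s^2+ρ^2))^3) * k (s / √(s^2+ρ^2)) ≤ ∫⁻ t, k t := by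
  have hpos : ∀ s : ℝ, 0 < √(s^2+ρ^2) := fun s => by positivity
  have hd : ∀ s : ℝ, HasDerivAt (fun s : ℝ => s / √(s^2+ρ^2)) (ρ^2 / (√(s^2+ρ^2))^3) s := by
    intro s
    have h1 : HasDerivAt (fun s : ℝ => s^2+ρ^2) (2*s) s := by
      simpa using (hasDerivAt_pow 2 s).add_const (ρ^2)
    have h2 := (hasDerivAt_id s).div (h1.sqrt (by positivity)) (hpos s).ne'
    refine HasDerivAt.congr_deriv (f := fun s : ℝ => s / √(s^2+ρ^2)) h2 ?_
    have h3 : √(s^2+ρ^2)^2 = s^2+ρ^2 := Real.sq_sqrt (by positivity)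
    have := (hpos s).ne'
    simp only [id]
    field_simp
    rw [h3]; ring
  have hmono : StrictMono (fun s : ℝ => s / √(s^2+ρ^2)) :=
    strictMono_of_hasDerivAt_pos hd (fun s => by have := hpos s; positivity)
  have := lintegral_image_eq_lintegral_abs_deriv_mul MeasurableSet.univ
    (fun s _ => (hd s).hasDerivWithinAt) hmono.injective.injOn k
  rw [setLIntegral_univ] at this
  calc _ = _ := by
        refine Eq.trans ?_ this.symm
        congr 1; ext s; rw [abs_of_nonneg (by have := hpos s; positivity)]
    _ ≤ _ := setLIntegral_le_lintegral _ _

theorem lintegral_hatbox (a : S2) (ψ : ℝ → ENNReal) (hψ : Measurable ψ) :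
    ∫⁻ σ, ψ ⟪(a:R3), (σ:R3)⟫ ∂sphMeasure ≤ ENNReal.ofReal 128 * ∫⁻ t, ψ t := by
  set H : R3 → ENNReal := {x : R3 | 1/2 < ‖x‖ ∧ ‖x‖ < 1}.indicator (fun x => ψ (⟪(a:R3), x⟫ / ‖x‖)) with hH
  have hmS : MeasurableSet {x : R3 | 1/2 < ‖x‖ ∧ ‖x‖ < 1} :=
    mset_and (measurableSet_lt (by fun_prop) (by fun_prop)) (measurableSet_lt (by fun_prop) (by fun_prop))
  have hHm : Measurable H := by
    apply Measurable.indicator _ hmS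
    apply hψ.comp; fun_prop
  have low : ENNReal.ofReal (1/8) * ∫⁻ σ, ψ ⟪(a:R3), (σ:R3)⟫ ∂sphMeasure ≤ ∫⁻ x, H x := by
    rw [lintegral_polar H hHm, ← lintegral_const_mul _ (by apply hψ.comp; fun_prop)]
    apply lintegral_mono
    intro σ
    calc ENNReal.ofReal (1/8) * ψ ⟪(a:R3), (σ:R3)⟫ = ∫⁻ r in Ioo (1/2:ℝ) 1, ENNReal.ofReal (1/4) * ψ ⟪(a:R3), (σ:R3)⟫ := by
          rw [setLIntegral_const, Real.volume_Ioo, mul_right_comm, ← ENNReal.ofReal_mul (by norm_num)]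
          norm_num
      _ ≤ ∫⁻ r in Ioo (1/2:ℝ) 1, ENNReal.ofReal (r ^ 2) * H (r • (σ : R3)) := by
          apply setLIntegral_mono' measurableSet_Ioo
          intro r hr
          have hr0 : 0 < r := by linarith [hr.1]
          have : r • (σ:R3) ∈ {x : R3 | 1/2 < ‖x‖ ∧ ‖x‖ < 1} := by
            simp only [mem_ofPred_eq, norm_smul, norm_eq_of_mem_sphere, mul_one, Real.norm_of_nonneg hr0.le]
            exact hr
          rw [hH, indicator_of_mem this, inner_smul_right, norm_smul]
          simp only [norm_eq_of_mem_sphere, mul_one, Real.norm_of_nonneg hr0.le, mul_div_cancel_left₀ _ hr0.ne']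
          gcongr
          nlinarith [hr.1]
      _ ≤ _ := by
          apply lintegral_mono_set
          intro r hr; exact lt_trans (by norm_num) hr.1
  have up : ∫⁻ x, H x ≤ ENNReal.ofReal 16 * ∫⁻ t, ψ t := by
    rw [lintegral_decomp a H hHm, lintegral_lintegral_swap]
    swap
    · exact (hHm.comp (by have := measurable_iota a; fun_prop)).aemeasurable
    set S : Set (E2 × ℝ) := {p | (1 - p.2^2)/4 < ‖p.1‖^2 ∧ ‖p.1‖^2 < 1 - p.2^2 ∧ 0 < ‖p.1‖} with hS
    have hSm : MeasurableSet S :=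
      mset_and (measurableSet_lt (by fun_prop) (by fun_prop)) (mset_and (measurableSet_lt (by fun_prop) (by fun_prop)) (measurableSet_lt (by fun_prop) (by fun_prop)))
    have step : ∀ z : E2, z ≠ 0 → ∫⁻ s : ℝ, H (s • (a:R3) + iota a z) ≤
        ∫⁻ t : ℝ, S.indicator (fun p => ENNReal.ofReal ((‖p.1‖^2)⁻¹) * ψ p.2) (z, t) := by
      intro z hz
      have hz0 : 0 < ‖z‖ := norm_pos_iff.2 hz
      refine le_trans ?_ (hat_cov ‖z‖ hz0 _)
      apply lintegral_mono
      intro s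
      have hm : 0 < √(s^2+‖z‖^2) := by positivity
      have hm2 : √(s^2+‖z‖^2)^2 = s^2+‖z‖^2 := Real.sq_sqrt (by positivity)
      by_cases hx : s • (a:R3) + iota a z ∈ {x : R3 | 1/2 < ‖x‖ ∧ ‖x‖ < 1}
      · simp only [hH, indicator_of_mem hx, norm_decomp, inner_decomp]
        simp only [mem_ofPred_eq, norm_decomp] at hx
        set m := √(s^2+‖z‖^2)
        have ht : 1 - (s/m)^2 = ‖z‖^2 / m^2 := by field_simp; linarith
        have hm1 : m^2 < 1 := by nlinarith [hx.2]
        have hm3 : 1/4 < m^2 := by nlinarith [hx.1]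
        have hmem : (z, s/m) ∈ S := by
          simp only [hS, mem_ofPred_eq, ht]
          refine ⟨?_, ?_, hz0⟩
          · rw [div_div, div_lt_iff₀ (by positivity)]
            nlinarith [sq_pos_of_pos hz0]
          · rw [lt_div_iff₀ (by positivity)]
            nlinarith [sq_pos_of_pos hz0]
        rw [indicator_of_mem hmem, ← mul_assoc, ← ENNReal.ofReal_mul (by positivity)]
        apply le_mul_of_one_le_left (zero_le)
        rw [ENNReal.one_le_ofReal]
        field_simp
        exact pow_le_one₀ hm.le hx.2.le
      · simp only [hH, indicator_of_notMem hx]; exact zero_le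
    have hSi : Measurable (S.indicator (fun p : E2 × ℝ => ENNReal.ofReal ((‖p.1‖^2)⁻¹) * ψ p.2)) := by
      apply Measurable.indicator _ hSm
      apply Measurable.mul (by fun_prop)
      exact hψ.comp measurable_snd
    calc _ ≤ ∫⁻ z : E2, ∫⁻ t : ℝ, S.indicator (fun p => ENNReal.ofReal ((‖p.1‖^2)⁻¹) * ψ p.2) (z, t) := by
          apply lintegral_mono_ae
          have : ∀ᵐ z : E2, z ≠ 0 := by simp [ae_iff]
          filter_upwards [this] with z hz using step z hz
      _ = ∫⁻ t : ℝ, ∫⁻ z : E2, S.indicator (fun p => ENNReal.ofReal ((‖p.1‖^2)⁻¹) * ψ p.2) (z, t) := by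
          rw [lintegral_lintegral_swap]
          exact hSi.aemeasurable
      _ ≤ ∫⁻ t : ℝ, ENNReal.ofReal 16 * ψ t := by
          apply lintegral_mono
          intro t
          by_cases ht : 0 < 1 - t^2
          · calc ∫⁻ z : E2, S.indicator (fun p => ENNReal.ofReal ((‖p.1‖^2)⁻¹) * ψ p.2) (z, t)
                ≤ ∫⁻ z : E2, (Metric.ball (0:E2) (√(1-t^2))).indicator (fun _ => ENNReal.ofReal (4/(1-t^2)) * ψ t) z := by
                  apply lintegral_mono
                  intro z
                  beta_reduce
                  by_cases hz : (z,t) ∈ S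
                  · have hzb : z ∈ Metric.ball (0:E2) (√(1-t^2)) := by
                      simp only [Metric.mem_ball, dist_zero_right]
                      exact Real.lt_sqrt_of_sq_lt hz.2.1
                    rw [indicator_of_mem hz]; simp only [indicator_of_mem hzb]
                    gcongr
                    have h1 := hz.1
                    have h3 := hz.2.2
                    simp only at h1 h3
                    rw [inv_eq_one_div, div_le_div_iff₀ (by positivity) ht]
                    linarith
                  · rw [indicator_of_notMem hz]; exact zero_le
              _ ≤ _ := by
                  rw [lintegral_indicator measurableSet_ball, setLIntegral_const, EuclideanSpace.volume_ball_fin_two,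
                    mul_right_comm]
                  refine mul_le_mul_left ?_ _
                  rw [← ENNReal.ofReal_pow (by positivity), Real.sq_sqrt ht.le]
                  rw [← ENNReal.ofReal_mul (by positivity), ← ENNReal.ofReal_mul (by positivity)]
                  apply ENNReal.ofReal_le_ofReal
                  field_simp
                  linarith [pi_le_four]
          · have : ∀ z : E2, S.indicator (fun p => ENNReal.ofReal ((‖p.1‖^2)⁻¹) * ψ p.2) (z, t) = 0 := by
              intro z
              apply indicator_of_notMem
              intro h
              have := h.2.1
              simp only at this
              nlinarith [sq_nonneg ‖z‖]
            simp [this]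
      _ = _ := by rw [lintegral_const_mul _ hψ]
  have : ENNReal.ofReal 8 * (ENNReal.ofReal (1/8) * ∫⁻ σ, ψ ⟪(a:R3), (σ:R3)⟫ ∂sphMeasure) ≤ ENNReal.ofReal 8 * (ENNReal.ofReal 16 * ∫⁻ t, ψ t) := by
    exact mul_le_mul_right (low.trans up) _
  rw [← mul_assoc, ← mul_assoc, ← ENNReal.ofReal_mul (by norm_num), ← ENNReal.ofReal_mul (by norm_num)] at this
  norm_num at this ⊢
  exact this

theorem lintegral_affine (ψ : ℝ → ENNReal) (hψ : Measurable ψ) (c r : ℝ) (hr : 0 < r) :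
    ∫⁻ t, ψ (c + r * t) = ENNReal.ofReal (1/r) * ∫⁻ t, ψ t := by
  have h := Real.map_volume_mul_left hr.ne'
  have h1 : ∫⁻ t, ψ (c + r * t) = ∫⁻ t, ψ (c + t) ∂(Measure.map (r * ·) volume) := by
    rw [lintegral_map (by fun_prop) (by fun_prop)]
  rw [h1, h, lintegral_smul_measure, lintegral_add_left_eq_self]
  simp [abs_of_pos hr]

theorem lintegral_hatbox' (a : S2) (ψ : ℝ → ENNReal) (hψ : Measurable ψ) (c r : ℝ) (hr : 0 < r) :
    ∫⁻ σ, ψ (c + r * ⟪(a:R3), (σ:R3)⟫) ∂sphMeasure ≤ ENNReal.ofReal (128/r) * ∫⁻ t, ψ t := by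
  refine (lintegral_hatbox a (fun t => ψ (c + r * t)) (by fun_prop)).trans ?_
  rw [lintegral_affine ψ hψ c r hr, ← mul_assoc, ← ENNReal.ofReal_mul (by norm_num)]
  apply le_of_eq; congr 2; ring

end Part4

section Part5

theorem measurable_vOut : Measurable (fun p : R3 × R3 × S2 => vOut p.1 p.2.1 p.2.2) := by
  unfold vOut; fun_prop

theorem measurable_vOutStar : Measurable (fun p : R3 × R3 × S2 => vOutStar p.1 p.2.1 p.2.2) := by
  unfold vOutStar; fun_prop

@[fun_prop]
theorem meas_vOut {α : Type*} [MeasurableSpace α] {g h : α → R3} {k : α → S2}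
    (hg : Measurable g) (hh : Measurable h) (hk : Measurable k) :
    Measurable (fun x => vOut (g x) (h x) (k x)) :=
  by unfold vOut; fun_prop

@[fun_prop]
theorem meas_vOutStar {α : Type*} [MeasurableSpace α] {g h : α → R3} {k : α → S2}
    (hg : Measurable g) (hh : Measurable h) (hk : Measurable k) :
    Measurable (fun x => vOutStar (g x) (h x) (k x)) :=
  by unfold vOutStar; fun_prop

theorem col_rep (v : R3) (Φ : ℝ → R3 → R3 → ENNReal)
    (hΦ : Measurable (fun p : ℝ × R3 × R3 => Φ p.1 p.2.1 p.2.2)) :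
    ∫⁻ w : R3, (∫⁻ σ, Φ ‖v - w‖ (vOut v w σ) (vOutStar v w σ) ∂sphMeasure) =
    4 * ∫⁻ a, (∫⁻ s : ℝ, ∫⁻ z : E2, ENNReal.ofReal (s / √(s^2+‖z‖^2)) *
      Φ (√(s^2+‖z‖^2)) (v + s • (a:R3)) (v + iota a z)) ∂sphMeasure := by
  have hc : ∀ {α : Type} [MeasurableSpace α] {g : α → ℝ} {h k : α → R3}, Measurable g → Measurable h →
      Measurable k → Measurable (fun x => Φ (g x) (h x) (k x)) := fun hg hh hk =>
    hΦ.comp (hg.prodMk (hh.prodMk hk))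
  rw [← lintegral_add_left_eq_self _ v]
  have h1 : ∀ u : R3, u ≠ 0 → ∫⁻ σ, Φ ‖v - (v+u)‖ (vOut v (v+u) σ) (vOutStar v (v+u) σ) ∂sphMeasure =
      4 * ∫⁻ a, ENNReal.ofReal (⟪u, (a:R3)⟫ / ‖u‖) * Φ ‖u‖ (v + ⟪u, (a:R3)⟫ • (a:R3)) (v + u - ⟪u, (a:R3)⟫ • (a:R3)) ∂sphMeasure := by
    intro u hu
    have hu' : ‖u‖ ≠ 0 := by simpa using hu
    have := lintegral_sphere_refl (‖u‖⁻¹ • u) (by rw [norm_smul]; simp [hu'])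
      (fun σ => Φ ‖u‖ (v + (2⁻¹:ℝ) • u + (‖u‖/2) • σ) (v + (2⁻¹:ℝ) • u - (‖u‖/2) • σ)) (by apply hc <;> fun_prop)
    have e1 : ∀ σ : S2, Φ ‖v - (v+u)‖ (vOut v (v+u) σ) (vOutStar v (v+u) σ) =
       Φ ‖u‖ (v + (2⁻¹:ℝ) • u + (‖u‖/2) • (σ:R3)) (v + (2⁻¹:ℝ) • u - (‖u‖/2) • (σ:R3)) := by
      intro σ
      have : v - (v+u) = -u := by abel
      rw [vOut, vOutStar, this, norm_neg]
      congr 1 <;> module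
    simp_rw [e1]
    rw [this]
    congr 2
    ext a
    rw [inner_smul_left]
    have : ‖u‖ * ‖u‖⁻¹ = 1 := mul_inv_cancel₀ hu'
    simp only [conj_trivial]
    congr 2
    · rw [div_eq_inv_mul]
    · rw [smul_sub, smul_smul, smul_smul, show ‖u‖/2 * (2 * (‖u‖⁻¹ * ⟪u, (a:R3)⟫)) = (‖u‖ * ‖u‖⁻¹) * ⟪u, (a:R3)⟫ by ring,
        show ‖u‖/2 * ‖u‖⁻¹ = (‖u‖ * ‖u‖⁻¹)/2 by ring, this]
      module
    · rw [smul_sub, smul_smul, smul_smul, show ‖u‖/2 * (2 * (‖u‖⁻¹ * ⟪u, (a:R3)⟫)) = (‖u‖ * ‖u‖⁻¹) * ⟪u, (a:R3)⟫ by ring,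
        show ‖u‖/2 * ‖u‖⁻¹ = (‖u‖ * ‖u‖⁻¹)/2 by ring, this]
      module
  have h2 : ∀ᵐ u : R3, u ≠ 0 := by simp [ae_iff]
  have hm : Measurable (fun p : R3 × S2 => ENNReal.ofReal (⟪p.1, (p.2:R3)⟫ / ‖p.1‖) * Φ ‖p.1‖ (v + ⟪p.1, (p.2:R3)⟫ • (p.2:R3)) (v + p.1 - ⟪p.1, (p.2:R3)⟫ • (p.2:R3))) := by
    apply Measurable.mul (by fun_prop)
    apply hc <;> fun_prop
  rw [lintegral_congr_ae (h2.mono h1), lintegral_const_mul _ hm.lintegral_prod_right', lintegral_lintegral_swap hm.aemeasurable]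
  congr 2
  ext a
  rw [lintegral_decomp a]
  · congr 1; ext s; congr 1; ext z
    rw [real_inner_comm, inner_decomp, norm_decomp]
    congr 2
    module
  · exact hm.comp (measurable_id.prodMk measurable_const)

theorem col_le (v : R3) (Φ : ℝ → R3 → R3 → ENNReal)
    (hΦ : Measurable (fun p : ℝ × R3 × R3 => Φ p.1 p.2.1 p.2.2)) (B : S2 → ENNReal)
    (h : ∀ᵐ a : S2 ∂sphMeasure, ∫⁻ s in Ioi (0:ℝ), ∫⁻ z : E2, ENNReal.ofReal (s / √(s^2+‖z‖^2)) *
      Φ (√(s^2+‖z‖^2)) (v + s • (a:R3)) (v + iota a z) ≤ B a) :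
    ∫⁻ w : R3, (∫⁻ σ, Φ ‖v - w‖ (vOut v w σ) (vOutStar v w σ) ∂sphMeasure) ≤ 4 * ∫⁻ a, B a ∂sphMeasure := by
  rw [col_rep v Φ hΦ]
  refine mul_le_mul_right (lintegral_mono_ae ?_) _
  filter_upwards [h] with a ha
  refine le_trans ?_ ha
  rw [← lintegral_indicator measurableSet_Ioi]
  apply lintegral_mono
  intro s
  by_cases hs : 0 < s
  · rw [indicator_of_mem (show s ∈ Ioi (0:ℝ) from hs)]
  · have : ∀ z : E2, ENNReal.ofReal (s / √(s^2+‖z‖^2)) = 0 := fun z =>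
      ENNReal.ofReal_of_nonpos (div_nonpos_of_nonpos_of_nonneg (not_lt.1 hs) (by positivity))
    simp [this]

end Part5

section Part6

theorem polar_tr (v : R3) (k : ℝ → ENNReal) (hk : Measurable k) (h : R3 → ENNReal) (hh : Measurable h) :
    ∫⁻ a, (∫⁻ s in Ioi (0:ℝ), ENNReal.ofReal (s^2) * (k s * h (v + s • (a:R3)))) ∂sphMeasure =
      ∫⁻ x, k ‖x - v‖ * h x := by
  rw [← lintegral_add_left_eq_self _ v, lintegral_polar _ (by fun_prop)]
  congr 1; ext a
  apply setLIntegral_congr_fun measurableSet_Ioi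
  intro s hs
  have : v + s • (a:R3) - v = s • (a:R3) := by abel
  simp only [this, norm_smul, norm_eq_of_mem_sphere, mul_one, Real.norm_of_nonneg (le_of_lt hs)]

theorem jlemma (v : R3) (γ : ℝ) (hγ : 0 ≤ γ) (K : ℝ) (hK : 0 ≤ K) (h : R3 → ENNReal) (hh : Measurable h) :
    ∫⁻ w : R3, (∫⁻ σ, ENNReal.ofReal (‖v - w‖^γ) * h (vOut v w σ) *
        {p : R3 × R3 | ‖p.2 - v‖ ≤ K * ‖p.1 - v‖}.indicator 1 (vOut v w σ, vOutStar v w σ) ∂sphMeasure)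
      ≤ ENNReal.ofReal (16 * K^2 * (1+K)^γ) * ∫⁻ x, ENNReal.ofReal (‖x - v‖^γ) * h x := by
  have hmS : MeasurableSet {p : R3 × R3 | ‖p.2 - v‖ ≤ K * ‖p.1 - v‖} := measurableSet_le (by fun_prop) (by fun_prop)
  refine (col_le v (fun r x y => ENNReal.ofReal (r^γ) * h x * {p : R3 × R3 | ‖p.2 - v‖ ≤ K * ‖p.1 - v‖}.indicator 1 (x,y)) ?_
    (fun a => ∫⁻ s in Ioi (0:ℝ), ENNReal.ofReal (s^2) * (ENNReal.ofReal (4 * K^2 * (1+K)^γ * s^γ) * h (v + s • (a:R3)))) ?_).trans ?_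
  · apply Measurable.mul (by fun_prop)
    exact (measurable_one.indicator hmS).comp measurable_snd
  · refine Filter.Eventually.of_forall fun a => ?_
    apply setLIntegral_mono' measurableSet_Ioi
    intro s hs
    have hs : 0 < s := hs
    calc _ ≤ ∫⁻ z : E2, (Metric.closedBall (0:E2) (K*s)).indicator (fun _ => ENNReal.ofReal (((1+K)*s)^γ) * h (v + s • (a:R3))) z := by
          apply lintegral_mono
          intro z
          beta_reduce
          by_cases hz : ‖z‖ ≤ K * s
          · have hz' : z ∈ Metric.closedBall (0:E2) (K*s) := by simpa using hz
            rw [indicator_of_mem hz']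
            have hr : √(s^2+‖z‖^2) ≤ (1+K)*s := by
              rw [Real.sqrt_le_left (by positivity)]
              nlinarith [norm_nonneg z, mul_nonneg hK hs.le, mul_self_le_mul_self (norm_nonneg z) hz]
            have hsr : s ≤ √(s^2+‖z‖^2) := Real.le_sqrt_of_sq_le (by nlinarith [sq_nonneg ‖z‖])
            calc _ ≤ 1 * (ENNReal.ofReal (((1+K)*s)^γ) * h (v + s • (a:R3)) * 1) := by
                  gcongr
                  · rw [ENNReal.ofReal_le_one]
                    exact div_le_one_of_le₀ hsr (by positivity)
                  · exact indicator_le_self' (fun _ _ => zero_le) _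
              _ = _ := by ring
          · have : (v + s • (a:R3), v + iota a z) ∉ {p : R3 × R3 | ‖p.2 - v‖ ≤ K * ‖p.1 - v‖} := by
              simpa [norm_smul, abs_of_pos hs] using hz
            rw [indicator_of_notMem this]; simp
      _ ≤ _ := by
          rw [lintegral_indicator measurableSet_closedBall, setLIntegral_const, EuclideanSpace.volume_closedBall_fin_two,
            mul_right_comm, ← mul_assoc (ENNReal.ofReal (s^2))]
          refine mul_le_mul_left ?_ _
          rw [← ENNReal.ofReal_pow (by positivity), ← ENNReal.ofReal_mul (by positivity), ← ENNReal.ofReal_mul (by positivity), ← ENNReal.ofReal_mul (by positivity)]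
          apply ENNReal.ofReal_le_ofReal
          rw [Real.mul_rpow (by positivity) hs.le]
          have : 0 ≤ (1+K)^γ * s^γ * (K*s)^2 := by positivity
          nlinarith [pi_le_four]
  · rw [polar_tr v (fun s => ENNReal.ofReal (4 * K^2 * (1+K)^γ * s^γ)) (by fun_prop) h hh, ← lintegral_const_mul _ (by fun_prop),
      ← lintegral_const_mul _ (by fun_prop)]
    apply lintegral_mono
    intro x
    beta_reduce
    rw [← mul_assoc, ← mul_assoc]
    refine mul_le_mul_left ?_ _
    rw [show (4:ENNReal) = ENNReal.ofReal 4 by simp, ← ENNReal.ofReal_mul (by positivity), ← ENNReal.ofReal_mul (by positivity)]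
    apply ENNReal.ofReal_le_ofReal
    apply le_of_eq; ring

theorem plemma (v : R3) (γ : ℝ) (hγ : 0 ≤ γ) (hγ1 : γ ≤ 1) (h g : R3 → ENNReal) (hh : Measurable h) (hg : Measurable g)
    (Λ : ENNReal) (hΛ : ∀ᵐ a : S2 ∂sphMeasure, ∫⁻ z : E2, g (v + iota a z) ≤ Λ) :
    ∫⁻ w : R3, (∫⁻ σ, ENNReal.ofReal (‖v - w‖^γ) * h (vOut v w σ) * g (vOutStar v w σ) ∂sphMeasure)
      ≤ 4 * Λ * ∫⁻ x, ENNReal.ofReal (‖x - v‖^(γ-2)) * h x := by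
  refine (col_le v (fun r x y => ENNReal.ofReal (r^γ) * h x * g y) (by fun_prop)
    (fun a => ∫⁻ s in Ioi (0:ℝ), ENNReal.ofReal (s^2) * (Λ * ENNReal.ofReal (s^(γ-2)) * h (v + s • (a:R3)))) ?_).trans ?_
  · filter_upwards [hΛ] with a ha
    apply setLIntegral_mono' measurableSet_Ioi
    intro s hs
    have hs : 0 < s := hs
    calc _ ≤ ∫⁻ z : E2, ENNReal.ofReal (s^γ) * h (v + s • (a:R3)) * g (v + iota a z) := by
          apply lintegral_mono
          intro z
          beta_reduce
          rw [← mul_assoc, ← mul_assoc, ← ENNReal.ofReal_mul (by positivity)]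
          gcongr
          have hsr : s ≤ √(s^2+‖z‖^2) := Real.le_sqrt_of_sq_le (by nlinarith [sq_nonneg ‖z‖])
          set r := √(s^2+‖z‖^2)
          have hr : 0 < r := hs.trans_le hsr
          calc s / r * r^γ = s * r^(γ-1) := by rw [Real.rpow_sub hr, Real.rpow_one]; ring
            _ ≤ s * s^(γ-1) := 
                mul_le_mul_of_nonneg_left (Real.rpow_le_rpow_of_nonpos hs hsr (sub_nonpos.2 hγ1)) hs.le
            _ = s^γ := by rw [Real.rpow_sub hs, Real.rpow_one]; field_simp
      _ = ENNReal.ofReal (s^γ) * h (v + s • (a:R3)) * ∫⁻ z : E2, g (v + iota a z) := by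
          rw [lintegral_const_mul]
          have := measurable_iota a
          fun_prop
      _ ≤ ENNReal.ofReal (s^γ) * h (v + s • (a:R3)) * Λ := by gcongr
      _ = _ := by
          have : s^γ = s^2 * s^(γ-2) := by
            rw [Real.rpow_sub hs, Real.rpow_two]; field_simp
          rw [this, ENNReal.ofReal_mul (by positivity)]
          ring
  · rw [polar_tr v (fun s => Λ * ENNReal.ofReal (s^(γ-2))) (by fun_prop) h hh, mul_assoc 4]
    simp_rw [mul_assoc Λ]
    rw [lintegral_const_mul _ (by fun_prop)]

end Part6

section Part7

theorem lintegral_mid (G : R3 → R3 → ENNReal) (hG : Measurable (Function.uncurry G)) :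
    ∫⁻ v, ∫⁻ w, G v w = ∫⁻ m, ∫⁻ u, G (m + (2⁻¹:ℝ) • u) (m - (2⁻¹:ℝ) • u) := by
  have hc : ∀ {α : Type} [MeasurableSpace α] {g h : α → R3}, Measurable g → Measurable h →
      Measurable (fun x => G (g x) (h x)) := fun hg hh => hG.comp (hg.prodMk hh)
  calc _ = ∫⁻ v, ∫⁻ u, G v (v - u) := by
        congr 1; ext v; rw [lintegral_sub_left_eq_self (fun w => G v w) v]
    _ = ∫⁻ u, ∫⁻ v, G v (v - u) := lintegral_lintegral_swap (hc (by fun_prop) (by fun_prop)).aemeasurable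
    _ = ∫⁻ u, ∫⁻ m, G (m + (2⁻¹:ℝ) • u) (m - (2⁻¹:ℝ) • u) := by
        congr 1; ext u
        rw [← lintegral_add_right_eq_self (fun v => G v (v - u)) ((2⁻¹:ℝ) • u)]
        congr 1; ext m; congr 1; module
    _ = _ := lintegral_lintegral_swap (hc (by fun_prop) (by fun_prop)).aemeasurable

theorem swap3 (Ψ : S2 → ℝ → S2 → ENNReal) (hΨ : Measurable (fun p : S2 × ℝ × S2 => Ψ p.1 p.2.1 p.2.2)) :
    ∫⁻ ω, (∫⁻ r in Ioi (0:ℝ), (∫⁻ σ, Ψ ω r σ ∂sphMeasure)) ∂sphMeasure =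
    ∫⁻ ω, (∫⁻ r in Ioi (0:ℝ), (∫⁻ σ, Ψ σ r ω ∂sphMeasure)) ∂sphMeasure := by
  have hc : ∀ {α : Type} [MeasurableSpace α] {g : α → S2} {k : α → ℝ} {h : α → S2}, Measurable g → Measurable k → Measurable h →
      Measurable (fun x => Ψ (g x) (k x) (h x)) := fun hg hk hh => hΨ.comp (hg.prodMk (hk.prodMk hh))
  have h1 : Measurable (fun p : S2 × ℝ => ∫⁻ σ, Ψ p.1 p.2 σ ∂sphMeasure) :=
    Measurable.lintegral_prod_right' (f := fun q : (S2 × ℝ) × S2 => Ψ q.1.1 q.1.2 q.2) (hc (by fun_prop) (by fun_prop) (by fun_prop))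
  have h2 : Measurable (fun p : ℝ × S2 => ∫⁻ σ, Ψ σ p.1 p.2 ∂sphMeasure) :=
    Measurable.lintegral_prod_right' (f := fun q : (ℝ × S2) × S2 => Ψ q.2 q.1.1 q.1.2) (hc (by fun_prop) (by fun_prop) (by fun_prop))
  rw [lintegral_lintegral_swap h1.aemeasurable]
  rw [← lintegral_lintegral_swap (f := fun r ω => ∫⁻ σ, Ψ σ r ω ∂sphMeasure) h2.aemeasurable]
  congr 1; ext r
  exact lintegral_lintegral_swap (hc (by fun_prop) (by fun_prop) (by fun_prop)).aemeasurable

theorem col_mid (Φ : R3 → R3 → R3 → R3 → ENNReal)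
    (hΦ : Measurable (fun p : R3 × R3 × R3 × R3 => Φ p.1 p.2.1 p.2.2.1 p.2.2.2)) :
    ∫⁻ v : R3, ∫⁻ w : R3, (∫⁻ σ, Φ v w (vOut v w σ) (vOutStar v w σ) ∂sphMeasure) =
    ∫⁻ m : R3, (∫⁻ ω, (∫⁻ r in Ioi (0:ℝ), (∫⁻ σ, ENNReal.ofReal (r^2) *
      Φ (m + (r/2) • (ω:R3)) (m - (r/2) • (ω:R3)) (m + (r/2) • (σ:R3)) (m - (r/2) • (σ:R3)) ∂sphMeasure)) ∂sphMeasure) := by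
  have hc : ∀ {α : Type} [MeasurableSpace α] {g h k l : α → R3}, Measurable g → Measurable h → Measurable k → Measurable l →
      Measurable (fun x => Φ (g x) (h x) (k x) (l x)) := fun hg hh hk hl => hΦ.comp (hg.prodMk (hh.prodMk (hk.prodMk hl)))
  rw [lintegral_mid (fun v w => ∫⁻ σ, Φ v w (vOut v w σ) (vOutStar v w σ) ∂sphMeasure)]
  · congr 1; ext m
    rw [lintegral_polar]
    · congr 1; ext ω
      apply setLIntegral_congr_fun measurableSet_Ioi
      intro r hr
      have hr : 0 < r := hr
      beta_reduce
      rw [← lintegral_const_mul _ (by apply hc <;> fun_prop)]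
      congr 1; ext σ
      have e1 : m + (2⁻¹:ℝ) • r • (ω:R3) - (m - (2⁻¹:ℝ) • r • (ω:R3)) = r • (ω:R3) := by module
      have e2 : (2⁻¹:ℝ) • (m + (2⁻¹:ℝ) • r • (ω:R3) + (m - (2⁻¹:ℝ) • r • (ω:R3))) = m := by module
      have e3 : (2⁻¹:ℝ) • r • (ω:R3) = (r/2) • (ω:R3) := by module
      rw [vOut, vOutStar, e1, e2, e3, norm_smul]
      simp [abs_of_pos hr]
    · exact Measurable.lintegral_prod_right' (f := fun q : R3 × S2 => Φ (m + (2⁻¹:ℝ) • q.1) (m - (2⁻¹:ℝ) • q.1) (vOut (m + (2⁻¹:ℝ) • q.1) (m - (2⁻¹:ℝ) • q.1) q.2) (vOutStar (m + (2⁻¹:ℝ) • q.1) (m - (2⁻¹:ℝ) • q.1) q.2))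
        (by apply hc <;> fun_prop)
  · exact Measurable.lintegral_prod_right' (f := fun q : (R3 × R3) × S2 => Φ q.1.1 q.1.2 (vOut q.1.1 q.1.2 q.2) (vOutStar q.1.1 q.1.2 q.2))
        (by apply hc <;> fun_prop)

/-- pre-post collisional change of variables -/
theorem prepost (Φ : R3 → R3 → R3 → R3 → ENNReal)
    (hΦ : Measurable (fun p : R3 × R3 × R3 × R3 => Φ p.1 p.2.1 p.2.2.1 p.2.2.2)) :
    ∫⁻ v : R3, ∫⁻ w : R3, (∫⁻ σ, Φ v w (vOut v w σ) (vOutStar v w σ) ∂sphMeasure) =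
    ∫⁻ v : R3, ∫⁻ w : R3, (∫⁻ σ, Φ (vOut v w σ) (vOutStar v w σ) v w ∂sphMeasure) := by
  have hc : ∀ {α : Type} [MeasurableSpace α] {g h k l : α → R3}, Measurable g → Measurable h → Measurable k → Measurable l →
      Measurable (fun x => Φ (g x) (h x) (k x) (l x)) := fun hg hh hk hl => hΦ.comp (hg.prodMk (hh.prodMk (hk.prodMk hl)))
  rw [col_mid Φ hΦ, col_mid (fun v w x y => Φ x y v w) (by apply hc <;> fun_prop)]
  congr 1; ext m
  rw [swap3]
  refine Measurable.mul (by fun_prop) ?_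
  apply hc <;> fun_prop

theorem col_swap (v w : R3) (Φ : R3 → R3 → ENNReal) (hΦ : Measurable (fun p : R3 × R3 => Φ p.1 p.2)) :
    ∫⁻ σ, Φ (vOut v w σ) (vOutStar v w σ) ∂sphMeasure = ∫⁻ σ, Φ (vOutStar v w σ) (vOut v w σ) ∂sphMeasure := by
  unfold vOut vOutStar
  rw [← lintegral_sphere_neg (fun x => Φ ((2⁻¹ : ℝ) • (v + w) + (‖v - w‖ / 2) • x) ((2⁻¹ : ℝ) • (v + w) - (‖v - w‖ / 2) • x))
    (hΦ.comp (g := fun p : R3 × R3 => Φ p.1 p.2) (f := fun x : R3 => ((2⁻¹ : ℝ) • (v + w) + (‖v - w‖ / 2) • x, (2⁻¹ : ℝ) • (v + w) - (‖v - w‖ / 2) • x)) (by fun_prop))]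
  congr 1; ext σ; congr 1 <;> module

end Part7

section Part8

theorem vOut_sub_sq (v w : R3) (σ : S2) :
    ‖vOut v w σ - v‖^2 = ‖v - w‖^2 / 2 - ‖v - w‖ / 2 * ⟪v - w, (σ:R3)⟫ := by
  have : vOut v w σ - v = (‖v - w‖ / 2) • (σ:R3) - (2⁻¹:ℝ) • (v - w) := by unfold vOut; module
  rw [this, norm_sub_sq_real, norm_smul, norm_smul, inner_smul_left, inner_smul_right, real_inner_comm]
  simp; ring

theorem vOutStar_sub_sq (v w : R3) (σ : S2) :
    ‖vOutStar v w σ - v‖^2 = ‖v - w‖^2 / 2 + ‖v - w‖ / 2 * ⟪v - w, (σ:R3)⟫ := by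
  have : vOutStar v w σ - v = - ((‖v - w‖ / 2) • (σ:R3) + (2⁻¹:ℝ) • (v - w)) := by unfold vOutStar; module
  rw [this, norm_neg, norm_add_sq_real, norm_smul, norm_smul, inner_smul_left, inner_smul_right, real_inner_comm]
  simp; ring

theorem col_pyth (v w : R3) (σ : S2) :
    ‖vOut v w σ - v‖^2 + ‖vOutStar v w σ - v‖^2 = ‖v - w‖^2 := by
  rw [vOut_sub_sq, vOutStar_sub_sq]; ring

theorem col_energy (v w : R3) (σ : S2) :
    ‖vOut v w σ‖^2 + ‖vOutStar v w σ‖^2 = ‖v‖^2 + ‖w‖^2 := by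
  unfold vOut vOutStar
  rw [norm_sub_sq_real, norm_add_sq_real ((2⁻¹:ℝ) • (v+w))]
  have h1 : ‖(2⁻¹:ℝ) • (v+w)‖^2 = (‖v‖^2 + 2 * ⟪v,w⟫ + ‖w‖^2)/4 := by
    rw [norm_smul, mul_pow, norm_add_sq_real]; norm_num; ring
  have h2 : ‖(‖v-w‖/2) • (σ:R3)‖^2 = (‖v‖^2 - 2 * ⟪v,w⟫ + ‖w‖^2)/4 := by
    rw [norm_smul, mul_pow]; simp [div_pow, norm_sub_sq_real]; norm_num
  rw [h1, h2]; ring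

theorem col_rel (v w : R3) (σ : S2) : ‖vOut v w σ - vOutStar v w σ‖ = ‖v - w‖ := by
  have : vOut v w σ - vOutStar v w σ = ‖v-w‖ • (σ:R3) := by unfold vOut vOutStar; module
  rw [this, norm_smul]; simp

theorem band_le (v w : R3) (K : ℝ) (hK : 0 < K) :
    ∫⁻ σ, {p : R3 × R3 | K * ‖p.1 - v‖ < ‖p.2 - v‖}.indicator 1 (vOut v w σ, vOutStar v w σ) ∂sphMeasure
      ≤ ENNReal.ofReal (256 / K^2) := by
  by_cases hvw : v = w
  · subst hvw
    have : ∀ σ : S2, (vOut v v σ, vOutStar v v σ) ∉ {p : R3 × R3 | K * ‖p.1 - v‖ < ‖p.2 - v‖} := by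
      intro σ
      have h1 := vOut_sub_sq v v σ
      have h2 := vOutStar_sub_sq v v σ
      simp at h1 h2
      simp [h1, h2]
    simp [indicator_of_notMem (this _)]
  have hr : 0 < ‖v - w‖ := norm_pos_iff.2 (sub_ne_zero.2 hvw)
  let ω : S2 := ⟨‖v-w‖⁻¹ • (v-w), by simp [norm_smul, hr.ne']⟩
  set ψ : ℝ → ENNReal := (Icc (1 - 2/K^2) 1).indicator 1 with hψ
  refine le_trans ?_ ((lintegral_hatbox ω ψ (measurable_one.indicator measurableSet_Icc)).trans ?_)
  · apply lintegral_mono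
    intro σ
    beta_reduce
    by_cases h : (vOut v w σ, vOutStar v w σ) ∈ {p : R3 × R3 | K * ‖p.1 - v‖ < ‖p.2 - v‖}
    swap
    · rw [indicator_of_notMem h]; exact zero_le
    rw [indicator_of_mem h]
    suffices hm : ⟪(ω:R3), (σ:R3)⟫ ∈ Icc (1 - 2/K^2) 1 by rw [hψ, indicator_of_mem hm]; rfl
    simp only [mem_ofPred_eq] at h
    have hi : ⟪v - w, (σ:R3)⟫ = ‖v-w‖ * ⟪(ω:R3), (σ:R3)⟫ := by
      simp only [ω, inner_smul_left]; simp; field_simp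
    have h1 : K^2 * ‖vOut v w σ - v‖^2 ≤ ‖v-w‖^2 := by
      have h0 : 0 ≤ K * ‖vOut v w σ - v‖ := by positivity
      have := col_pyth v w σ
      nlinarith [norm_nonneg (vOut v w σ - v)]
    rw [vOut_sub_sq, hi] at h1
    constructor
    · rw [sub_le_iff_le_add, ← sub_le_iff_le_add', le_div_iff₀ (by positivity)]
      have : K^2 * (1 - ⟪(ω:R3), (σ:R3)⟫) * ‖v-w‖^2 ≤ 2 * ‖v-w‖^2 := by nlinarith
      have := le_of_mul_le_mul_right this (by positivity)
      linarith
    · have := real_inner_le_norm (ω:R3) (σ:R3)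
      simpa using this
  · rw [hψ, lintegral_indicator_one measurableSet_Icc, Real.volume_Icc, ← ENNReal.ofReal_mul (by norm_num)]
    apply ENNReal.ofReal_le_ofReal
    apply le_of_eq; ring

end Part8

section Part9

/-- collision integral at `v` with weight `r^γ` -/
def CC (γ : ℝ) (v : R3) (X : R3 → S2 → ENNReal) : ENNReal :=
  ∫⁻ w : R3, (∫⁻ σ, ENNReal.ofReal (‖v - w‖^γ) * X w σ ∂sphMeasure)

theorem CC_mono {γ : ℝ} {v : R3} {X Y : R3 → S2 → ENNReal} (h : ∀ w σ, X w σ ≤ Y w σ) : CC γ v X ≤ CC γ v Y :=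
  lintegral_mono fun w => lintegral_mono fun σ => mul_le_mul_right (h w σ) _

theorem CC_add {γ : ℝ} {v : R3} {X Y : R3 → S2 → ENNReal} (hX : Measurable (fun p : R3 × S2 => X p.1 p.2)) :
    CC γ v (fun w σ => X w σ + Y w σ) = CC γ v X + CC γ v Y := by
  unfold CC
  have hX' : Measurable (fun p : R3 × S2 => ENNReal.ofReal (‖v - p.1‖^γ) * X p.1 p.2) := by fun_prop
  rw [← lintegral_add_left hX'.lintegral_prod_right']
  congr 1; ext w
  have hw : Measurable (fun σ : S2 => ENNReal.ofReal (‖v - w‖^γ) * X w σ) := by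
    have hXw : Measurable (fun σ : S2 => X w σ) := hX.comp (measurable_const.prodMk measurable_id)
    fun_prop
  refine Eq.trans ?_ (lintegral_add_left hw _)
  congr 1; ext σ
  rw [mul_add]

theorem CC_smul {γ : ℝ} {v : R3} {X : R3 → S2 → ENNReal} (c : ENNReal) (hX : Measurable (fun p : R3 × S2 => X p.1 p.2)) :
    CC γ v (fun w σ => c * X w σ) = c * CC γ v X := by
  unfold CC
  have hX' : Measurable (fun p : R3 × S2 => ENNReal.ofReal (‖v - p.1‖^γ) * X p.1 p.2) := by fun_prop
  rw [← lintegral_const_mul _ hX'.lintegral_prod_right']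
  congr 1; ext w
  have hw : Measurable (fun σ : S2 => ENNReal.ofReal (‖v - w‖^γ) * X w σ) := by
    have hXw : Measurable (fun σ : S2 => X w σ) := hX.comp (measurable_const.prodMk measurable_id)
    fun_prop
  refine Eq.trans ?_ (lintegral_const_mul _ hw)
  congr 1; ext σ
  ring

def NN (h : R3 → ℝ) : ENNReal := ∫⁻ x, ENNReal.ofReal (|h x| * (1 + ‖x‖^2))

theorem wt_le (γ : ℝ) (h0 : 0 ≤ γ) (h1 : γ ≤ 1) (v x : R3) : ‖x - v‖^γ ≤ 2 * (1 + ‖v‖) * (1 + ‖x‖^2) := by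
  have a1 : ‖x - v‖^γ ≤ 1 + ‖x - v‖ := by
    calc _ ≤ (1 + ‖x-v‖)^γ := Real.rpow_le_rpow (by positivity) (by linarith) h0
      _ ≤ (1 + ‖x-v‖)^(1:ℝ) := Real.rpow_le_rpow_of_exponent_le (by linarith [norm_nonneg (x-v)]) h1
      _ = _ := Real.rpow_one _
  have a2 := norm_sub_le x v
  have a3 := norm_nonneg x
  have a4 := norm_nonneg v
  nlinarith [sq_nonneg (‖x‖-1), mul_nonneg a4 (sq_nonneg ‖x‖)]

theorem wt_int (γ : ℝ) (h0 : 0 ≤ γ) (h1 : γ ≤ 1) (v : R3) (h : R3 → ℝ) :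
    ∫⁻ x, ENNReal.ofReal (‖x - v‖^γ) * ENNReal.ofReal |h x| ≤ ENNReal.ofReal (2 * (1 + ‖v‖)) * NN h := by
  rw [NN, ← lintegral_const_mul' _ _ ENNReal.ofReal_ne_top]
  apply lintegral_mono
  intro x
  beta_reduce
  rw [← ENNReal.ofReal_mul (by positivity), ← ENNReal.ofReal_mul (by positivity)]
  apply ENNReal.ofReal_le_ofReal
  have := mul_le_mul_of_nonneg_right (wt_le γ h0 h1 v x) (abs_nonneg (h x))
  linarith

def Jset (K : ℝ) (v : R3) : Set (R3 × R3) := {p : R3 × R3 | ‖p.2 - v‖ ≤ K * ‖p.1 - v‖}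
def Jset' (K : ℝ) (v : R3) : Set (R3 × R3) := {p : R3 × R3 | K * ‖p.1 - v‖ < ‖p.2 - v‖}
theorem mJset (K : ℝ) (v : R3) : MeasurableSet (Jset K v) := measurableSet_le (by fun_prop) (by fun_prop)
theorem mJset' (K : ℝ) (v : R3) : MeasurableSet (Jset' K v) := measurableSet_lt (by fun_prop) (by fun_prop)
theorem mJi (K : ℝ) (v : R3) : Measurable ((Jset K v).indicator (1 : R3 × R3 → ENNReal)) := measurable_one.indicator (mJset K v)
theorem mJi' (K : ℝ) (v : R3) : Measurable ((Jset' K v).indicator (1 : R3 × R3 → ENNReal)) := measurable_one.indicator (mJset' K v)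

def AK (γ K : ℝ) : ℝ := 16 * K^2 * (1+K)^γ

theorem CC_J (γ : ℝ) (h0 : 0 ≤ γ) (v : R3) (K : ℝ) (hK : 0 ≤ K) (h : R3 → ENNReal) (hh : Measurable h) :
    CC γ v (fun w σ => h (vOut v w σ) * (Jset K v).indicator 1 (vOut v w σ, vOutStar v w σ)) ≤
      ENNReal.ofReal (AK γ K) * ∫⁻ x, ENNReal.ofReal (‖x - v‖^γ) * h x := by
  refine le_trans (le_of_eq ?_) (jlemma v γ h0 K hK h hh)
  unfold CC Jset
  simp_rw [mul_assoc]

theorem CC_swap (γ : ℝ) (v : R3) (Φ : R3 → R3 → R3 → ENNReal) (hΦ : Measurable (fun p : R3 × R3 × R3 => Φ p.1 p.2.1 p.2.2)) :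
    CC γ v (fun w σ => Φ w (vOut v w σ) (vOutStar v w σ)) = CC γ v (fun w σ => Φ w (vOutStar v w σ) (vOut v w σ)) := by
  unfold CC
  congr 1; ext w
  exact col_swap v w (fun x y => ENNReal.ofReal (‖v - w‖^γ) * Φ w x y)
    (Measurable.mul (by fun_prop) (hΦ.comp (g := fun p : R3 × R3 × R3 => Φ p.1 p.2.1 p.2.2) (f := fun p : R3 × R3 => (w, p)) (by fun_prop)))

/-- first component dominated part -/
theorem CC_J1 (γ : ℝ) (h0 : 0 ≤ γ) (h1 : γ ≤ 1) (v : R3) (K : ℝ) (hK : 0 ≤ K) (h : R3 → ℝ) (hh : Measurable h) :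
    CC γ v (fun w σ => ENNReal.ofReal |h (vOut v w σ)| * (Jset K v).indicator 1 (vOut v w σ, vOutStar v w σ)) ≤
      ENNReal.ofReal (AK γ K) * (ENNReal.ofReal (2 * (1 + ‖v‖)) * NN h) :=
  (CC_J γ h0 v K hK (fun x => ENNReal.ofReal |h x|) (by fun_prop)).trans (mul_le_mul_right (wt_int γ h0 h1 v h) _)

theorem CC_J2 (γ : ℝ) (h0 : 0 ≤ γ) (h1 : γ ≤ 1) (v : R3) (K : ℝ) (hK : 0 ≤ K) (h : R3 → ℝ) (hh : Measurable h) :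
    CC γ v (fun w σ => ENNReal.ofReal |h (vOutStar v w σ)| * (Jset K v).indicator 1 (vOutStar v w σ, vOut v w σ)) ≤
      ENNReal.ofReal (AK γ K) * (ENNReal.ofReal (2 * (1 + ‖v‖)) * NN h) := by
  rw [← CC_swap γ v (fun w x y => ENNReal.ofReal |h x| * (Jset K v).indicator 1 (x, y))]
  · exact CC_J1 γ h0 h1 v K hK h hh
  · have := mJi K v; fun_prop

theorem CC_W (γ : ℝ) (v : R3) (h : R3 → ENNReal) (hh : Measurable h) (c : ENNReal)
    (X : R3 → S2 → ENNReal) (hX : Measurable (fun p : R3 × S2 => X p.1 p.2))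
    (hc : ∀ w, ∫⁻ σ, X w σ ∂sphMeasure ≤ c) :
    CC γ v (fun w σ => h w * X w σ) ≤ c * ∫⁻ x, ENNReal.ofReal (‖x - v‖^γ) * h x := by
  unfold CC
  rw [← lintegral_const_mul _ (by fun_prop)]
  apply lintegral_mono
  intro w
  beta_reduce
  simp_rw [← mul_assoc]
  have hw : Measurable (fun σ : S2 => X w σ) := hX.comp (measurable_const.prodMk measurable_id)
  rw [lintegral_const_mul _ hw, mul_comm, norm_sub_rev, mul_assoc c]
  exact mul_le_mul_left (hc w) _

def GE (γ : ℝ) (f : R3 → ℝ) (v : R3) : ENNReal :=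
  CC γ v (fun w σ => ENNReal.ofReal (f (vOut v w σ) * f (vOutStar v w σ) * (1 - f w)))
def LE' (γ : ℝ) (f : R3 → ℝ) (v : R3) : ENNReal :=
  CC γ v (fun w σ => ENNReal.ofReal (f w * (1 - f (vOut v w σ)) * (1 - f (vOutStar v w σ))))
/-- full gain majorant -/
def GF (γ : ℝ) (f : R3 → ℝ) (v : R3) : ENNReal :=
  CC γ v (fun w σ => ENNReal.ofReal (f (vOut v w σ)) * ENNReal.ofReal (f (vOutStar v w σ)))

structure Adm (f : R3 → ℝ) : Prop where
  m : Measurable f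
  n : ∀ v, 0 ≤ f v
  l : ∀ v, f v ≤ 1

theorem GE_le_GF (γ : ℝ) (f : R3 → ℝ) (hf : Adm f) (v : R3) : GE γ f v ≤ GF γ f v := by
  apply CC_mono
  intro w σ
  rw [← ENNReal.ofReal_mul (hf.n _)]
  apply ENNReal.ofReal_le_ofReal
  apply mul_le_of_le_one_right (mul_nonneg (hf.n _) (hf.n _))
  linarith [hf.n w]

theorem Jset_or (v : R3) (K : ℝ) (hK : 0 < K) (x y : R3) : (x,y) ∈ Jset K v ∨ (y,x) ∈ Jset K⁻¹ v := by
  rcases le_or_gt ‖y - v‖ (K * ‖x - v‖) with h | h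
  · exact Or.inl h
  · right
    change ‖x - v‖ ≤ K⁻¹ * ‖y - v‖
    rw [inv_mul_eq_div, le_div_iff₀ hK]; linarith

/-- key splitting -/
theorem split_prod (v : R3) (K : ℝ) (hK : 0 < K) (x y : R3) (p q : ENNReal) (hp : p ≤ 1) (hq : q ≤ 1) :
    p * q ≤ p * (Jset K v).indicator 1 (x,y) + q * (Jset K⁻¹ v).indicator 1 (y,x) := by
  rcases Jset_or v K hK x y with h | h
  · rw [indicator_of_mem h]
    exact le_add_right (mul_le_mul_right hq _)
  · rw [indicator_of_mem h]
    refine le_add_left ?_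
    rw [mul_comm q]
    exact mul_le_mul' hp le_rfl |>.trans (by simp)

theorem GF_prod_le (γ : ℝ) (h0 : 0 ≤ γ) (h1 : γ ≤ 1) (v : R3) (K : ℝ) (hK : 0 < K) (p q : R3 → ℝ)
    (hp : Measurable p) (hq : Measurable q) (hp1 : ∀ x, |p x| ≤ 1) (hq1 : ∀ x, |q x| ≤ 1) :
    CC γ v (fun w σ => ENNReal.ofReal |p (vOut v w σ)| * ENNReal.ofReal |q (vOutStar v w σ)|) ≤
      ENNReal.ofReal (2 * (1 + ‖v‖)) * (ENNReal.ofReal (AK γ K) * NN p + ENNReal.ofReal (AK γ K⁻¹) * NN q) := by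
  refine (CC_mono (fun w σ => split_prod v K hK (vOut v w σ) (vOutStar v w σ) _ _ ?_ ?_)).trans ?_
  · simpa using hp1 _
  · simpa using hq1 _
  rw [CC_add]
  · refine (add_le_add (CC_J1 γ h0 h1 v K hK.le p hp) (CC_J2 γ h0 h1 v K⁻¹ (by positivity) q hq)).trans ?_
    apply le_of_eq; ring
  · have := mJi K v; fun_prop

theorem WP_prod_le (γ : ℝ) (h0 : 0 ≤ γ) (h1 : γ ≤ 1) (v : R3) (K : ℝ) (hK : 0 < K) (p q : R3 → ℝ)
    (hp : Measurable p) (hq : Measurable q) (hp1 : ∀ x, |p x| ≤ 1) (hq1 : ∀ x, |q x| ≤ 1) :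
    CC γ v (fun w σ => ENNReal.ofReal |p (vOut v w σ)| * ENNReal.ofReal |q w|) ≤
      ENNReal.ofReal (2 * (1 + ‖v‖)) * (ENNReal.ofReal (AK γ K) * NN p + ENNReal.ofReal (256 / K^2) * NN q) := by
  refine (CC_mono (Y := fun w σ => ENNReal.ofReal |p (vOut v w σ)| * (Jset K v).indicator 1 (vOut v w σ, vOutStar v w σ) +
     ENNReal.ofReal |q w| * (Jset' K v).indicator 1 (vOut v w σ, vOutStar v w σ)) (fun w σ => ?_)).trans ?_
  · rcases le_or_gt ‖vOutStar v w σ - v‖ (K * ‖vOut v w σ - v‖) with h | h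
    · rw [indicator_of_mem (show (vOut v w σ, vOutStar v w σ) ∈ Jset K v from h)]
      refine le_add_right (mul_le_mul_right ?_ _)
      simpa using hq1 _
    · rw [indicator_of_mem (show (vOut v w σ, vOutStar v w σ) ∈ Jset' K v from h)]
      refine le_add_left ?_
      rw [mul_comm]
      refine (mul_le_mul_right ?_ _)
      simpa using hp1 _
  rw [CC_add]
  · refine (add_le_add (CC_J1 γ h0 h1 v K hK.le p hp) ((CC_W γ v (fun w => ENNReal.ofReal |q w|) (by fun_prop) (ENNReal.ofReal (256/K^2)) (fun w σ => (Jset' K v).indicator 1 (vOut v w σ, vOutStar v w σ)) ?_ ?_).trans (mul_le_mul_right (wt_int γ h0 h1 v q) _))).trans ?_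
    · have := mJi' K v; fun_prop
    · exact fun w => band_le v w K hK
    apply le_of_eq; ring
  · have := mJi K v; fun_prop

theorem W_le (γ : ℝ) (h0 : 0 ≤ γ) (h1 : γ ≤ 1) (v : R3) (q : R3 → ℝ) (hq : Measurable q) :
    CC γ v (fun w _ => ENNReal.ofReal |q w|) ≤
      ENNReal.ofReal (2 * (1 + ‖v‖)) * (sphMeasure univ * NN q) := by
  have := (CC_W γ v (fun w => ENNReal.ofReal |q w|) (by fun_prop) (sphMeasure univ) (fun _ _ => 1) (by fun_prop) (by simp)).trans (mul_le_mul_right (wt_int γ h0 h1 v q) _)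
  simp only [mul_one] at this
  refine this.trans (le_of_eq (by ring))

end Part9

section Part10
open scoped ENNReal

theorem Adm.abs {f : R3 → ℝ} (hf : Adm f) (x : R3) : |f x| = f x := abs_of_nonneg (hf.n x)
theorem Adm.abs_le {f : R3 → ℝ} (hf : Adm f) (x : R3) : |f x| ≤ 1 := by rw [hf.abs]; exact hf.l x
theorem Adm.abs_sub_le {f g : R3 → ℝ} (hf : Adm f) (hg : Adm g) (x : R3) : |f x - g x| ≤ 1 := by
  rw [_root_.abs_le]; constructor <;> linarith [hf.n x, hf.l x, hg.n x, hg.l x]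

theorem AK_inv_le (γ : ℝ) (h0 : 0 ≤ γ) (h1 : γ ≤ 1) (K : ℝ) (hK : 1 ≤ K) : AK γ K⁻¹ ≤ 32 / K^2 := by
  unfold AK
  have h2 : K⁻¹ ≤ 1 := inv_le_one_of_one_le₀ hK
  have h3 : (1+K⁻¹)^γ ≤ 2 := by
    calc _ ≤ (1+K⁻¹)^(1:ℝ) := Real.rpow_le_rpow_of_exponent_le (by simp; linarith) h1
      _ ≤ 2 := by rw [Real.rpow_one]; linarith
  calc _ ≤ 16 * K⁻¹^2 * 2 := by gcongr
    _ = _ := by rw [inv_pow]; ring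

def Err (γ K : ℝ) (v : R3) (n N : ENNReal) : ENNReal :=
  ENNReal.ofReal (2 * (1 + ‖v‖)) * ((2 * ENNReal.ofReal (AK γ K) + sphMeasure univ) * n + ENNReal.ofReal (576 / K^2) * N)

theorem Adm.GF_top {f : R3 → ℝ} (hf : Adm f) (γ : ℝ) (h0 : 0 ≤ γ) (h1 : γ ≤ 1) (v : R3) :
    GF γ f v ≤ ENNReal.ofReal (2 * (1 + ‖v‖)) * (ENNReal.ofReal (2 * AK γ 1) * NN f) := by
  have := GF_prod_le γ h0 h1 v 1 one_pos f f hf.m hf.m hf.abs_le hf.abs_le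
  simp only [hf.abs, inv_one] at this
  refine this.trans (le_of_eq ?_)
  rw [ENNReal.ofReal_mul (by norm_num)]; simp; ring

theorem Adm.LE_top {f : R3 → ℝ} (hf : Adm f) (γ : ℝ) (h0 : 0 ≤ γ) (h1 : γ ≤ 1) (v : R3) :
    LE' γ f v ≤ ENNReal.ofReal (2 * (1 + ‖v‖)) * (sphMeasure univ * NN f) := by
  refine le_trans (CC_mono fun w σ => ?_) (W_le γ h0 h1 v f hf.m)
  apply ENNReal.ofReal_le_ofReal
  rw [hf.abs, mul_assoc]
  apply mul_le_of_le_one_right (hf.n _)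
  have := hf.n (vOut v w σ); have := hf.l (vOut v w σ); have := hf.n (vOutStar v w σ); have := hf.l (vOutStar v w σ)
  nlinarith

theorem GE_diff {f g : R3 → ℝ} (hf : Adm f) (hg : Adm g) (γ : ℝ) (h0 : 0 ≤ γ) (h1 : γ ≤ 1) (v : R3)
    (K : ℝ) (hK : 1 ≤ K) (N : ENNReal) (hfN : NN f ≤ N) (hgN : NN g ≤ N) :
    GE γ f v ≤ GE γ g v + Err γ K v (NN (fun x => f x - g x)) N := by
  have hK0 : 0 < K := by linarith
  have hfm := hf.m
  have hgm := hg.m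
  have hm : Measurable (fun x => f x - g x) := by fun_prop
  refine le_trans (CC_mono (Y := fun w σ => ENNReal.ofReal (g (vOut v w σ) * g (vOutStar v w σ) * (1 - g w)) +
    (ENNReal.ofReal |f (vOut v w σ) - g (vOut v w σ)| * ENNReal.ofReal |f (vOutStar v w σ)| +
    (ENNReal.ofReal |g (vOut v w σ)| * ENNReal.ofReal |f (vOutStar v w σ) - g (vOutStar v w σ)| +
     ENNReal.ofReal |f w - g w|))) fun w σ => ?_) ?_
  · rw [hf.abs, hg.abs, ← ENNReal.ofReal_mul (abs_nonneg _), ← ENNReal.ofReal_mul (hg.n _)]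
    refine le_trans (ENNReal.ofReal_le_ofReal ?_) (ENNReal.ofReal_add_le.trans (add_le_add_right (ENNReal.ofReal_add_le.trans (add_le_add_right (ENNReal.ofReal_add_le) _)) _))
    have a1 := hf.n (vOut v w σ); have a2 := hf.l (vOut v w σ); have a3 := hf.n (vOutStar v w σ); have a4 := hf.l (vOutStar v w σ)
    have b1 := hg.n (vOut v w σ); have b2 := hg.l (vOut v w σ); have b3 := hg.n (vOutStar v w σ); have b4 := hg.l (vOutStar v w σ)
    have c1 := hf.n w; have c2 := hf.l w; have c3 := hg.n w; have c4 := hg.l w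
    generalize f (vOut v w σ) = fx at *
    generalize f (vOutStar v w σ) = fy at *
    generalize g (vOut v w σ) = gx at *
    generalize g (vOutStar v w σ) = gy at *
    generalize f w = fw at *
    generalize g w = gw at *
    have e1 : fx * fy * (1 - fw) - gx * gy * (1 - gw) = (fx - gx) * fy * (1-fw) + gx * (fy - gy) * (1 - fw) + gx * gy * (gw - fw) := by ring
    have e2 : (fx - gx) * fy * (1-fw) ≤ |fx - gx| * fy := by
      have : (fx - gx) * (fy * (1-fw)) ≤ |fx - gx| * (fy * (1-fw)) := mul_le_mul_of_nonneg_right (le_abs_self _) (by apply mul_nonneg <;> linarith)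
      have : |fx - gx| * fy * (1-fw) ≤ |fx - gx| * fy := mul_le_of_le_one_right (by positivity) (by linarith)
      linarith
    have e3 : gx * (fy - gy) * (1 - fw) ≤ gx * |fy - gy| := by
      have : (fy - gy) * (gx * (1-fw)) ≤ |fy - gy| * (gx * (1-fw)) := mul_le_mul_of_nonneg_right (le_abs_self _) (by apply mul_nonneg <;> linarith)
      have : gx * |fy - gy| * (1-fw) ≤ gx * |fy - gy| := mul_le_of_le_one_right (by positivity) (by linarith)
      linarith
    have e4 : gx * gy * (gw - fw) ≤ |fw - gw| := by
      have : gx * gy * (gw - fw) ≤ gx * gy * |fw - gw| := mul_le_mul_of_nonneg_left (by rw [abs_sub_comm]; exact le_abs_self _) (by positivity)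
      have : gx * gy * |fw - gw| ≤ |fw - gw| := mul_le_of_le_one_left (by positivity) (by nlinarith)
      linarith
    linarith
  · rw [CC_add (by fun_prop), CC_add (by fun_prop), CC_add (by fun_prop)]
    refine add_le_add le_rfl ?_
    have t1 := GF_prod_le γ h0 h1 v K hK0 (fun x => f x - g x) f hm hf.m (hf.abs_sub_le hg) hf.abs_le
    have t2 := GF_prod_le γ h0 h1 v K⁻¹ (by positivity) g (fun x => f x - g x) hg.m hm hg.abs_le (hf.abs_sub_le hg)
    have t3 := W_le γ h0 h1 v _ hm
    refine (add_le_add t1 (add_le_add t2 t3)).trans ?_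
    rw [inv_inv]
    set n := NN (fun x => f x - g x)
    unfold Err
    rw [← mul_add, ← mul_add]
    refine mul_le_mul_right ?_ _
    have q : ENNReal.ofReal (AK γ K⁻¹) * NN f + ENNReal.ofReal (AK γ K⁻¹) * NN g ≤ ENNReal.ofReal (576 / K^2) * N := by
      calc _ ≤ ENNReal.ofReal (32 / K^2) * N + ENNReal.ofReal (32 / K^2) * N := by
            have := AK_inv_le γ h0 h1 K hK
            gcongr
        _ = ENNReal.ofReal (64 / K^2) * N := by
            rw [← add_mul, ← ENNReal.ofReal_add (by positivity) (by positivity)]; congr 2; ring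
        _ ≤ _ := by gcongr; norm_num
    calc _ = (2 * ENNReal.ofReal (AK γ K) + sphMeasure univ) * n + (ENNReal.ofReal (AK γ K⁻¹) * NN f + ENNReal.ofReal (AK γ K⁻¹) * NN g) := by ring
      _ ≤ _ := by gcongr

theorem LE_diff {f g : R3 → ℝ} (hf : Adm f) (hg : Adm g) (γ : ℝ) (h0 : 0 ≤ γ) (h1 : γ ≤ 1) (v : R3)
    (K : ℝ) (hK : 1 ≤ K) (N : ENNReal) (hgN : NN g ≤ N) :
    LE' γ f v ≤ LE' γ g v + Err γ K v (NN (fun x => f x - g x)) N := by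
  have hK0 : 0 < K := by linarith
  have hfm := hf.m
  have hgm := hg.m
  have hm : Measurable (fun x => f x - g x) := by fun_prop
  refine le_trans (CC_mono (Y := fun w σ => ENNReal.ofReal (g w * (1 - g (vOut v w σ)) * (1 - g (vOutStar v w σ))) +
    (ENNReal.ofReal |f (vOut v w σ) - g (vOut v w σ)| * ENNReal.ofReal |g w| +
    (ENNReal.ofReal |f (vOutStar v w σ) - g (vOutStar v w σ)| * ENNReal.ofReal |g w| +
     ENNReal.ofReal |f w - g w|))) fun w σ => ?_) ?_
  · rw [hg.abs, ← ENNReal.ofReal_mul (abs_nonneg _), ← ENNReal.ofReal_mul (abs_nonneg _)]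
    refine le_trans (ENNReal.ofReal_le_ofReal ?_) (ENNReal.ofReal_add_le.trans (add_le_add_right (ENNReal.ofReal_add_le.trans (add_le_add_right (ENNReal.ofReal_add_le) _)) _))
    have a1 := hf.n (vOut v w σ); have a2 := hf.l (vOut v w σ); have a3 := hf.n (vOutStar v w σ); have a4 := hf.l (vOutStar v w σ)
    have b1 := hg.n (vOut v w σ); have b2 := hg.l (vOut v w σ); have b3 := hg.n (vOutStar v w σ); have b4 := hg.l (vOutStar v w σ)
    have c1 := hf.n w; have c2 := hf.l w; have c3 := hg.n w; have c4 := hg.l w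
    generalize f (vOut v w σ) = fx at *
    generalize f (vOutStar v w σ) = fy at *
    generalize g (vOut v w σ) = gx at *
    generalize g (vOutStar v w σ) = gy at *
    generalize f w = fw at *
    generalize g w = gw at *
    have e1 : fw * (1 - fx) * (1 - fy) - gw * (1 - gx) * (1 - gy) = (fw - gw) * ((1-fx) * (1-fy)) + gw * (1-fy) * (gx - fx) + gw * (1-gx) * (gy - fy) := by ring
    have e2 : (fw - gw) * ((1-fx) * (1-fy)) ≤ |fw - gw| := by
      have : (fw - gw) * ((1-fx) * (1-fy)) ≤ |fw - gw| * ((1-fx) * (1-fy)) := mul_le_mul_of_nonneg_right (le_abs_self _) (by apply mul_nonneg <;> linarith)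
      have : |fw - gw| * ((1-fx) * (1-fy)) ≤ |fw - gw| := mul_le_of_le_one_right (by positivity) (by nlinarith)
      linarith
    have e3 : gw * (1-fy) * (gx - fx) ≤ |fx - gx| * gw := by
      have : gw * (1-fy) * (gx - fx) ≤ gw * (1-fy) * |fx - gx| := mul_le_mul_of_nonneg_left (by rw [abs_sub_comm]; exact le_abs_self _) (by apply mul_nonneg <;> linarith)
      have : |fx - gx| * gw * (1-fy) ≤ |fx - gx| * gw := mul_le_of_le_one_right (by positivity) (by linarith)
      linarith
    have e4 : gw * (1-gx) * (gy - fy) ≤ |fy - gy| * gw := by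
      have : gw * (1-gx) * (gy - fy) ≤ gw * (1-gx) * |fy - gy| := mul_le_mul_of_nonneg_left (by rw [abs_sub_comm]; exact le_abs_self _) (by apply mul_nonneg <;> linarith)
      have : |fy - gy| * gw * (1-gx) ≤ |fy - gy| * gw := mul_le_of_le_one_right (by positivity) (by linarith)
      linarith
    linarith
  · rw [CC_add (by fun_prop), CC_add (by fun_prop), CC_add (by fun_prop)]
    refine add_le_add le_rfl ?_
    have t1 := WP_prod_le γ h0 h1 v K hK0 (fun x => f x - g x) g hm hg.m (hf.abs_sub_le hg) hg.abs_le
    have t3 := W_le γ h0 h1 v _ hm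
    have t2 := CC_swap γ v (fun w x y => ENNReal.ofReal |f x - g x| * ENNReal.ofReal |g w|) (by fun_prop)
    rw [← t2]
    refine (add_le_add t1 (add_le_add t1 t3)).trans ?_
    set n := NN (fun x => f x - g x)
    unfold Err
    rw [← mul_add, ← mul_add]
    refine mul_le_mul_right ?_ _
    have q : ENNReal.ofReal (256 / K^2) * NN g + ENNReal.ofReal (256 / K^2) * NN g ≤ ENNReal.ofReal (576 / K^2) * N := by
      calc _ = ENNReal.ofReal (512 / K^2) * NN g := by
            rw [← add_mul, ← ENNReal.ofReal_add (by positivity) (by positivity)]; congr 2; ring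
        _ ≤ _ := by gcongr; norm_num
    calc _ = (2 * ENNReal.ofReal (AK γ K) + sphMeasure univ) * n + (ENNReal.ofReal (256 / K^2) * NN g + ENNReal.ofReal (256 / K^2) * NN g) := by ring
      _ ≤ _ := by gcongr

end Part10

section Part11
open scoped ENNReal

theorem cont_abs (φ : ℝ → ENNReal) (hfin : ∀ t, 0 ≤ t → φ t ≠ ⊤)
    (h : ∀ ε : ℝ, 0 < ε → ∀ t, 0 ≤ t → ∃ δ > 0, ∀ s, 0 ≤ s → |s - t| < δ → φ s ≤ φ t + ENNReal.ofReal ε ∧ φ t ≤ φ s + ENNReal.ofReal ε) :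
    ContinuousOn (fun t => (φ t).toReal) (Ici 0) := by
  rw [Metric.continuousOn_iff]
  intro t ht ε hε
  obtain ⟨δ, hδ, H⟩ := h (ε/2) (by positivity) t ht
  refine ⟨δ, hδ, fun s hs hst => ?_⟩
  have hst' : |s - t| < δ := hst
  obtain ⟨a, b⟩ := H s hs hst'
  rw [Real.dist_eq]
  have key : ∀ x y : ENNReal, x ≠ ⊤ → y ≠ ⊤ → x ≤ y + ENNReal.ofReal (ε/2) → x.toReal ≤ y.toReal + ε/2 := by
    intro x y hx hy hxy
    have := ENNReal.toReal_mono (by finiteness) hxy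
    rwa [ENNReal.toReal_add hy (by finiteness), ENNReal.toReal_ofReal (by positivity)] at this
  have a' := key _ _ (hfin s hs) (hfin t ht) a
  have b' := key _ _ (hfin t ht) (hfin s hs) b
  rw [abs_lt]; constructor <;> linarith

theorem Err_small (γ : ℝ) (v : R3) (N : ENNReal) (hN : N ≠ ⊤) (ε : ℝ) (hε : 0 < ε) :
    ∃ K : ℝ, 1 ≤ K ∧ ∃ η > 0, ∀ n ≤ ENNReal.ofReal η, Err γ K v n N ≤ ENNReal.ofReal ε := by
  have := sph_fin
  obtain ⟨A, hA⟩ : ∃ A, A = 2 * (1 + ‖v‖) := ⟨_, rfl⟩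
  have hA0 : 0 < A := by rw [hA]; positivity
  set K := 1 + 1152 * A * N.toReal / ε with hKd
  have hK : 1 ≤ K := by
    have : 0 ≤ 1152 * A * N.toReal / ε := by positivity
    linarith
  set c : ENNReal := 2 * ENNReal.ofReal (AK γ K) + sphMeasure univ with hc
  have hct : c ≠ ⊤ := by rw [hc]; finiteness
  refine ⟨K, hK, ε / (2 * A * (c.toReal + 1)), by positivity, fun n hn => ?_⟩
  unfold Err
  rw [← hA, ← hc, mul_add]
  have e1 : ENNReal.ofReal A * (c * n) ≤ ENNReal.ofReal (ε/2) := by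
    calc _ ≤ ENNReal.ofReal A * (ENNReal.ofReal (c.toReal) * ENNReal.ofReal (ε / (2 * A * (c.toReal + 1)))) := by
          rw [ENNReal.ofReal_toReal hct]; gcongr
      _ = ENNReal.ofReal (A * (c.toReal * (ε / (2 * A * (c.toReal + 1))))) := by
          rw [ENNReal.ofReal_mul hA0.le, ENNReal.ofReal_mul (by positivity)]
      _ ≤ _ := by
          apply ENNReal.ofReal_le_ofReal
          have : A * (c.toReal * (ε / (2 * A * (c.toReal + 1)))) = ε/2 * (c.toReal / (c.toReal+1)) := by field_simp
          rw [this]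
          apply mul_le_of_le_one_right (by positivity)
          rw [div_le_one (by positivity)]; linarith
  have e2 : ENNReal.ofReal A * (ENNReal.ofReal (576 / K^2) * N) ≤ ENNReal.ofReal (ε/2) := by
    calc _ = ENNReal.ofReal (A * (576 / K^2 * N.toReal)) := by
          rw [ENNReal.ofReal_mul hA0.le, ENNReal.ofReal_mul (by positivity), ENNReal.ofReal_toReal hN]
      _ ≤ _ := by
          apply ENNReal.ofReal_le_ofReal
          have h1 : A * (576 / K^2 * N.toReal) ≤ A * (576 / K * N.toReal) := by
            gcongr; nlinarith
          refine h1.trans ?_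
          have : A * (576 / K * N.toReal) = (A * 576 * N.toReal) / K := by field_simp
          rw [this, div_le_iff₀ (by linarith)]
          have : ε/2 * K = ε/2 + 576 * A * N.toReal := by rw [hKd]; field_simp; ring
          rw [this]; nlinarith
  calc _ ≤ ENNReal.ofReal (ε/2) + ENNReal.ofReal (ε/2) := add_le_add e1 e2
    _ = _ := by rw [← ENNReal.ofReal_add (by positivity) (by positivity)]; congr 1; ring

/-- the extracted basic regularity data of a solution -/
structure Reg (f : ℝ → R3 → ℝ) (N : ENNReal) : Prop where
  top : N ≠ ⊤
  adm : ∀ t, 0 ≤ t → Adm (f t)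
  nn : ∀ t, 0 ≤ t → NN (f t) ≤ N
  cont : ∀ t, 0 ≤ t → ∀ ε : ℝ, 0 < ε → ∃ δ > 0, ∀ s, 0 ≤ s → |s - t| < δ → NN (fun v => f s v - f t v) ≤ ENNReal.ofReal ε

theorem NN_symm (f g : R3 → ℝ) : NN (fun v => f v - g v) = NN (fun v => g v - f v) := by
  unfold NN; simp_rw [abs_sub_comm]

theorem Reg.GE_fin {f : ℝ → R3 → ℝ} {N : ENNReal} (hf : Reg f N) (γ : ℝ) (h0 : 0 ≤ γ) (h1 : γ ≤ 1) (v : R3)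
    (t : ℝ) (ht : 0 ≤ t) : GE γ (f t) v ≠ ⊤ := by
  have := hf.top
  have h2 := hf.nn t ht
  refine ne_top_of_le_ne_top (b := ENNReal.ofReal (2 * (1 + ‖v‖)) * (ENNReal.ofReal (2 * AK γ 1) * N)) (by finiteness) ?_
  exact (GE_le_GF γ _ (hf.adm t ht) v).trans (((hf.adm t ht).GF_top γ h0 h1 v).trans (by gcongr))

theorem Reg.LE_fin {f : ℝ → R3 → ℝ} {N : ENNReal} (hf : Reg f N) (γ : ℝ) (h0 : 0 ≤ γ) (h1 : γ ≤ 1) (v : R3)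
    (t : ℝ) (ht : 0 ≤ t) : LE' γ (f t) v ≠ ⊤ := by
  have := sph_fin
  have := hf.top
  have h2 := hf.nn t ht
  refine ne_top_of_le_ne_top (b := ENNReal.ofReal (2 * (1 + ‖v‖)) * (sphMeasure univ * N)) (by finiteness) ?_
  exact (((hf.adm t ht).LE_top γ h0 h1 v).trans (by gcongr))

theorem Reg.GE_cont {f : ℝ → R3 → ℝ} {N : ENNReal} (hf : Reg f N) (γ : ℝ) (h0 : 0 ≤ γ) (h1 : γ ≤ 1) (v : R3) :
    ContinuousOn (fun t => (GE γ (f t) v).toReal) (Ici 0) := by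
  refine cont_abs _ (hf.GE_fin γ h0 h1 v) fun ε hε t ht => ?_
  obtain ⟨K, hK, η, hη, H⟩ := Err_small γ v N hf.top ε hε
  obtain ⟨δ, hδ, H2⟩ := hf.cont t ht η hη
  refine ⟨δ, hδ, fun s hs hst => ?_⟩
  have h3 := H2 s hs hst
  constructor
  · exact (GE_diff (hf.adm s hs) (hf.adm t ht) γ h0 h1 v K hK N (hf.nn s hs) (hf.nn t ht)).trans (add_le_add_right (H _ h3) _)
  · exact (GE_diff (hf.adm t ht) (hf.adm s hs) γ h0 h1 v K hK N (hf.nn t ht) (hf.nn s hs)).trans (add_le_add_right (H _ (by rw [NN_symm]; exact h3)) _)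

theorem Reg.LE_cont {f : ℝ → R3 → ℝ} {N : ENNReal} (hf : Reg f N) (γ : ℝ) (h0 : 0 ≤ γ) (h1 : γ ≤ 1) (v : R3) :
    ContinuousOn (fun t => (LE' γ (f t) v).toReal) (Ici 0) := by
  refine cont_abs _ (hf.LE_fin γ h0 h1 v) fun ε hε t ht => ?_
  obtain ⟨K, hK, η, hη, H⟩ := Err_small γ v N hf.top ε hε
  obtain ⟨δ, hδ, H2⟩ := hf.cont t ht η hη
  refine ⟨δ, hδ, fun s hs hst => ?_⟩
  have h3 := H2 s hs hst
  constructor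
  · exact (LE_diff (hf.adm s hs) (hf.adm t ht) γ h0 h1 v K hK N (hf.nn t ht)).trans (add_le_add_right (H _ h3) _)
  · exact (LE_diff (hf.adm t ht) (hf.adm s hs) γ h0 h1 v K hK N (hf.nn s hs)).trans (add_le_add_right (H _ (by rw [NN_symm]; exact h3)) _)

end Part11

section Part12
open scoped ENNReal

theorem CC_real (γ : ℝ) (v : R3) (X : R3 → S2 → ℝ) (hX : Measurable (fun p : R3 × S2 => X p.1 p.2))
    (h0 : ∀ w σ, 0 ≤ X w σ) (h1 : ∀ w σ, X w σ ≤ 1) (ht : CC γ v (fun w σ => ENNReal.ofReal (X w σ)) ≠ ⊤) :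
    (∀ w, Integrable (fun σ => X w σ) sphMeasure) ∧
    Integrable (fun w => ‖v - w‖^γ * ∫ σ, X w σ ∂sphMeasure) ∧
    ∫ w, ‖v - w‖^γ * ∫ σ, X w σ ∂sphMeasure = (CC γ v (fun w σ => ENNReal.ofReal (X w σ))).toReal := by
  have := sph_fin
  have hXw : ∀ w, Measurable (fun σ => X w σ) := fun w => hX.comp (measurable_const.prodMk measurable_id)
  have i1 : ∀ w, Integrable (fun σ => X w σ) sphMeasure := by
    intro w
    refine Integrable.mono' (integrable_const (1:ℝ)) (hXw w).aestronglyMeasurable ?_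
    filter_upwards with σ
    rw [Real.norm_eq_abs, abs_of_nonneg (h0 w σ)]; exact h1 w σ
  have e : CC γ v (fun w σ => ENNReal.ofReal (X w σ)) = ∫⁻ w, ENNReal.ofReal (‖v - w‖^γ * ∫ σ, X w σ ∂sphMeasure) := by
    unfold CC
    congr 1; ext w
    rw [lintegral_const_mul' _ _ ENNReal.ofReal_ne_top, ENNReal.ofReal_mul (by positivity), ofReal_integral_eq_lintegral_ofReal (i1 w) (by filter_upwards with σ; exact h0 w σ)]
  have hsm : StronglyMeasurable (fun w => ∫ σ, X w σ ∂sphMeasure) := by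
    have : SFinite sphMeasure := inferInstance
    exact (hX.stronglyMeasurable).integral_prod_right
  have hn : ∀ w, 0 ≤ ‖v - w‖^γ * ∫ σ, X w σ ∂sphMeasure := fun w => mul_nonneg (by positivity) (integral_nonneg (h0 w))
  have hmm : Measurable (fun w => ‖v - w‖^γ * ∫ σ, X w σ ∂sphMeasure) := by
    have := hsm.measurable
    fun_prop
  refine ⟨i1, ?_, ?_⟩
  · refine ⟨hmm.aestronglyMeasurable, ?_⟩
    rw [hasFiniteIntegral_iff_ofReal (by filter_upwards with w; exact hn w), ← e]
    exact lt_top_iff_ne_top.2 ht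
  · rw [integral_eq_lintegral_of_nonneg_ae (by filter_upwards with w; exact hn w) hmm.aestronglyMeasurable, e]

theorem QFD_eq (γ : ℝ) (b : ℝ → ℝ) (β : ℝ) (hb : ∀ x, b x = β) (f : R3 → ℝ) (hf : Adm f) (v : R3)
    (hG : GE γ f v ≠ ⊤) (hL : LE' γ f v ≠ ⊤) :
    QFD γ b f v = β * ((GE γ f v).toReal * (1 - f v)) - f v * (β * (LE' γ f v).toReal) := by
  have hfm := hf.m
  obtain ⟨a1, a2, a3⟩ := CC_real γ v (fun w σ => f (vOut v w σ) * f (vOutStar v w σ) * (1 - f w)) (by fun_prop)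
    (fun w σ => mul_nonneg (mul_nonneg (hf.n _) (hf.n _)) (by linarith [hf.l w]))
    (fun w σ => by
      have := hf.n (vOut v w σ); have := hf.l (vOut v w σ); have := hf.n (vOutStar v w σ); have := hf.l (vOutStar v w σ)
      have := hf.n w; have := hf.l w
      have : f (vOut v w σ) * f (vOutStar v w σ) ≤ 1 := by nlinarith
      have : 0 ≤ f (vOut v w σ) * f (vOutStar v w σ) := by positivity
      nlinarith) hG
  obtain ⟨b1, b2, b3⟩ := CC_real γ v (fun w σ => f w * (1 - f (vOut v w σ)) * (1 - f (vOutStar v w σ))) (by fun_prop)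
    (fun w σ => mul_nonneg (mul_nonneg (hf.n _) (by linarith [hf.l (vOut v w σ)])) (by linarith [hf.l (vOutStar v w σ)]))
    (fun w σ => by
      have := hf.n (vOut v w σ); have := hf.l (vOut v w σ); have := hf.n (vOutStar v w σ); have := hf.l (vOutStar v w σ)
      have := hf.n w; have := hf.l w
      have : f w * (1 - f (vOut v w σ)) ≤ 1 := by nlinarith
      have : 0 ≤ f w * (1 - f (vOut v w σ)) := mul_nonneg (by assumption) (by linarith)
      nlinarith) hL
  unfold QFD
  have e : ∀ w, (∫ σ : S2, Bker γ b v w σ *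
      (f (vOut v w σ) * f (vOutStar v w σ) * (1 - f v) * (1 - f w)
        - f v * f w * (1 - f (vOut v w σ)) * (1 - f (vOutStar v w σ))) ∂sphMeasure) =
      (β * (1 - f v)) * (‖v - w‖^γ * ∫ σ, f (vOut v w σ) * f (vOutStar v w σ) * (1 - f w) ∂sphMeasure) -
      (β * f v) * (‖v - w‖^γ * ∫ σ, f w * (1 - f (vOut v w σ)) * (1 - f (vOutStar v w σ)) ∂sphMeasure) := by
    intro w
    rw [← mul_assoc, ← mul_assoc, ← integral_const_mul, ← integral_const_mul, ← integral_sub ((a1 w).const_mul _) ((b1 w).const_mul _)]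
    congr 1; ext σ
    unfold Bker; rw [hb]; ring
  simp_rw [e]
  rw [integral_sub (a2.const_mul _) (b2.const_mul _), integral_const_mul, integral_const_mul, a3, b3]
  unfold GE LE'; ring

/-- conversion of the solution hypotheses -/
theorem NN_wnorm (h : R3 → ℝ) (hh : Integrable (fun v : R3 => |h v| * (1 + ‖v‖ ^ 2) ^ ((2:ℝ) / 2))) :
    NN h = ENNReal.ofReal (wnorm 2 h) := by
  unfold wnorm NN
  rw [ofReal_integral_eq_lintegral_ofReal hh (by filter_upwards with x; positivity)]
  norm_num

theorem IsFDSolution.reg {γ : ℝ} {b : ℝ → ℝ} {f₀ : R3 → ℝ} {f : ℝ → R3 → ℝ} (hf : IsFDSolution γ b f₀ f) :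
    ∃ N, Reg f N ∧ ∀ t, 0 ≤ t → (∫⁻ v, ENNReal.ofReal (f t v) = ENNReal.ofReal (∫ v, f₀ v)) ∧
      (∫⁻ v, ENNReal.ofReal (f t v * ‖v‖^2) = ENNReal.ofReal (∫ v, f₀ v * ‖v‖^2)) := by
  have hadm : ∀ t, 0 ≤ t → Adm (f t) := fun t ht => ⟨hf.measurable t, hf.nonneg t ht, hf.le_one t ht⟩
  have hi : ∀ t, 0 ≤ t → Integrable (fun v => f t v * (1 + ‖v‖^2)) := by
    intro t ht
    have := hf.memL12 t ht
    unfold MemL1s at this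
    norm_num at this
    refine this.congr ?_
    filter_upwards with v; rw [(hadm t ht).abs]
  have hi1 : ∀ t, 0 ≤ t → Integrable (f t) := by
    intro t ht
    refine (hi t ht).mono' (hf.measurable t).aestronglyMeasurable ?_
    filter_upwards with v
    rw [Real.norm_eq_abs, (hadm t ht).abs]
    exact le_mul_of_one_le_right ((hadm t ht).n v) (by nlinarith [sq_nonneg ‖v‖])
  have hi2 : ∀ t, 0 ≤ t → Integrable (fun v => f t v * ‖v‖^2) := by
    intro t ht
    have := hf.measurable t
    refine (hi t ht).mono' (by fun_prop) ?_
    filter_upwards with v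
    have := (hadm t ht).n v
    rw [Real.norm_eq_abs, abs_of_nonneg (by positivity)]
    nlinarith
  have hme : ∀ t, 0 ≤ t → (∫⁻ v, ENNReal.ofReal (f t v) = ENNReal.ofReal (∫ v, f₀ v)) ∧
      (∫⁻ v, ENNReal.ofReal (f t v * ‖v‖^2) = ENNReal.ofReal (∫ v, f₀ v * ‖v‖^2)) := by
    intro t ht
    rw [← hf.mass t ht, ← hf.energy t ht, ofReal_integral_eq_lintegral_ofReal (hi1 t ht) (by filter_upwards with v; exact (hadm t ht).n v),
      ofReal_integral_eq_lintegral_ofReal (hi2 t ht) (by filter_upwards with v; have := (hadm t ht).n v; positivity)]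
    exact ⟨rfl, rfl⟩
  refine ⟨ENNReal.ofReal (∫ v, f₀ v) + ENNReal.ofReal (∫ v, f₀ v * ‖v‖^2), ⟨by finiteness, hadm, ?_, ?_⟩, hme⟩
  · intro t ht
    obtain ⟨a, b⟩ := hme t ht
    have := hf.measurable t
    rw [← a, ← b, ← lintegral_add_left (by fun_prop)]
    unfold NN
    apply lintegral_mono
    intro v
    beta_reduce
    have := (hadm t ht).n v
    rw [(hadm t ht).abs, ← ENNReal.ofReal_add (by positivity) (by positivity)]
    apply ENNReal.ofReal_le_ofReal; linarith
  · intro t ht ε hε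
    obtain ⟨δ, hδ, H⟩ := hf.contL12 t ht ε hε
    refine ⟨δ, hδ, fun s hs hst => ?_⟩
    have h1 := H s hs hst
    rw [NN_wnorm]
    · exact ENNReal.ofReal_le_ofReal h1.le
    · have m1 := hf.measurable t
      have m2 := hf.measurable s
      refine ((hi s hs).add (hi t ht)).mono' (by fun_prop) ?_
      filter_upwards with v
      have a1 := (hadm t ht).n v
      have a2 := (hadm s hs).n v
      have : |f s v - f t v| ≤ f s v + f t v := by rw [abs_le]; constructor <;> linarith
      norm_num
      rw [abs_of_nonneg (by positivity : 0 ≤ 1 + ‖v‖^2), ← add_mul]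
      gcongr

end Part12

section Part13
open scoped ENNReal

theorem ode_cont (y F g Λ : ℝ → ℝ) (y0 : ℝ) (h0 : ∀ t, 0 ≤ t → 0 ≤ y t) (h1 : ∀ t, 0 ≤ t → y t ≤ 1)
    (hg : ContinuousOn g (Ici 0)) (hΛ : ContinuousOn Λ (Ici 0))
    (hF : ∀ t, 0 ≤ t → F t = g t * (1 - y t) - y t * Λ t)
    (hy : ∀ t, 0 ≤ t → y t = y0 + ∫ τ in (0:ℝ)..t, F τ) : ContinuousOn y (Ici 0) := by
  have prim : ∀ T, 0 ≤ T → IntervalIntegrable F volume 0 T → ContinuousOn y (Icc 0 T) := by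
    intro T hT hi
    have := intervalIntegral.continuousOn_primitive_interval' hi left_mem_uIcc
    rw [uIcc_of_le hT] at this
    have h2 : ContinuousOn (fun t => y0 + ∫ τ in (0:ℝ)..t, F τ) (Icc 0 T) := continuousOn_const.add this
    exact h2.congr fun t ht => hy t ht.1
  suffices H : ∀ T, 0 ≤ T → IntervalIntegrable F volume 0 T by
    intro t ht
    have ht' : (0:ℝ) ≤ t := ht
    have := prim (t+1) (by linarith) (H _ (by linarith)) t ⟨ht, by linarith⟩
    refine this.mono_of_mem_nhdsWithin ?_
    rw [mem_nhdsWithin]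
    exact ⟨Iio (t+1), isOpen_Iio, by simp, fun x hx => ⟨hx.2, hx.1.le⟩⟩
  intro T hT
  set S : Set ℝ := {t | 0 ≤ t ∧ IntervalIntegrable F volume 0 t} with hS
  have hdown : ∀ a b, 0 ≤ a → a ≤ b → b ∈ S → a ∈ S := by
    intro a b ha hab hb
    refine ⟨ha, hb.2.mono_set ?_⟩
    rw [uIcc_of_le ha, uIcc_of_le hb.1]; exact Icc_subset_Icc_right hab
  have hoc : S.OrdConnected := by
    constructor
    intro a ha b hb c hc
    exact hdown c b (ha.1.trans hc.1) hc.2 hb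
  have hcS : ContinuousOn y S := by
    intro t ht
    by_cases hex : ∃ t1 ∈ S, t < t1
    · obtain ⟨t1, ht1, hlt⟩ := hex
      have := prim t1 ht1.1 ht1.2 t ⟨ht.1, hlt.le⟩
      refine this.mono_of_mem_nhdsWithin ?_
      rw [mem_nhdsWithin]
      exact ⟨Iio t1, isOpen_Iio, hlt, fun x hx => ⟨hx.2.1, hx.1.le⟩⟩
    · push Not at hex
      exact (prim t ht.1 ht.2 t ⟨ht.1, le_rfl⟩).mono fun x hx => ⟨hx.1, hex x hx⟩
  classical
  have hm : Measurable (S.piecewise y (fun _ => y0)) := hcS.measurable_piecewise continuousOn_const hoc.measurableSet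
  have heq : ∀ t, 0 ≤ t → y t = S.piecewise y (fun _ => y0) t := by
    intro t ht
    by_cases hts : t ∈ S
    · simp [hts]
    · rw [Set.piecewise_eq_of_notMem _ _ _ hts, hy t ht, intervalIntegral.integral_undef, add_zero]
      intro hi; exact hts ⟨ht, hi⟩
  have hym : AEStronglyMeasurable y (volume.restrict (Icc 0 T)) := by
    refine ⟨_, hm.stronglyMeasurable, ?_⟩
    filter_upwards [ae_restrict_mem measurableSet_Icc] with t ht
    exact heq t ht.1
  have hgi : IntegrableOn g (Icc 0 T) := (hg.mono Icc_subset_Ici_self).integrableOn_Icc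
  have hΛi : IntegrableOn Λ (Icc 0 T) := (hΛ.mono Icc_subset_Ici_self).integrableOn_Icc
  have : IntegrableOn (fun t => g t * (1 - y t) - y t * Λ t) (Icc 0 T) := by
    have m1 : AEStronglyMeasurable (fun t => 1 - y t) (volume.restrict (Icc 0 T)) := aestronglyMeasurable_const.sub hym
    refine Integrable.sub ?_ ?_
    · refine Integrable.mono hgi (hgi.1.mul m1) ?_
      filter_upwards [ae_restrict_mem measurableSet_Icc] with t ht
      rw [norm_mul]
      apply mul_le_of_le_one_right (norm_nonneg _)
      rw [Real.norm_eq_abs, abs_le]; constructor <;> linarith [h0 t ht.1, h1 t ht.1]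
    · refine Integrable.mono hΛi (hym.mul hΛi.1) ?_
      filter_upwards [ae_restrict_mem measurableSet_Icc] with t ht
      rw [norm_mul]
      apply mul_le_of_le_one_left (norm_nonneg _)
      rw [Real.norm_eq_abs, abs_le]; constructor <;> linarith [h0 t ht.1, h1 t ht.1]
  rw [intervalIntegrable_iff_integrableOn_Icc_of_le hT]
  exact this.congr_fun (fun t ht => (hF t ht.1).symm) measurableSet_Icc

theorem ode_duhamel (y F g Λ : ℝ → ℝ) (y0 : ℝ) (h0 : ∀ t, 0 ≤ t → 0 ≤ y t)
    (hyc : ContinuousOn y (Ici 0))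
    (hg : ContinuousOn g (Ici 0)) (hΛ : ContinuousOn Λ (Ici 0)) (hg0 : ∀ t, 0 ≤ t → 0 ≤ g t)
    (hF : ∀ t, 0 ≤ t → F t = g t * (1 - y t) - y t * Λ t)
    (hy : ∀ t, 0 ≤ t → y t = y0 + ∫ τ in (0:ℝ)..t, F τ) (t lam : ℝ) (ht : 0 ≤ t)
    (hl : ∀ τ, 0 ≤ τ → τ ≤ t → lam ≤ Λ τ) :
    Real.exp (lam * t) * y t ≤ y0 + ∫ τ in (0:ℝ)..t, Real.exp (lam * τ) * g τ := by
  have hFc : ContinuousOn F (Ici 0) := by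
    have : ContinuousOn (fun t => g t * (1 - y t) - y t * Λ t) (Ici 0) := (hg.mul (continuousOn_const.sub hyc)).sub (hyc.mul hΛ)
    exact this.congr fun x hx => hF x hx
  set e := fun τ => Real.exp (lam * τ) * g τ with he
  have hec : ContinuousOn e (Ici 0) := by
    have : Continuous (fun τ => Real.exp (lam * τ)) := by fun_prop
    exact this.continuousOn.mul hg
  have der : ∀ (G : ℝ → ℝ), ContinuousOn G (Ici 0) → ∀ x, 0 < x → HasDerivAt (fun u => ∫ τ in (0:ℝ)..u, G τ) (G x) x := by
    intro G hG x hx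
    refine intervalIntegral.integral_hasDerivAt_right ?_ ?_ (hG.continuousAt (Ici_mem_nhds hx))
    · exact ContinuousOn.intervalIntegrable (hG.mono (by rw [uIcc_of_le hx.le]; exact Icc_subset_Ici_self))
    · exact (hG.mono Ioi_subset_Ici_self).stronglyMeasurableAtFilter isOpen_Ioi x hx
  set H := fun u => Real.exp (lam * u) * y u - ∫ τ in (0:ℝ)..u, e τ with hH
  have hHd : ∀ x, 0 < x → HasDerivAt H (Real.exp (lam * x) * lam * y x + Real.exp (lam * x) * F x - e x) x := by
    intro x hx
    have d1 : HasDerivAt (fun u => Real.exp (lam * u)) (Real.exp (lam * x) * lam) x := by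
      have := ((hasDerivAt_id x).const_mul lam).exp
      simpa using this
    have d2 : HasDerivAt y (F x) x := by
      have := (der F hFc x hx).const_add y0
      refine this.congr_of_eventuallyEq ?_
      filter_upwards [Ioi_mem_nhds hx] with u hu
      exact hy u (le_of_lt hu)
    exact (d1.mul d2).sub (der e hec x hx)
  have hanti : AntitoneOn H (Icc 0 t) := by
    apply antitoneOn_of_deriv_nonpos (convex_Icc 0 t)
    · refine ContinuousOn.sub ?_ ?_
      · have : Continuous (fun τ => Real.exp (lam * τ)) := by fun_prop
        exact this.continuousOn.mul (hyc.mono Icc_subset_Ici_self)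
      · have hi : IntervalIntegrable e volume 0 t := ContinuousOn.intervalIntegrable (hec.mono (by rw [uIcc_of_le ht]; exact Icc_subset_Ici_self))
        have := intervalIntegral.continuousOn_primitive_interval' hi left_mem_uIcc
        rwa [uIcc_of_le ht] at this
    · intro x hx
      rw [interior_Icc] at hx
      exact (hHd x hx.1).differentiableAt.differentiableWithinAt
    · intro x hx
      rw [interior_Icc] at hx
      rw [(hHd x hx.1).deriv, hF x hx.1.le, he]
      have := hl x hx.1.le hx.2.le
      have h2 := h0 x hx.1.le
      have h3 := hg0 x hx.1.le
      have h4 := Real.exp_pos (lam * x)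
      have : Real.exp (lam * x) * lam * y x + Real.exp (lam * x) * (g x * (1 - y x) - y x * Λ x) - Real.exp (lam * x) * g x = - (Real.exp (lam * x) * (y x * (Λ x - lam) + g x * y x)) := by ring
      simp only
      rw [this]
      have : 0 ≤ y x * (Λ x - lam) + g x * y x := add_nonneg (mul_nonneg h2 (by linarith)) (mul_nonneg h3 h2)
      nlinarith [mul_nonneg h4.le this]
  have := hanti (left_mem_Icc.2 ht) (right_mem_Icc.2 ht) ht
  simp only [hH, mul_zero, Real.exp_zero, intervalIntegral.integral_same, one_mul, sub_zero] at this
  have h5 := hy 0 le_rfl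
  simp at h5
  linarith

end Part13

section Part14
open scoped ENNReal

theorem CC_meas (γ : ℝ) (X : R3 → R3 → S2 → ENNReal) (hX : Measurable (fun p : (R3 × R3) × S2 => X p.1.1 p.1.2 p.2)) :
    Measurable (fun v => CC γ v (X v)) := by
  have := sph_fin
  unfold CC
  have h1 : Measurable (fun p : (R3 × R3) × S2 => ENNReal.ofReal (‖p.1.1 - p.1.2‖^γ) * X p.1.1 p.1.2 p.2) :=
    Measurable.mul (by fun_prop) hX
  have h2 := h1.lintegral_prod_right' (ν := sphMeasure)
  exact h2.lintegral_prod_right'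

theorem Adm.GE_meas {f : R3 → ℝ} (hf : Adm f) (γ : ℝ) : Measurable (fun v => GE γ f v) := by
  have := hf.m
  exact CC_meas γ _ (by fun_prop)
theorem Adm.GF_meas {f : R3 → ℝ} (hf : Adm f) (γ : ℝ) : Measurable (fun v => GF γ f v) := by
  have := hf.m
  exact CC_meas γ _ (by fun_prop)
theorem Adm.LE_meas {f : R3 → ℝ} (hf : Adm f) (γ : ℝ) : Measurable (fun v => LE' γ f v) := by
  have := hf.m
  exact CC_meas γ _ (by fun_prop)

theorem small_le {x y : ENNReal} (h : ∀ ε : ℝ, 0 < ε → x ≤ y + ENNReal.ofReal ε) : x ≤ y := by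
  apply ENNReal.le_of_forall_pos_le_add
  intro ε hε _
  have := h ε (by exact_mod_cast hε)
  simpa using this

theorem GE_congr {f g : R3 → ℝ} (hf : Adm f) (hg : Adm g) (γ : ℝ) (h0 : 0 ≤ γ) (h1 : γ ≤ 1) (v : R3)
    (N : ENNReal) (hN : N ≠ ⊤) (hfN : NN f ≤ N) (hgN : NN g ≤ N) (hz : NN (fun x => f x - g x) = 0) :
    GE γ f v = GE γ g v := by
  apply le_antisymm <;> refine small_le fun ε hε => ?_ <;> obtain ⟨K, hK, η, hη, H⟩ := Err_small γ v N hN ε hε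
  · exact (GE_diff hf hg γ h0 h1 v K hK N hfN hgN).trans (add_le_add_right (H _ (by simp [hz])) _)
  · exact (GE_diff hg hf γ h0 h1 v K hK N hgN hfN).trans (add_le_add_right (H _ (by rw [NN_symm]; simp [hz])) _)

theorem LE_congr {f g : R3 → ℝ} (hf : Adm f) (hg : Adm g) (γ : ℝ) (h0 : 0 ≤ γ) (h1 : γ ≤ 1) (v : R3)
    (N : ENNReal) (hN : N ≠ ⊤) (hfN : NN f ≤ N) (hgN : NN g ≤ N) (hz : NN (fun x => f x - g x) = 0) :
    LE' γ f v = LE' γ g v := by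
  apply le_antisymm <;> refine small_le fun ε hε => ?_ <;> obtain ⟨K, hK, η, hη, H⟩ := Err_small γ v N hN ε hε
  · exact (LE_diff hf hg γ h0 h1 v K hK N hgN).trans (add_le_add_right (H _ (by simp [hz])) _)
  · exact (LE_diff hg hf γ h0 h1 v K hK N hfN).trans (add_le_add_right (H _ (by rw [NN_symm]; simp [hz])) _)

structure Sol (γ β : ℝ) (f0 : R3 → ℝ) (f : ℝ → R3 → ℝ) (N M E : ENNReal) : Prop where
  reg : Reg f N
  jm : Measurable (fun p : ℝ × R3 => f p.1 p.2)
  jG : Measurable (fun p : ℝ × R3 => GE γ (f p.1) p.2)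
  jL : Measurable (fun p : ℝ × R3 => LE' γ (f p.1) p.2)
  Mt : M ≠ ⊤
  Et : E ≠ ⊤
  mass : ∀ t, 0 ≤ t → ∫⁻ v, ENNReal.ofReal (f t v) = M
  energy : ∀ t, 0 ≤ t → ∫⁻ v, ENNReal.ofReal (f t v * ‖v‖^2) = E
  cont : ∀ v, Continuous (fun t => f t v)
  eq : ∀ᵐ v, ∀ t, 0 ≤ t → f t v = f0 v + ∫ τ in (0:ℝ)..t, ((β * (GE γ (f τ) v).toReal) * (1 - f τ v) - f τ v * (β * (LE' γ (f τ) v).toReal))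

theorem exists_Sol (γ : ℝ) (h0 : 0 ≤ γ) (h1 : γ ≤ 1) (b : ℝ → ℝ) (β : ℝ) (hb : ∀ x, b x = β)
    (f₀ : R3 → ℝ) (g : ℝ → R3 → ℝ) (hg : IsFDSolution γ b f₀ g) :
    ∃ f N M E, Sol γ β f₀ f N M E ∧ ∀ t, 0 ≤ t → f t =ᵐ[volume] g t := by
  obtain ⟨N, hR, hme⟩ := hg.reg
  obtain ⟨Z, hZ, hmild⟩ := hg.mild
  set Z' := toMeasurable volume Z with hZ'
  have hZ'm : MeasurableSet Z' := measurableSet_toMeasurable _ _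
  have hZ'0 : volume Z' = 0 := by rw [hZ', measure_toMeasurable, hZ]
  have hZZ : Z ⊆ Z' := subset_toMeasurable _ _
  have hgc : ∀ v, v ∉ Z → ContinuousOn (fun t => g t v) (Ici 0) := by
    intro v hv
    refine ode_cont (fun t => g t v) (fun τ => QFD γ b (g τ) v) (fun t => β * (GE γ (g t) v).toReal) (fun t => β * (LE' γ (g t) v).toReal) (f₀ v)
      (fun t ht => hg.nonneg t ht v) (fun t ht => hg.le_one t ht v) ?_ ?_ ?_ ?_
    · exact continuousOn_const.mul (hR.GE_cont γ h0 h1 v)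
    · exact continuousOn_const.mul (hR.LE_cont γ h0 h1 v)
    · intro t ht
      rw [QFD_eq γ b β hb (g t) (hR.adm t ht) v (hR.GE_fin γ h0 h1 v t ht) (hR.LE_fin γ h0 h1 v t ht)]; ring
    · intro t ht; exact hmild t ht v hv
  set f : ℝ → R3 → ℝ := fun t => Z'ᶜ.indicator (g (max t 0)) with hf
  have hmax : ∀ t : ℝ, 0 ≤ max t 0 := fun t => le_max_right _ _
  have hfadm : ∀ t, Adm (f t) := by
    intro t
    have := hR.adm (max t 0) (hmax t)
    refine ⟨this.m.indicator hZ'm.compl, fun v => indicator_nonneg (fun x _ => this.n x) v, fun v => ?_⟩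
    simp only [hf]
    by_cases hv : v ∈ Z'ᶜ
    · rw [indicator_of_mem hv]; exact this.l v
    · rw [indicator_of_notMem hv]; exact zero_le_one
  have hae : ∀ t, f t =ᵐ[volume] g (max t 0) := by
    intro t
    have : ∀ᵐ v, v ∉ Z' := measure_eq_zero_iff_ae_notMem.1 hZ'0
    filter_upwards [this] with v hv
    exact indicator_of_mem hv _
  have hmaxe : ∀ t : ℝ, 0 ≤ t → max t 0 = t := fun t ht => max_eq_left ht
  have hNNs : ∀ s t, NN (fun v => f s v - f t v) = NN (fun v => g (max s 0) v - g (max t 0) v) := by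
    intro s t
    unfold NN
    apply lintegral_congr_ae
    filter_upwards [hae s, hae t] with v h1 h2
    rw [h1, h2]
  have hNNz : ∀ t, NN (fun v => f t v - g (max t 0) v) = 0 := by
    intro t
    unfold NN
    rw [lintegral_eq_zero_iff' ]
    · filter_upwards [hae t] with v h1
      rw [h1]; simp
    · have := (hfadm t).m; have := (hR.adm _ (hmax t)).m; fun_prop
  have hNNf : ∀ t, NN (f t) ≤ N := by
    intro t
    refine le_trans (le_of_eq ?_) (hR.nn _ (hmax t))
    unfold NN
    apply lintegral_congr_ae
    filter_upwards [hae t] with v h1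
    rw [h1]
  have hGEe : ∀ t v, GE γ (f t) v = GE γ (g (max t 0)) v := fun t v => GE_congr (hfadm t) (hR.adm _ (hmax t)) γ h0 h1 v N hR.top (hNNf t) (hR.nn _ (hmax t)) (hNNz t)
  have hLEe : ∀ t v, LE' γ (f t) v = LE' γ (g (max t 0)) v := fun t v => LE_congr (hfadm t) (hR.adm _ (hmax t)) γ h0 h1 v N hR.top (hNNf t) (hR.nn _ (hmax t)) (hNNz t)
  have hcmax : Continuous (fun t : ℝ => max t 0) := by fun_prop
  have hfc : ∀ v, Continuous (fun t => f t v) := by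
    intro v
    by_cases hv : v ∈ Z'ᶜ
    · have : (fun t => f t v) = fun t => g (max t 0) v := by ext t; simp only [hf]; rw [indicator_of_mem hv]
      rw [this]
      exact (hgc v (fun h => hv (hZZ h))).comp_continuous hcmax hmax
    · have : (fun t => f t v) = fun t => 0 := by ext t; simp only [hf]; rw [indicator_of_notMem hv]
      rw [this]; exact continuous_const
  refine ⟨f, N, ENNReal.ofReal (∫ v, f₀ v), ENNReal.ofReal (∫ v, f₀ v * ‖v‖^2), ⟨⟨hR.top, fun t _ => hfadm t, fun t _ => hNNf t, ?_⟩, ?_, ?_, ?_, ENNReal.ofReal_ne_top, ENNReal.ofReal_ne_top, ?_, ?_, hfc, ?_⟩, ?_⟩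
  · intro t ht ε hε
    obtain ⟨δ, hδ, H⟩ := hR.cont t ht ε hε
    refine ⟨δ, hδ, fun s hs hst => ?_⟩
    rw [hNNs, hmaxe s hs, hmaxe t ht]; exact H s hs hst
  · have := stronglyMeasurable_uncurry_of_continuous_of_stronglyMeasurable (u := fun t v => f t v) hfc (fun t => (hfadm t).m.stronglyMeasurable)
    exact this.measurable
  · have := stronglyMeasurable_uncurry_of_continuous_of_stronglyMeasurable (u := fun t v => (GE γ (f t) v).toReal) (fun v => by simp_rw [hGEe]; exact (hR.GE_cont γ h0 h1 v).comp_continuous hcmax hmax) (fun t => ((hfadm t).GE_meas γ).ennreal_toReal.stronglyMeasurable)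
    have := (this.measurable).ennreal_ofReal
    convert this using 2 with p
    simp only [Function.uncurry]
    rw [ENNReal.ofReal_toReal]
    rw [hGEe]; exact hR.GE_fin γ h0 h1 _ _ (hmax _)
  · have := stronglyMeasurable_uncurry_of_continuous_of_stronglyMeasurable (u := fun t v => (LE' γ (f t) v).toReal) (fun v => by simp_rw [hLEe]; exact (hR.LE_cont γ h0 h1 v).comp_continuous hcmax hmax) (fun t => ((hfadm t).LE_meas γ).ennreal_toReal.stronglyMeasurable)
    have := (this.measurable).ennreal_ofReal
    convert this using 2 with p
    simp only [Function.uncurry]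
    rw [ENNReal.ofReal_toReal]
    rw [hLEe]; exact hR.LE_fin γ h0 h1 _ _ (hmax _)
  · intro t ht
    rw [← (hme t ht).1]
    apply lintegral_congr_ae
    filter_upwards [hae t] with v h1
    rw [h1, hmaxe t ht]
  · intro t ht
    rw [← (hme t ht).2]
    apply lintegral_congr_ae
    filter_upwards [hae t] with v h1
    rw [h1, hmaxe t ht]
  · have : ∀ᵐ v, v ∉ Z' := measure_eq_zero_iff_ae_notMem.1 hZ'0
    filter_upwards [this] with v hv t ht
    have e : ∀ t, 0 ≤ t → f t v = g t v := by
      intro t ht; simp only [hf]; rw [indicator_of_mem hv, hmaxe t ht]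
    rw [e t ht, hmild t ht v (fun h => hv (hZZ h))]
    congr 1
    apply intervalIntegral.integral_congr
    intro τ hτ
    rw [uIcc_of_le ht] at hτ
    simp only
    rw [QFD_eq γ b β hb (g τ) (hR.adm τ hτ.1) v (hR.GE_fin γ h0 h1 v τ hτ.1) (hR.LE_fin γ h0 h1 v τ hτ.1), hGEe, hLEe, hmaxe τ hτ.1, e τ hτ.1]; ring
  · intro t ht
    have := hae t
    rwa [hmaxe t ht] at this

end Part14

section Part15
open scoped ENNReal

variable {γ β : ℝ} {f0 : R3 → ℝ} {f : ℝ → R3 → ℝ} {N M E : ENNReal}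

theorem Sol.init (hf : Sol γ β f0 f N M E) : ∀ᵐ v, f 0 v = f0 v := by
  filter_upwards [hf.eq] with v hv
  simpa using hv 0 le_rfl

theorem Sol.duh (hf : Sol γ β f0 f N M E) (h0 : 0 ≤ γ) (h1 : γ ≤ 1) (hβ : 0 < β) : ∀ᵐ v, ∀ t, 0 ≤ t → ∀ lam : ℝ,
    (∀ τ, 0 ≤ τ → τ ≤ t → ENNReal.ofReal lam ≤ ENNReal.ofReal β * LE' γ (f τ) v) →
    ENNReal.ofReal (Real.exp (lam * t) * f t v) ≤ ENNReal.ofReal (f0 v) + ∫⁻ τ in Ioc 0 t, ENNReal.ofReal (β * Real.exp (lam * τ)) * GE γ (f τ) v := by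
  filter_upwards [hf.eq] with v hv t ht lam hl
  have key := ode_duhamel (fun t => f t v) _ (fun t => β * (GE γ (f t) v).toReal) (fun t => β * (LE' γ (f t) v).toReal) (f0 v)
    (fun t ht => (hf.reg.adm t ht).n v) (hf.cont v).continuousOn
    (continuousOn_const.mul (hf.reg.GE_cont γ h0 h1 v)) (continuousOn_const.mul (hf.reg.LE_cont γ h0 h1 v))
    (fun t _ => by positivity) (fun _ _ => rfl) hv t lam ht ?_
  · refine (ENNReal.ofReal_le_ofReal key).trans (ENNReal.ofReal_add_le.trans (add_le_add_right ?_ _))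
    have hc : ContinuousOn (fun τ => Real.exp (lam * τ) * (β * (GE γ (f τ) v).toReal)) (Ici 0) :=
      (Continuous.continuousOn (by fun_prop)).mul (continuousOn_const.mul (hf.reg.GE_cont γ h0 h1 v))
    have hi : IntervalIntegrable (fun τ => Real.exp (lam * τ) * (β * (GE γ (f τ) v).toReal)) volume 0 t :=
      ContinuousOn.intervalIntegrable (hc.mono (by rw [uIcc_of_le ht]; exact Icc_subset_Ici_self))
    rw [intervalIntegral.integral_of_le ht, ofReal_integral_eq_lintegral_ofReal]
    · apply setLIntegral_mono' measurableSet_Ioc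
      intro τ hτ
      rw [← ENNReal.ofReal_toReal (hf.reg.GE_fin γ h0 h1 v τ hτ.1.le), ← ENNReal.ofReal_mul (by positivity), ENNReal.toReal_ofReal (by positivity)]
      apply ENNReal.ofReal_le_ofReal
      apply le_of_eq; ring
    · rw [intervalIntegrable_iff_integrableOn_Ioc_of_le ht] at hi; exact hi
    · filter_upwards with τ
      positivity
  · intro τ h1' h2'
    have := hl τ h1' h2'
    rw [← ENNReal.ofReal_toReal (hf.reg.LE_fin γ h0 h1 v τ h1'), ← ENNReal.ofReal_mul hβ.le] at this
    exact (ENNReal.ofReal_le_ofReal_iff (by positivity)).1 this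

theorem Sol.weak (hf : Sol γ β f0 f N M E) (h0 : 0 ≤ γ) (h1 : γ ≤ 1) (hβ : 0 < β) : ∀ᵐ v, ∀ t0 t, 0 ≤ t0 → t0 ≤ t →
    ENNReal.ofReal (f t v) + ∫⁻ τ in Ioc t0 t, ENNReal.ofReal (f τ v) * (ENNReal.ofReal β * LE' γ (f τ) v) =
    ENNReal.ofReal (f t0 v) + ∫⁻ τ in Ioc t0 t, ENNReal.ofReal β * GE γ (f τ) v * ENNReal.ofReal (1 - f τ v) := by
  filter_upwards [hf.eq] with v hv t0 t ht0 htt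
  have ht : 0 ≤ t := ht0.trans htt
  have c1 : ContinuousOn (fun τ => (β * (GE γ (f τ) v).toReal) * (1 - f τ v)) (Ici 0) :=
    (continuousOn_const.mul (hf.reg.GE_cont γ h0 h1 v)).mul (continuousOn_const.sub (hf.cont v).continuousOn)
  have c2 : ContinuousOn (fun τ => f τ v * (β * (LE' γ (f τ) v).toReal)) (Ici 0) :=
    (hf.cont v).continuousOn.mul (continuousOn_const.mul (hf.reg.LE_cont γ h0 h1 v))
  have ii : ∀ {F : ℝ → ℝ}, ContinuousOn F (Ici 0) → ∀ a b, 0 ≤ a → a ≤ b → IntervalIntegrable F volume a b := by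
    intro F hF a b ha hb
    exact ContinuousOn.intervalIntegrable (hF.mono (by rw [uIcc_of_le hb]; exact Icc_subset_Ici_self.trans (Ici_subset_Ici.2 ha)))
  have key : f t v - f t0 v = ∫ τ in t0..t, ((β * (GE γ (f τ) v).toReal) * (1 - f τ v) - f τ v * (β * (LE' γ (f τ) v).toReal)) := by
    rw [hv t ht, hv t0 ht0, add_sub_add_left_eq_sub]
    exact intervalIntegral.integral_interval_sub_left (ii (c1.sub c2) 0 t le_rfl ht) (ii (c1.sub c2) 0 t0 le_rfl ht0)
  rw [intervalIntegral.integral_sub (ii c1 _ _ ht0 htt) (ii c2 _ _ ht0 htt)] at key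
  have n1 : ∀ τ ∈ Ioc t0 t, 0 ≤ (β * (GE γ (f τ) v).toReal) * (1 - f τ v) := fun τ hτ =>
    mul_nonneg (by positivity) (by linarith [(hf.reg.adm τ (ht0.trans hτ.1.le)).l v])
  have n2 : ∀ τ ∈ Ioc t0 t, 0 ≤ f τ v * (β * (LE' γ (f τ) v).toReal) := fun τ hτ =>
    mul_nonneg ((hf.reg.adm τ (ht0.trans hτ.1.le)).n v) (by positivity)
  have e1 : ENNReal.ofReal (∫ τ in t0..t, (β * (GE γ (f τ) v).toReal) * (1 - f τ v)) = ∫⁻ τ in Ioc t0 t, ENNReal.ofReal β * GE γ (f τ) v * ENNReal.ofReal (1 - f τ v) := by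
    rw [intervalIntegral.integral_of_le htt, ofReal_integral_eq_lintegral_ofReal ((intervalIntegrable_iff_integrableOn_Ioc_of_le htt).1 (ii c1 _ _ ht0 htt))]
    · apply setLIntegral_congr_fun measurableSet_Ioc
      intro τ hτ
      simp only
      rw [← ENNReal.ofReal_toReal (hf.reg.GE_fin γ h0 h1 v τ (ht0.trans hτ.1.le)), ← ENNReal.ofReal_mul (by positivity), ENNReal.toReal_ofReal (by positivity), ENNReal.ofReal_mul (by positivity)]
    · filter_upwards [ae_restrict_mem measurableSet_Ioc] with τ hτ using n1 τ hτ
  have e2 : ENNReal.ofReal (∫ τ in t0..t, f τ v * (β * (LE' γ (f τ) v).toReal)) = ∫⁻ τ in Ioc t0 t, ENNReal.ofReal (f τ v) * (ENNReal.ofReal β * LE' γ (f τ) v) := by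
    rw [intervalIntegral.integral_of_le htt, ofReal_integral_eq_lintegral_ofReal ((intervalIntegrable_iff_integrableOn_Ioc_of_le htt).1 (ii c2 _ _ ht0 htt))]
    · apply setLIntegral_congr_fun measurableSet_Ioc
      intro τ hτ
      simp only
      rw [← ENNReal.ofReal_toReal (hf.reg.LE_fin γ h0 h1 v τ (ht0.trans hτ.1.le)), ← ENNReal.ofReal_mul (by positivity), ENNReal.toReal_ofReal (by positivity), ENNReal.ofReal_mul ((hf.reg.adm τ (ht0.trans hτ.1.le)).n v)]
    · filter_upwards [ae_restrict_mem measurableSet_Ioc] with τ hτ using n2 τ hτ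
  rw [← e1, ← e2, ← ENNReal.ofReal_add ((hf.reg.adm t ht).n v), ← ENNReal.ofReal_add ((hf.reg.adm t0 ht0).n v)]
  · congr 1; linarith
  · rw [intervalIntegral.integral_of_le htt]; exact setIntegral_nonneg measurableSet_Ioc n1
  · rw [intervalIntegral.integral_of_le htt]; exact setIntegral_nonneg measurableSet_Ioc n2

end Part15

section Part16
open scoped ENNReal

def Band (K : ℝ) (v : R3) : Set (R3 × R3) := {p | ‖p.2 - v‖ ≤ K * ‖p.1 - v‖ ∧ ‖p.1 - v‖ ≤ K * ‖p.2 - v‖}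
theorem mBand (K : ℝ) (v : R3) : MeasurableSet (Band K v) :=
  mset_and (measurableSet_le (by fun_prop) (by fun_prop)) (measurableSet_le (by fun_prop) (by fun_prop))
theorem mBi (K : ℝ) (v : R3) : Measurable ((Band K v).indicator (1 : R3 × R3 → ENNReal)) := measurable_one.indicator (mBand K v)
theorem Band_swap (K : ℝ) (v x y : R3) : (Band K v).indicator (1 : R3 × R3 → ENNReal) (x, y) = (Band K v).indicator 1 (y, x) := by
  have : (x,y) ∈ Band K v ↔ (y,x) ∈ Band K v := by unfold Band; simp only [mem_ofPred_eq]; tauto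
  by_cases h : (x,y) ∈ Band K v
  · rw [indicator_of_mem h, indicator_of_mem (this.1 h)]; rfl
  · rw [indicator_of_notMem h, indicator_of_notMem (fun h' => h (this.2 h'))]

theorem sph_pos : 0 < sphMeasure univ := by
  rw [pos_iff_ne_zero]
  intro h
  have h0 : sphMeasure = 0 := Measure.measure_univ_eq_zero.1 h
  have := lintegral_polar (fun _ => 1) measurable_const
  rw [h0] at this
  simp at this

theorem band_mass : ∃ K : ℝ, 1 ≤ K ∧ ∃ m : ℝ, 0 < m ∧ ∀ v w : R3, ENNReal.ofReal m ≤
    ∫⁻ σ, (Band K v).indicator 1 (vOut v w σ, vOutStar v w σ) ∂sphMeasure := by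
  have := sph_fin
  set m := (sphMeasure univ).toReal with hm
  have hm0 : 0 < m := ENNReal.toReal_pos sph_pos.ne' (measure_ne_top _ _)
  have hmm : sphMeasure univ = ENNReal.ofReal m := by rw [hm, ENNReal.ofReal_toReal (measure_ne_top _ _)]
  set K := 1 + 1024 / m with hKd
  have hK1 : 1 ≤ K := by have : 0 < 1024 / m := by positivity
                         linarith
  have hK : 256 / K^2 ≤ m/4 := by
    rw [div_le_iff₀ (by positivity)]
    have : K ≤ K^2 := by nlinarith
    have : m/4 * K = m/4 + 256 := by rw [hKd]; field_simp; norm_num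
    nlinarith
  refine ⟨K, hK1, m/2, by positivity, fun v w => ?_⟩
  have hK0 : 0 < K := by linarith
  set S : Set (R3 × R3) := {p : R3 × R3 | K * ‖p.1 - v‖ < ‖p.2 - v‖} with hS
  have mS : Measurable (S.indicator (1 : R3 × R3 → ENNReal)) := measurable_one.indicator (measurableSet_lt (by fun_prop) (by fun_prop))
  have b1 := band_le v w K hK0
  have b2 := col_swap v w (fun x y => S.indicator 1 (x,y)) mS
  rw [← hS] at b1
  have tot : sphMeasure univ ≤ ∫⁻ σ, ((Band K v).indicator 1 (vOut v w σ, vOutStar v w σ) + (S.indicator 1 (vOut v w σ, vOutStar v w σ) + S.indicator 1 (vOutStar v w σ, vOut v w σ))) ∂sphMeasure := by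
    calc _ = ∫⁻ σ : S2, 1 ∂sphMeasure := by simp
      _ ≤ _ := by
        apply lintegral_mono
        intro σ
        beta_reduce
        by_cases c1 : (vOut v w σ, vOutStar v w σ) ∈ S
        · rw [indicator_of_mem c1, Pi.one_apply, ← add_assoc, add_comm _ (1:ENNReal), add_assoc]; exact le_self_add
        · by_cases c2 : (vOutStar v w σ, vOut v w σ) ∈ S
          · rw [indicator_of_mem c2, Pi.one_apply, ← add_assoc]; exact le_add_self
          · rw [indicator_of_mem (show (vOut v w σ, vOutStar v w σ) ∈ Band K v from ?_)]
            · exact le_self_add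
            · simp only [hS, mem_ofPred_eq, not_lt] at c1 c2
              exact ⟨c1, c2⟩
  have mB := mBi K v
  rw [lintegral_add_left (by fun_prop), lintegral_add_left (by fun_prop), ← b2, hmm] at tot
  have h3 : ENNReal.ofReal (256/K^2) + ENNReal.ofReal (256/K^2) ≤ ENNReal.ofReal (m/2) := by
    rw [← ENNReal.ofReal_add (by positivity) (by positivity)]
    apply ENNReal.ofReal_le_ofReal; linarith
  have h4 := tot.trans (add_le_add_right ((add_le_add b1 b1).trans h3) _)
  have h5 : ENNReal.ofReal m = ENNReal.ofReal (m/2) + ENNReal.ofReal (m/2) := by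
    rw [← ENNReal.ofReal_add (by positivity) (by positivity)]; congr 1; ring
  rw [h5] at h4
  exact (ENNReal.add_le_add_iff_right ENNReal.ofReal_ne_top).1 h4

/-- geometry: in the band with `w` small, both outgoing velocities are large -/
theorem band_geom (K R1 : ℝ) (hK : 1 ≤ K) (v w : R3) (σ : S2) (hw : ‖w‖ ≤ R1) (hv : 2 * R1 + 4 * K * R1 ≤ ‖v‖)
    (hb : (vOut v w σ, vOutStar v w σ) ∈ Band K v) : ‖v‖ / (4 * K) ≤ ‖vOut v w σ‖ := by
  have hb1 : ‖vOut v w σ - v‖ ≤ K * ‖vOutStar v w σ - v‖ := hb.2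
  have p := col_pyth v w σ
  have e : ‖vOut v w σ - w‖ = ‖vOutStar v w σ - v‖ := by
    have : vOut v w σ - w = - (vOutStar v w σ - v) := by unfold vOut vOutStar; module
    rw [this, norm_neg]
  have h1 : ‖v - w‖ ≤ 2 * K * ‖vOutStar v w σ - v‖ := by
    have n1 := norm_nonneg (vOutStar v w σ - v)
    have n2 := norm_nonneg (vOut v w σ - v)
    apply abs_le_of_sq_le_sq' _ (by positivity) |>.2
    rw [← p]
    have q1 : ‖vOut v w σ - v‖^2 ≤ (K * ‖vOutStar v w σ - v‖)^2 := by gcongr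
    have q2 : ‖vOutStar v w σ - v‖^2 ≤ (K * ‖vOutStar v w σ - v‖)^2 := by
      gcongr; exact le_mul_of_one_le_left n1 hK
    nlinarith [sq_nonneg (K * ‖vOutStar v w σ - v‖)]
  have h2 : ‖v‖ - R1 ≤ ‖v - w‖ := by have := norm_sub_norm_le v w; linarith
  have h3 : ‖vOut v w σ - w‖ ≤ ‖vOut v w σ‖ + R1 := (norm_sub_le _ _).trans (by linarith)
  rw [e] at h3
  rw [div_le_iff₀ (by linarith)]
  have h4 : ‖v‖ - R1 ≤ 2 * K * (‖vOut v w σ‖ + R1) := by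
    refine h2.trans (h1.trans ?_)
    gcongr
  nlinarith

end Part16

section Part17
open scoped ENNReal

/-- tail of mass -/
theorem tail_le (f : R3 → ℝ) (hf : Adm f) (E R : ℝ) (hR : 0 < R) (hE : ∫⁻ v, ENNReal.ofReal (f v * ‖v‖^2) ≤ ENNReal.ofReal E) :
    ∫⁻ v, {v : R3 | R ≤ ‖v‖}.indicator 1 v * ENNReal.ofReal (f v) ≤ ENNReal.ofReal (E / R^2) := by
  have hfm := hf.m
  calc _ ≤ ∫⁻ v, ENNReal.ofReal (1 / R^2) * ENNReal.ofReal (f v * ‖v‖^2) := by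
        apply lintegral_mono
        intro v
        beta_reduce
        by_cases h : R ≤ ‖v‖
        · rw [indicator_of_mem (show v ∈ {v : R3 | R ≤ ‖v‖} from h), Pi.one_apply, one_mul, ← ENNReal.ofReal_mul (by positivity)]
          apply ENNReal.ofReal_le_ofReal
          rw [one_div, inv_mul_eq_div, le_div_iff₀ (by positivity)]
          have := hf.n v
          gcongr
        · rw [indicator_of_notMem (show v ∉ {v : R3 | R ≤ ‖v‖} from h), zero_mul]; exact zero_le
    _ = ENNReal.ofReal (1/R^2) * ∫⁻ v, ENNReal.ofReal (f v * ‖v‖^2) := lintegral_const_mul' _ _ ENNReal.ofReal_ne_top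
    _ ≤ ENNReal.ofReal (1/R^2) * ENNReal.ofReal E := by gcongr
    _ = _ := by rw [← ENNReal.ofReal_mul (by positivity)]; congr 1; ring

def BX (K R1 : ℝ) (v w : R3) (σ : S2) : ENNReal :=
  {w : R3 | ‖w‖ ≤ R1}.indicator 1 w * (Band K v).indicator 1 (vOut v w σ, vOutStar v w σ)

theorem lower_bound (γ : ℝ) (h0 : 0 ≤ γ) (h1 : γ ≤ 1) (M E : ℝ) (hM : 0 < M) (hE : 0 ≤ E) :
    ∃ K R1 R0 c : ℝ, 1 ≤ K ∧ 0 < R1 ∧ 2 * R1 + 4 * K * R1 ≤ R0 ∧ 1 ≤ R0 ∧ 0 < c ∧ ∀ f : R3 → ℝ, Adm f →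
      ∫⁻ v, ENNReal.ofReal (f v) = ENNReal.ofReal M → ∫⁻ v, ENNReal.ofReal (f v * ‖v‖^2) ≤ ENNReal.ofReal E → ∀ v : R3, R0 ≤ ‖v‖ →
      ENNReal.ofReal (c * ‖v‖^γ) ≤ CC γ v (fun w σ => BX K R1 v w σ * ENNReal.ofReal (f w * (1 - f (vOut v w σ)) * (1 - f (vOutStar v w σ)))) := by
  obtain ⟨K, hK, m, hm, hband⟩ := band_mass
  have hK0 : 0 < K := by linarith
  set R1 := 1 + 2 * E / M with hR1
  have hR10 : 1 ≤ R1 := by have : 0 ≤ 2 * E / M := by positivity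
                           linarith
  have hER : E / R1^2 ≤ M / 2 := by
    rw [div_le_iff₀ (by positivity)]
    have : M / 2 * R1 = M/2 + E := by rw [hR1]; field_simp
    nlinarith
  set B := 2 * (AK γ K * ((4 * K + 1) * (16 * K^2) * E)) with hB
  have hAK : 0 ≤ AK γ K := by unfold AK; positivity
  have hB0 : 0 ≤ B := by positivity
  set c := M * m / 8 with hc
  have hc0 : 0 < c := by positivity
  set R0 := 2 * R1 + 4 * K * R1 + 4 * K + B / c with hR0
  have hBc : 0 ≤ B / c := by positivity
  have hKR : 0 < 4 * K * R1 := by positivity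
  refine ⟨K, R1, R0, c, hK, by linarith, by linarith, by linarith, hc0, fun f hf hfM hfE v hv => ?_⟩
  have hv1 : 2 * R1 + 4 * K * R1 ≤ ‖v‖ := by linarith
  have hv4 : 4 * K ≤ ‖v‖ := by linarith
  have hvpos : 0 < ‖v‖ := by linarith
  have hfm := hf.m
  have mB := mBi K v
  have mI : Measurable ({w : R3 | ‖w‖ ≤ R1}.indicator (1 : R3 → ENNReal)) := measurable_one.indicator (measurableSet_le (by fun_prop) (by fun_prop))
  have mBX : Measurable (fun p : R3 × S2 => BX K R1 v p.1 p.2) := by unfold BX; fun_prop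
  -- lower bound of the full part
  have lowT : ENNReal.ofReal (2 * c * ‖v‖^γ) ≤ CC γ v (fun w σ => BX K R1 v w σ * ENNReal.ofReal (f w)) := by
    have step1 : ∀ w, {w : R3 | ‖w‖ ≤ R1}.indicator 1 w * ENNReal.ofReal (f w) * ENNReal.ofReal (‖v‖^γ / 2 * m) ≤
        ∫⁻ σ, ENNReal.ofReal (‖v - w‖^γ) * (BX K R1 v w σ * ENNReal.ofReal (f w)) ∂sphMeasure := by
      intro w
      by_cases hw : ‖w‖ ≤ R1
      · have e : ∀ σ, ENNReal.ofReal (‖v - w‖^γ) * (BX K R1 v w σ * ENNReal.ofReal (f w)) = (ENNReal.ofReal (‖v - w‖^γ) * ENNReal.ofReal (f w)) * (Band K v).indicator 1 (vOut v w σ, vOutStar v w σ) := by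
          intro σ; unfold BX; rw [indicator_of_mem (show w ∈ {w : R3 | ‖w‖ ≤ R1} from hw), Pi.one_apply]; ring
        simp_rw [e]
        rw [lintegral_const_mul' _ _ (by finiteness), indicator_of_mem (show w ∈ {w : R3 | ‖w‖ ≤ R1} from hw), Pi.one_apply, one_mul, ENNReal.ofReal_mul (by positivity), ← mul_assoc]
        refine mul_le_mul' ?_ (hband v w)
        rw [mul_comm]
        gcongr
        have : ‖v‖/2 ≤ ‖v - w‖ := by have := norm_sub_norm_le v w; linarith
        calc ‖v‖^γ/2 ≤ ‖v‖^γ / 2^γ := by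
              gcongr
              calc (2:ℝ)^γ ≤ 2^(1:ℝ) := Real.rpow_le_rpow_of_exponent_le (by norm_num) h1
                _ = 2 := Real.rpow_one 2
          _ = (‖v‖/2)^γ := by rw [Real.div_rpow (by positivity) (by norm_num)]
          _ ≤ _ := Real.rpow_le_rpow (by positivity) this h0
      · rw [indicator_of_notMem (show w ∉ {w : R3 | ‖w‖ ≤ R1} from hw)]; simp
    refine le_trans ?_ (lintegral_mono step1)
    rw [lintegral_mul_const _ (by fun_prop)]
    have massR : ENNReal.ofReal (M/2) ≤ ∫⁻ w, {w : R3 | ‖w‖ ≤ R1}.indicator 1 w * ENNReal.ofReal (f w) := by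
      have t := tail_le f hf E R1 (by linarith) hfE
      have : ENNReal.ofReal M ≤ (∫⁻ w, {w : R3 | ‖w‖ ≤ R1}.indicator 1 w * ENNReal.ofReal (f w)) + ENNReal.ofReal (M/2) := by
        rw [← hfM]
        calc _ ≤ ∫⁻ w, ({w : R3 | ‖w‖ ≤ R1}.indicator 1 w * ENNReal.ofReal (f w) + {v : R3 | R1 ≤ ‖v‖}.indicator 1 w * ENNReal.ofReal (f w)) := by
              apply lintegral_mono
              intro w
              beta_reduce
              rcases le_total ‖w‖ R1 with h | h
              · rw [indicator_of_mem (show w ∈ {w : R3 | ‖w‖ ≤ R1} from h), Pi.one_apply, one_mul]; exact le_self_add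
              · rw [indicator_of_mem (show w ∈ {w : R3 | R1 ≤ ‖w‖} from h), Pi.one_apply, one_mul]; exact le_add_self
          _ ≤ _ := by
              rw [lintegral_add_left (by fun_prop)]
              exact add_le_add_right (t.trans (ENNReal.ofReal_le_ofReal hER)) _
      have e : ENNReal.ofReal M = ENNReal.ofReal (M/2) + ENNReal.ofReal (M/2) := by
        rw [← ENNReal.ofReal_add (by positivity) (by positivity)]; congr 1; ring
      rw [e] at this
      exact (ENNReal.add_le_add_iff_right ENNReal.ofReal_ne_top).1 this
    refine le_trans (le_of_eq ?_) (mul_le_mul_left massR _)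
    rw [← ENNReal.ofReal_mul (by positivity)]
    congr 1; rw [hc]; ring
  -- bad parts
  set ρ := ‖v‖ / (4 * K) with hρ
  have hρ0 : 0 < ρ := by positivity
  set h : R3 → ENNReal := fun x => {v : R3 | ρ ≤ ‖v‖}.indicator 1 x * ENNReal.ofReal (f x) with hh
  have mI2 : Measurable ({v : R3 | ρ ≤ ‖v‖}.indicator (1 : R3 → ENNReal)) := measurable_one.indicator (measurableSet_le (by fun_prop) (by fun_prop))
  have mh : Measurable h := by fun_prop
  have bad1 : CC γ v (fun w σ => BX K R1 v w σ * ENNReal.ofReal (f (vOut v w σ))) ≤ ENNReal.ofReal (c * ‖v‖^γ / 2) := by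
    refine le_trans (CC_mono (Y := fun w σ => h (vOut v w σ) * (Jset K v).indicator 1 (vOut v w σ, vOutStar v w σ)) ?_) ?_
    · intro w σ
      by_cases hw : ‖w‖ ≤ R1
      · by_cases hb : (vOut v w σ, vOutStar v w σ) ∈ Band K v
        · have g := band_geom K R1 hK v w σ hw hv1 hb
          have hJ : (vOut v w σ, vOutStar v w σ) ∈ Jset K v := hb.1
          unfold BX
          rw [indicator_of_mem hJ, indicator_of_mem hb, indicator_of_mem (show w ∈ {w : R3 | ‖w‖ ≤ R1} from hw), hh]
          beta_reduce
          rw [indicator_of_mem (show vOut v w σ ∈ {v : R3 | ρ ≤ ‖v‖} from g)]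
          simp
        · unfold BX; rw [indicator_of_notMem hb]; simp
      · unfold BX; rw [indicator_of_notMem (show w ∉ {w : R3 | ‖w‖ ≤ R1} from hw)]; simp
    · refine (CC_J γ h0 v K hK0.le h mh).trans ?_
      have i1 : ∫⁻ x, ENNReal.ofReal (‖x - v‖^γ) * h x ≤ ∫⁻ x, ENNReal.ofReal ((4*K+1) * ρ^(γ-2)) * ENNReal.ofReal (f x * ‖x‖^2) := by
        apply lintegral_mono
        intro x
        beta_reduce
        by_cases hx : ρ ≤ ‖x‖
        · rw [hh]; beta_reduce
          rw [indicator_of_mem (show x ∈ {v : R3 | ρ ≤ ‖v‖} from hx), Pi.one_apply, one_mul, ← ENNReal.ofReal_mul (by positivity), ← ENNReal.ofReal_mul (by positivity)]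
          apply ENNReal.ofReal_le_ofReal
          have hxp : 0 < ‖x‖ := lt_of_lt_of_le hρ0 hx
          have a1 : ‖x - v‖ ≤ (4*K+1) * ‖x‖ := by
            have := norm_sub_le x v
            have h2 : ‖v‖ = ρ * (4 * K) := by rw [hρ]; field_simp
            nlinarith
          have a2 : ‖x - v‖^γ ≤ (4*K+1) * ‖x‖^γ := by
            calc _ ≤ ((4*K+1) * ‖x‖)^γ := Real.rpow_le_rpow (norm_nonneg _) a1 h0
              _ = (4*K+1)^γ * ‖x‖^γ := Real.mul_rpow (by positivity) (by positivity)
              _ ≤ (4*K+1)^(1:ℝ) * ‖x‖^γ := by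
                  have := Real.rpow_le_rpow_of_exponent_le (show 1 ≤ 4*K+1 by linarith) h1
                  gcongr
              _ = _ := by rw [Real.rpow_one]
          have a3 : ‖x‖^γ ≤ ρ^(γ-2) * ‖x‖^2 := by
            calc ‖x‖^γ = ‖x‖^(γ-2) * ‖x‖^2 := by
                  rw [← Real.rpow_natCast, ← Real.rpow_add hxp]; congr 1; push_cast; ring
              _ ≤ _ := by
                  have := Real.rpow_le_rpow_of_nonpos hρ0 hx (show γ - 2 ≤ 0 by linarith)
                  gcongr
          have := hf.n x
          calc ‖x - v‖^γ * f x ≤ ((4*K+1) * (ρ^(γ-2) * ‖x‖^2)) * f x := by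
                gcongr; exact a2.trans (by gcongr)
            _ = _ := by ring
        · rw [hh]; beta_reduce
          rw [indicator_of_notMem (show x ∉ {v : R3 | ρ ≤ ‖v‖} from hx)]; simp
      refine (mul_le_mul_right i1 _).trans ?_
      rw [lintegral_const_mul' _ _ ENNReal.ofReal_ne_top]
      refine (mul_le_mul_right (mul_le_mul_right hfE _) _).trans ?_
      rw [← ENNReal.ofReal_mul (by positivity), ← ENNReal.ofReal_mul hAK]
      apply ENNReal.ofReal_le_ofReal
      have b1 : ρ^(γ-2) ≤ ‖v‖^γ * (16 * K^2) / ‖v‖^2 := by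
        rw [Real.rpow_sub hρ0]
        have : ρ^γ ≤ ‖v‖^γ := Real.rpow_le_rpow hρ0.le (by rw [hρ]; exact div_le_self hvpos.le (by linarith)) h0
        have h2 : ρ^(2:ℝ) = ‖v‖^2 / (16 * K^2) := by
          rw [Real.rpow_two, hρ, div_pow]; ring
        rw [h2]
        calc _ ≤ ‖v‖^γ / (‖v‖^2 / (16 * K^2)) := by gcongr
          _ = _ := by field_simp
      have b2 : B / ‖v‖^2 ≤ c := by
        rw [div_le_iff₀ (by positivity)]
        have : B = c * (B / c) := by field_simp
        have h3 : B / c ≤ ‖v‖ := by linarith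
        have h4 : ‖v‖ ≤ ‖v‖^2 := by nlinarith
        calc B = c * (B / c) := this
          _ ≤ c * ‖v‖^2 := by gcongr; linarith
      calc AK γ K * ((4*K+1) * ρ^(γ-2) * E) ≤ AK γ K * ((4*K+1) * (‖v‖^γ * (16 * K^2) / ‖v‖^2) * E) := by gcongr
        _ = (B / ‖v‖^2) * ‖v‖^γ / 2 := by rw [hB]; field_simp
        _ ≤ c * ‖v‖^γ / 2 := by gcongr
  have bad2 : CC γ v (fun w σ => BX K R1 v w σ * ENNReal.ofReal (f (vOutStar v w σ))) ≤ ENNReal.ofReal (c * ‖v‖^γ / 2) := by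
    refine le_trans (le_of_eq ?_) bad1
    unfold BX
    have := CC_swap γ v (fun w x y => {w : R3 | ‖w‖ ≤ R1}.indicator 1 w * (Band K v).indicator 1 (x, y) * ENNReal.ofReal (f y)) (by fun_prop)
    rw [this]
    congr 1; ext w σ
    rw [Band_swap]
  have tot : ENNReal.ofReal (2 * c * ‖v‖^γ) ≤ CC γ v (fun w σ => BX K R1 v w σ * ENNReal.ofReal (f w * (1 - f (vOut v w σ)) * (1 - f (vOutStar v w σ)))) + ENNReal.ofReal (c * ‖v‖^γ) := by
    calc _ ≤ _ := lowT
      _ ≤ CC γ v (fun w σ => BX K R1 v w σ * ENNReal.ofReal (f w * (1 - f (vOut v w σ)) * (1 - f (vOutStar v w σ))) +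
          (BX K R1 v w σ * ENNReal.ofReal (f (vOut v w σ)) + BX K R1 v w σ * ENNReal.ofReal (f (vOutStar v w σ)))) := by
          apply CC_mono
          intro w σ
          rw [← mul_add, ← mul_add]
          refine mul_le_mul_right ?_ _
          refine le_trans (ENNReal.ofReal_le_ofReal ?_) (ENNReal.ofReal_add_le.trans (add_le_add_right ENNReal.ofReal_add_le _))
          have a1 := hf.n (vOut v w σ); have a2 := hf.l (vOut v w σ); have a3 := hf.n (vOutStar v w σ); have a4 := hf.l (vOutStar v w σ)
          have c1 := hf.n w; have c2 := hf.l w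
          nlinarith [mul_nonneg c1 (mul_nonneg a1 a3), mul_nonneg a1 (sub_nonneg.2 c2), mul_nonneg a3 (sub_nonneg.2 c2)]
      _ ≤ _ := by
          rw [CC_add (by fun_prop), CC_add (by fun_prop)]
          refine add_le_add_right ((add_le_add bad1 bad2).trans ?_) _
          rw [← ENNReal.ofReal_add (by positivity) (by positivity)]
          apply le_of_eq; congr 1; ring
  have e : ENNReal.ofReal (2 * c * ‖v‖^γ) = ENNReal.ofReal (c * ‖v‖^γ) + ENNReal.ofReal (c * ‖v‖^γ) := by
    rw [← ENNReal.ofReal_add (by positivity) (by positivity)]; congr 1; ring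
  rw [e] at tot
  exact (ENNReal.add_le_add_iff_right ENNReal.ofReal_ne_top).1 tot

theorem BX_le_one (K R1 : ℝ) (v w : R3) (σ : S2) : BX K R1 v w σ ≤ 1 := by
  unfold BX
  refine mul_le_one' ?_ ?_ <;> exact indicator_le_self' (fun _ _ => zero_le) _ |>.trans le_rfl

end Part17

section Part18
open scoped ENNReal

theorem plane_tr (a : S2) (g : R3 → ENNReal) (s : ℝ) (z' : E2) :
    ∫⁻ z : E2, g (s • (a:R3) + iota a z' + iota a z) = ∫⁻ z : E2, g (s • (a:R3) + iota a z) := by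
  rw [← lintegral_add_left_eq_self (fun z => g (s • (a:R3) + iota a z)) z']
  congr 1; ext z; rw [map_add, add_assoc]

theorem plane_P (a : S2) (g : R3 → ENNReal) (hg : Measurable g) (v : R3) :
    ∫⁻ u : R3, (Icc (0:ℝ) 1).indicator 1 ⟪(a:R3), u⟫ * g (v + u - ⟪(a:R3), u⟫ • (a:R3)) = ∫⁻ z : E2, g (v + iota a z) := by
  have mI : Measurable ((Icc (0:ℝ) 1).indicator (1 : ℝ → ENNReal)) := measurable_one.indicator measurableSet_Icc
  rw [lintegral_decomp a _ (by fun_prop)]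
  have : ∀ s : ℝ, ∫⁻ z : E2, (Icc (0:ℝ) 1).indicator (1 : ℝ → ENNReal) ⟪(a:R3), s • (a:R3) + iota a z⟫ * g (v + (s • (a:R3) + iota a z) - ⟪(a:R3), s • (a:R3) + iota a z⟫ • (a:R3)) =
     (Icc (0:ℝ) 1).indicator (1 : ℝ → ENNReal) s * ∫⁻ z : E2, g (v + iota a z) := by
    intro s
    have := measurable_iota a
    rw [← lintegral_const_mul _ (by fun_prop)]
    congr 1; ext z
    rw [inner_decomp]
    congr 2; module
  simp_rw [this]
  rw [lintegral_mul_const _ mI, lintegral_indicator_one measurableSet_Icc]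
  simp

theorem plane_one (a : S2) (g : R3 → ENNReal) (hg : Measurable g) (Λ : ENNReal)
    (H : ∀ ψ : ℝ → ENNReal, Measurable ψ → ∫⁻ q : R3, ψ ⟪(a:R3), q⟫ * g q ≤ Λ * ∫⁻ s, ψ s) :
    ∀ᵐ v : R3, ∫⁻ z : E2, g (v + iota a z) ≤ Λ := by
  have mio := measurable_iota a
  have mp : Measurable (fun s : ℝ => ∫⁻ z : E2, g (s • (a:R3) + iota a z)) :=
    Measurable.lintegral_prod_right' (f := fun q : ℝ × E2 => g (q.1 • (a:R3) + iota a q.2)) (by fun_prop)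
  have mp' : Measurable (fun v : R3 => ∫⁻ z : E2, g (v + iota a z)) :=
    Measurable.lintegral_prod_right' (f := fun q : R3 × E2 => g (q.1 + iota a q.2)) (by fun_prop)
  have h1 : ∀ᵐ s : ℝ, ∫⁻ z : E2, g (s • (a:R3) + iota a z) ≤ Λ := by
    refine ae_le_of_forall_setLIntegral_le_of_sigmaFinite (g := fun _ => Λ) mp ?_
    intro S hS _
    have := H (S.indicator 1) (measurable_one.indicator hS)
    rw [lintegral_decomp a _ (by have mI : Measurable (S.indicator (1 : ℝ → ENNReal)) := measurable_one.indicator hS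
                                 fun_prop), lintegral_indicator_one hS] at this
    simp_rw [inner_decomp] at this
    have e : ∀ s : ℝ, ∫⁻ z : E2, S.indicator (1 : ℝ → ENNReal) s * g (s • (a:R3) + iota a z) = S.indicator (fun s => ∫⁻ z : E2, g (s • (a:R3) + iota a z)) s := by
      intro s
      by_cases hs : s ∈ S <;> simp [hs]
    simp_rw [e] at this
    rw [lintegral_indicator hS] at this
    simpa using this
  rw [ae_iff]
  have mS : MeasurableSet {v : R3 | ¬ ∫⁻ z : E2, g (v + iota a z) ≤ Λ} := by
    simp only [not_le]
    exact measurableSet_lt measurable_const mp'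
  rw [← lintegral_indicator_one mS, lintegral_decomp a _ (measurable_one.indicator mS), lintegral_eq_zero_iff']
  · filter_upwards [h1] with s hs
    have : ∀ z : E2, ({v : R3 | ¬ ∫⁻ z : E2, g (v + iota a z) ≤ Λ}.indicator (1 : R3 → ENNReal)) (s • (a:R3) + iota a z) = 0 := by
      intro z
      apply indicator_of_notMem
      simp only [mem_ofPred_eq, not_not]
      rw [plane_tr]; exact hs
    simp_rw [this]; simp
  · apply Measurable.aemeasurable
    have mI := (measurable_one (α := ENNReal) ).indicator mS
    exact Measurable.lintegral_prod_right' (f := fun q : ℝ × E2 => {v : R3 | ¬ ∫⁻ z : E2, g (v + iota a z) ≤ Λ}.indicator 1 (q.1 • (a:R3) + iota a q.2)) (by fun_prop)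

theorem plane_ae (g : R3 → ENNReal) (hg : Measurable g) (Λ : ENNReal)
    (H : ∀ (a : S2) (ψ : ℝ → ENNReal), Measurable ψ → ∫⁻ q : R3, ψ ⟪(a:R3), q⟫ * g q ≤ Λ * ∫⁻ s, ψ s) :
    ∀ᵐ v : R3, ∀ᵐ a : S2 ∂sphMeasure, ∫⁻ z : E2, g (v + iota a z) ≤ Λ := by
  have mI : Measurable ((Icc (0:ℝ) 1).indicator (1 : ℝ → ENNReal)) := measurable_one.indicator measurableSet_Icc
  have mP : Measurable (fun p : R3 × S2 => ∫⁻ z : E2, g (p.1 + iota p.2 z)) := by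
    simp_rw [← plane_P _ g hg]
    exact Measurable.lintegral_prod_right' (f := fun q : (R3 × S2) × R3 => (Icc (0:ℝ) 1).indicator (1 : ℝ → ENNReal) ⟪(q.1.2:R3), q.2⟫ * g (q.1.1 + q.2 - ⟪(q.1.2:R3), q.2⟫ • (q.1.2:R3)))
      (by fun_prop)
  rw [Measure.ae_ae_comm (p := fun (v : R3) (a : S2) => ∫⁻ z : E2, g (v + iota a z) ≤ Λ)]
  · filter_upwards with a
    exact plane_one a g hg Λ (H a)
  · exact measurableSet_le mP measurable_const

/-- PL lemma. -/
theorem pl_lemma (γ : ℝ) (h0 : 0 < γ) (a : S2) (ψ : ℝ → ENNReal) (hψ : Measurable ψ) (R : ℝ) (hR : 0 ≤ R) (f : R3 → ℝ) (hf : Adm f) :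
    ∫⁻ q : R3, ψ ⟪(a:R3), q⟫ * ({q : R3 | R ≤ ‖q‖}.indicator 1 q * GF γ f q) ≤
      ENNReal.ofReal 256 * (∫⁻ s, ψ s) * ∫⁻ x : R3, ∫⁻ y : R3, {p : R3 × R3 | R^2 ≤ ‖p.1‖^2+‖p.2‖^2}.indicator 1 (x,y) *
        (ENNReal.ofReal (‖x - y‖^(γ-1)) * (ENNReal.ofReal (f x) * ENNReal.ofReal (f y))) := by
  have hm := hf.m
  have mI : Measurable ({q : R3 | R ≤ ‖q‖}.indicator (1 : R3 → ENNReal)) := measurable_one.indicator (measurableSet_le (by fun_prop) (by fun_prop))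
  have mJ : Measurable ({p : R3 × R3 | R^2 ≤ ‖p.1‖^2+‖p.2‖^2}.indicator (1 : R3 × R3 → ENNReal)) := measurable_one.indicator (measurableSet_le (by fun_prop) (by fun_prop))
  let Φ : R3 → R3 → R3 → R3 → ENNReal := fun v w x y => ψ ⟪(a:R3), v⟫ * ({q : R3 | R ≤ ‖q‖}.indicator 1 v * (ENNReal.ofReal (‖v - w‖^γ) * (ENNReal.ofReal (f x) * ENNReal.ofReal (f y))))
  have e1 : ∫⁻ q : R3, ψ ⟪(a:R3), q⟫ * ({q : R3 | R ≤ ‖q‖}.indicator 1 q * GF γ f q) =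
     ∫⁻ v : R3, ∫⁻ w : R3, (∫⁻ σ, Φ v w (vOut v w σ) (vOutStar v w σ) ∂sphMeasure) := by
    congr 1; ext v
    unfold GF CC
    have m1 : Measurable (fun p : R3 × S2 => ENNReal.ofReal (‖v - p.1‖^γ) * (ENNReal.ofReal (f (vOut v p.1 p.2)) * ENNReal.ofReal (f (vOutStar v p.1 p.2)))) := by fun_prop
    have m2 := m1.lintegral_prod_right' (ν := sphMeasure)
    rw [← mul_assoc, ← lintegral_const_mul _ m2]
    congr 1; ext w
    rw [← lintegral_const_mul]
    · congr 1; ext σ; simp only [Φ]; ring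
    · exact m1.comp (measurable_const.prodMk measurable_id)
  rw [e1, prepost Φ (by simp only [Φ]; fun_prop)]
  have m3 : Measurable (fun p : R3 × R3 => {p : R3 × R3 | R^2 ≤ ‖p.1‖^2+‖p.2‖^2}.indicator (1 : R3 × R3 → ENNReal) (p.1,p.2) *
        (ENNReal.ofReal (‖p.1 - p.2‖^(γ-1)) * (ENNReal.ofReal (f p.1) * ENNReal.ofReal (f p.2)))) := by fun_prop
  rw [← lintegral_const_mul _ m3.lintegral_prod_right']
  apply lintegral_mono; intro v; beta_reduce
  dsimp only
  rw [← lintegral_const_mul _ (by fun_prop)]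
  apply lintegral_mono; intro w; beta_reduce
  by_cases hvw : v = w
  · subst hvw
    simp [Φ, col_rel, Real.zero_rpow h0.ne']
  have hr : 0 < ‖v - w‖ := norm_pos_iff.2 (sub_ne_zero.2 hvw)
  have h2 : ∀ σ : S2, Φ (vOut v w σ) (vOutStar v w σ) v w ≤
     ({p : R3 × R3 | R^2 ≤ ‖p.1‖^2+‖p.2‖^2}.indicator 1 (v,w) * (ENNReal.ofReal (‖v - w‖^γ) * (ENNReal.ofReal (f v) * ENNReal.ofReal (f w)))) *
      ψ (⟪(a:R3), (2⁻¹:ℝ) • (v+w)⟫ + ‖v-w‖/2 * ⟪(a:R3), (σ:R3)⟫) := by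
    intro σ
    simp only [Φ]
    have e2 : ⟪(a:R3), vOut v w σ⟫ = ⟪(a:R3), (2⁻¹:ℝ) • (v+w)⟫ + ‖v-w‖/2 * ⟪(a:R3), (σ:R3)⟫ := by
      rw [vOut, inner_add_right, inner_smul_right _ _ (‖v-w‖/2)]
    rw [e2, col_rel, mul_comm]
    refine mul_le_mul_left (mul_le_mul_left ?_ _) _
    by_cases h : R ≤ ‖vOut v w σ‖
    · rw [indicator_of_mem (show vOut v w σ ∈ {q : R3 | R ≤ ‖q‖} from h), indicator_of_mem (show (v,w) ∈ {p : R3 × R3 | R^2 ≤ ‖p.1‖^2+‖p.2‖^2} from ?_)]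
      · rfl
      change R^2 ≤ ‖v‖^2 + ‖w‖^2
      rw [← col_energy v w σ]
      nlinarith [sq_nonneg ‖vOutStar v w σ‖]
    · rw [indicator_of_notMem (show vOut v w σ ∉ {q : R3 | R ≤ ‖q‖} from h)]
      exact zero_le
  refine (lintegral_mono h2).trans ?_
  rw [lintegral_const_mul _ (by fun_prop)]
  refine (mul_le_mul_right (lintegral_hatbox' a ψ hψ _ _ (by positivity)) _).trans (le_of_eq ?_)
  have e3 : ENNReal.ofReal (‖v - w‖^γ) * ENNReal.ofReal (128 / (‖v-w‖/2)) = ENNReal.ofReal 256 * ENNReal.ofReal (‖v - w‖^(γ-1)) := by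
    rw [← ENNReal.ofReal_mul (by positivity), ← ENNReal.ofReal_mul (by positivity), Real.rpow_sub_one hr.ne']
    congr 1; field_simp; norm_num
  calc _ = {p : R3 × R3 | R^2 ≤ ‖p.1‖^2+‖p.2‖^2}.indicator 1 (v,w) * (ENNReal.ofReal (‖v - w‖^γ) * ENNReal.ofReal (128 / (‖v-w‖/2)) * (ENNReal.ofReal (f v) * ENNReal.ofReal (f w))) * ∫⁻ s, ψ s := by ring
    _ = _ := by rw [e3]; ring

end Part18

section Part19
open scoped ENNReal

theorem ball_pot (ρ : ℝ) (hρ : 0 ≤ ρ) :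
    ∫⁻ u : R3, {u : R3 | ‖u‖ < ρ}.indicator 1 u * ENNReal.ofReal (‖u‖^(-2:ℝ)) ≤ ENNReal.ofReal ρ * sphMeasure univ := by
  have mI : Measurable ({u : R3 | ‖u‖ < ρ}.indicator (1 : R3 → ENNReal)) := measurable_one.indicator (measurableSet_lt (by fun_prop) (by fun_prop))
  rw [lintegral_polar _ (by fun_prop), ← lintegral_const]
  apply lintegral_mono; intro σ; beta_reduce
  have : ∫⁻ r in Ioi (0:ℝ), (Ioo 0 ρ).indicator (1 : ℝ → ENNReal) r ≤ ENNReal.ofReal ρ := by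
    refine (setLIntegral_le_lintegral _ _).trans ?_
    rw [lintegral_indicator_one measurableSet_Ioo]; simp
  refine le_trans (setLIntegral_mono' measurableSet_Ioi ?_) this
  intro r hr
  have hr : 0 < r := hr
  have hn : ‖r • (σ:R3)‖ = r := by simp [norm_smul, abs_of_pos hr]
  by_cases h : r < ρ
  · rw [indicator_of_mem (show r • (σ:R3) ∈ {u : R3 | ‖u‖ < ρ} from by simpa [hn] using h), indicator_of_mem (show r ∈ Ioo 0 ρ from ⟨hr, h⟩), hn]
    simp only [Pi.one_apply, one_mul]
    rw [← ENNReal.ofReal_mul (by positivity), Real.rpow_neg hr.le, Real.rpow_two, mul_inv_cancel₀ (by positivity)]; simp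
  · rw [indicator_of_notMem (show r • (σ:R3) ∉ {u : R3 | ‖u‖ < ρ} from by simpa [hn] using h)]
    simp

theorem ball_pot' (ρ : ℝ) (hρ : 0 ≤ ρ) (x : R3) (f : R3 → ℝ) (hf : Adm f) :
    ∫⁻ y : R3, {y : R3 | ‖y - x‖ < ρ}.indicator 1 y * ENNReal.ofReal (‖y - x‖^(-2:ℝ)) * ENNReal.ofReal (f y) ≤ ENNReal.ofReal ρ * sphMeasure univ := by
  refine le_trans ?_ (ball_pot ρ hρ)
  rw [← lintegral_sub_right_eq_self (fun u : R3 => {u : R3 | ‖u‖ < ρ}.indicator 1 u * ENNReal.ofReal (‖u‖^(-2:ℝ))) x]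
  apply lintegral_mono; intro y; beta_reduce
  refine (mul_le_of_le_one_right zero_le (by simpa using hf.l y)).trans (le_of_eq ?_)
  rfl

theorem pot_bound (γ : ℝ) (h0 : 0 < γ) (h1 : γ ≤ 1) (M E : ℝ) (hM : 0 ≤ M) (hE : 0 ≤ E) :
    ∃ C, 0 ≤ C ∧ ∀ f : R3 → ℝ, Adm f → ∫⁻ v, ENNReal.ofReal (f v) ≤ ENNReal.ofReal M →
      ∫⁻ v, ENNReal.ofReal (f v * ‖v‖^2) ≤ ENNReal.ofReal E → ∀ x : R3, 1 ≤ ‖x‖ →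
      ∫⁻ y, ENNReal.ofReal (‖y - x‖^(γ-1)) * ENNReal.ofReal (f y) ≤ ENNReal.ofReal (C * ‖x‖^(γ-1)) := by
  obtain ⟨S, hS0, hS⟩ : ∃ S : ℝ, 0 ≤ S ∧ sphMeasure univ = ENNReal.ofReal S :=
    ⟨(sphMeasure univ).toReal, by positivity, (ENNReal.ofReal_toReal (measure_ne_top _ _)).symm⟩
  refine ⟨2^(1-γ) * M + 4 * E + S, by positivity, ?_⟩
  intro f hf hfM hfE x hx
  have hm := hf.m
  have hx0 : 0 < ‖x‖ := by linarith
  obtain ⟨ρ, hρ⟩ : ∃ ρ, ρ = ‖x‖⁻¹ := ⟨_, rfl⟩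
  have hρ0 : 0 < ρ := by rw [hρ]; positivity
  have mI : Measurable ({y : R3 | ‖y - x‖ < ρ}.indicator (1 : R3 → ENNReal)) := measurable_one.indicator (measurableSet_lt (by fun_prop) (by fun_prop))
  have mJ : Measurable ({y : R3 | ‖x‖/2 ≤ ‖y‖}.indicator (1 : R3 → ENNReal)) := measurable_one.indicator (measurableSet_le (by fun_prop) (by fun_prop))
  have key : ∀ y, y ≠ x → ENNReal.ofReal (‖y - x‖^(γ-1)) * ENNReal.ofReal (f y) ≤
      ENNReal.ofReal (2^(1-γ) * ‖x‖^(γ-1)) * ENNReal.ofReal (f y) +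
      (ENNReal.ofReal (ρ^(γ-1)) * ({y : R3 | ‖x‖/2 ≤ ‖y‖}.indicator 1 y * ENNReal.ofReal (f y)) +
      ENNReal.ofReal (ρ^(γ+1)) * ({y : R3 | ‖y - x‖ < ρ}.indicator 1 y * ENNReal.ofReal (‖y - x‖^(-2:ℝ)) * ENNReal.ofReal (f y))) := by
    intro y hyx
    by_cases c1 : ‖x‖/2 ≤ ‖y - x‖
    · refine le_add_right (mul_le_mul_left (ENNReal.ofReal_le_ofReal ?_) _)
      refine (Real.rpow_le_rpow_of_nonpos (by positivity) c1 (by linarith)).trans (le_of_eq ?_)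
      rw [Real.div_rpow hx0.le (by norm_num), show (1-γ) = -(γ-1) by ring, Real.rpow_neg (by norm_num)]
      field_simp
    refine le_add_left ?_
    by_cases c2 : ρ ≤ ‖y - x‖
    · refine le_add_right ?_
      rw [indicator_of_mem (show y ∈ {y : R3 | ‖x‖/2 ≤ ‖y‖} from ?_)]
      · simp only [Pi.one_apply, one_mul]
        exact mul_le_mul_left (ENNReal.ofReal_le_ofReal (Real.rpow_le_rpow_of_nonpos hρ0 c2 (by linarith))) _
      · change ‖x‖/2 ≤ ‖y‖
        have := norm_sub_norm_le x y
        rw [norm_sub_rev] at this; push Not at c1; linarith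
    · refine le_add_left ?_
      push Not at c2
      rw [indicator_of_mem (show y ∈ {y : R3 | ‖y - x‖ < ρ} from c2)]
      simp only [Pi.one_apply, one_mul]
      rw [← mul_assoc, ← ENNReal.ofReal_mul (p := ρ^(γ+1)) (by positivity)]
      refine mul_le_mul_left (ENNReal.ofReal_le_ofReal ?_) _
      have h : 0 < ‖y - x‖ := norm_pos_iff.2 (sub_ne_zero.2 hyx)
      rw [show γ - 1 = (γ+1) + (-2) by ring, Real.rpow_add h]
      gcongr
  have hae : ∀ᵐ y : R3, y ≠ x := compl_mem_ae_iff.2 (measure_singleton x)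
  refine (lintegral_mono_ae (hae.mono key)).trans ?_
  rw [lintegral_add_left (by fun_prop), lintegral_add_left (by fun_prop), lintegral_const_mul _ (by fun_prop), lintegral_const_mul _ (by fun_prop), lintegral_const_mul _ (by fun_prop)]
  have b1 := hfM
  have b2 := tail_le f hf E (‖x‖/2) (by positivity) hfE
  have b3 := ball_pot' ρ hρ0.le x f hf
  rw [hS, ← ENNReal.ofReal_mul hρ0.le] at b3
  refine (add_le_add (mul_le_mul_right b1 _) (add_le_add (mul_le_mul_right b2 _) (mul_le_mul_right b3 _))).trans ?_
  rw [← ENNReal.ofReal_mul (by positivity), ← ENNReal.ofReal_mul (by positivity), ← ENNReal.ofReal_mul (by positivity), ← ENNReal.ofReal_add (by positivity) (by positivity), ← ENNReal.ofReal_add (by positivity) (by positivity)]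
  apply ENNReal.ofReal_le_ofReal
  have c1 : ρ^(γ-1) * (E/(‖x‖/2)^2) ≤ 4 * E * ‖x‖^(γ-1) := by
    have : ρ^(γ-1) = ‖x‖^(1-γ) := by rw [hρ, Real.inv_rpow hx0.le, ← Real.rpow_neg hx0.le]; congr 1; ring
    rw [this]
    have e : ‖x‖^(1-γ) * (E/(‖x‖/2)^2) = 4 * E * ‖x‖^(-1-γ) := by
      rw [show -1-γ = (1-γ) - 2 by ring, Real.rpow_sub hx0 (1-γ) 2, Real.rpow_two]; field_simp; norm_num
    rw [e]
    exact mul_le_mul_of_nonneg_left (Real.rpow_le_rpow_of_exponent_le hx (by linarith)) (by positivity)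
  have c2 : ρ^(γ+1) * (ρ * S) ≤ S * ‖x‖^(γ-1) := by
    have : ρ^(γ+1) * ρ = ‖x‖^(-2-γ) := by
      rw [← Real.rpow_add_one hρ0.ne', hρ, Real.inv_rpow hx0.le, ← Real.rpow_neg hx0.le]; congr 1; ring
    rw [← mul_assoc, this, mul_comm]
    exact mul_le_mul_of_nonneg_left (Real.rpow_le_rpow_of_exponent_le hx (by linarith)) hS0
  nlinarith

theorem pot2_bound (γ : ℝ) (h0 : 0 < γ) (h1 : γ ≤ 1) (M E : ℝ) (hM : 0 ≤ M) (hE : 0 ≤ E) (q Q : ℝ) (hq : 0 ≤ q) (hQ : 0 ≤ Q) :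
    ∃ C, 0 ≤ C ∧ ∀ f : R3 → ℝ, Adm f → ∫⁻ v, ENNReal.ofReal (f v) ≤ ENNReal.ofReal M →
      ∫⁻ v, ENNReal.ofReal (f v * ‖v‖^2) ≤ ENNReal.ofReal E → ∫⁻ v, ENNReal.ofReal (f v * ‖v‖^q) ≤ ENNReal.ofReal Q → ∀ R : ℝ, 2 ≤ R →
      ∫⁻ x : R3, ∫⁻ y : R3, {p : R3 × R3 | R^2 ≤ ‖p.1‖^2+‖p.2‖^2}.indicator 1 (x,y) *
        (ENNReal.ofReal (‖x - y‖^(γ-1)) * (ENNReal.ofReal (f x) * ENNReal.ofReal (f y))) ≤ ENNReal.ofReal (C * R^(γ-1-q)) := by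
  obtain ⟨C, hC, H⟩ := pot_bound γ h0 h1 M E hM hE
  refine ⟨2 * (C * (2^(1+q-γ) * Q)), by positivity, ?_⟩
  intro f hf hfM hfE hfq R hR
  have hm := hf.m
  have mJ : Measurable ({y : R3 | R/2 ≤ ‖y‖}.indicator (1 : R3 → ENNReal)) := measurable_one.indicator (measurableSet_le (by fun_prop) (by fun_prop))
  let T : R3 → R3 → ENNReal := fun x y => {x : R3 | R/2 ≤ ‖x‖}.indicator 1 x * ENNReal.ofReal (f x) * (ENNReal.ofReal (‖y - x‖^(γ-1)) * ENNReal.ofReal (f y))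
  have mT : Measurable (fun p : R3 × R3 => T p.1 p.2) := by simp only [T]; fun_prop
  have mT' : Measurable (fun p : R3 × R3 => T p.2 p.1) := by simp only [T]; fun_prop
  have key : ∀ x y : R3, {p : R3 × R3 | R^2 ≤ ‖p.1‖^2+‖p.2‖^2}.indicator 1 (x,y) *
        (ENNReal.ofReal (‖x - y‖^(γ-1)) * (ENNReal.ofReal (f x) * ENNReal.ofReal (f y))) ≤ T x y + T y x := by
    intro x y
    by_cases h : R^2 ≤ ‖x‖^2 + ‖y‖^2
    · rw [indicator_of_mem (show (x,y) ∈ {p : R3 × R3 | R^2 ≤ ‖p.1‖^2+‖p.2‖^2} from h)]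
      by_cases hx : R/2 ≤ ‖x‖
      · refine le_add_right (le_of_eq ?_)
        simp only [T]
        rw [indicator_of_mem (show x ∈ {x : R3 | R/2 ≤ ‖x‖} from hx), norm_sub_rev y x]
        simp only [Pi.one_apply]; ring
      · have hy : R/2 ≤ ‖y‖ := by
          by_contra hy
          push Not at hx hy
          nlinarith [norm_nonneg x, norm_nonneg y]
        refine le_add_left (le_of_eq ?_)
        simp only [T]
        rw [indicator_of_mem (show y ∈ {x : R3 | R/2 ≤ ‖x‖} from hy)]
        simp only [Pi.one_apply]; ring
    · rw [indicator_of_notMem (show (x,y) ∉ {p : R3 × R3 | R^2 ≤ ‖p.1‖^2+‖p.2‖^2} from h), zero_mul]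
      exact zero_le
  have b1 : ∫⁻ x, ∫⁻ y, T x y ≤ ENNReal.ofReal (C * (2^(1+q-γ) * Q) * R^(γ-1-q)) := by
    have : ∀ x, ∫⁻ y, T x y ≤ ENNReal.ofReal (C * (R/2)^(γ-1-q)) * ENNReal.ofReal (f x * ‖x‖^q) := by
      intro x
      simp only [T]
      rw [lintegral_const_mul _ (by fun_prop)]
      by_cases hx : R/2 ≤ ‖x‖
      · rw [indicator_of_mem (show x ∈ {x : R3 | R/2 ≤ ‖x‖} from hx)]
        simp only [Pi.one_apply, one_mul]
        refine (mul_le_mul_right (H f hf hfM hfE x (by linarith)) _).trans ?_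
        have hf0 := hf.n x
        rw [← ENNReal.ofReal_mul hf0, ← ENNReal.ofReal_mul (by positivity)]
        apply ENNReal.ofReal_le_ofReal
        have hx0 : 0 < ‖x‖ := by linarith
        have e : ‖x‖^(γ-1) ≤ (R/2)^(γ-1-q) * ‖x‖^q := by
          have e1 : ‖x‖^(γ-1) = ‖x‖^(γ-1-q) * ‖x‖^q := by rw [← Real.rpow_add hx0]; congr 1; ring
          rw [e1]
          exact mul_le_mul_of_nonneg_right (Real.rpow_le_rpow_of_nonpos (by linarith) hx (by linarith)) (by positivity)
        calc f x * (C * ‖x‖^(γ-1)) ≤ f x * (C * ((R/2)^(γ-1-q) * ‖x‖^q)) := by gcongr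
          _ = _ := by ring
      · rw [indicator_of_notMem (show x ∉ {x : R3 | R/2 ≤ ‖x‖} from hx), zero_mul, zero_mul]; exact zero_le
    refine (lintegral_mono this).trans ?_
    rw [lintegral_const_mul _ (by fun_prop)]
    refine (mul_le_mul_right hfq _).trans ?_
    rw [← ENNReal.ofReal_mul (by positivity)]
    apply ENNReal.ofReal_le_ofReal
    rw [Real.div_rpow (by linarith) (by norm_num), show 1+q-γ = -(γ-1-q) by ring, Real.rpow_neg (by norm_num)]
    apply le_of_eq; field_simp
  refine (lintegral_mono (fun x => lintegral_mono (key x))).trans ?_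
  have : ∀ x, ∫⁻ y, (T x y + T y x) = (∫⁻ y, T x y) + ∫⁻ y, T y x := fun x => lintegral_add_left (mT.comp (measurable_const.prodMk measurable_id)) _
  simp_rw [this]
  rw [lintegral_add_left mT.lintegral_prod_right', lintegral_lintegral_swap (f := fun x y => T y x) mT'.aemeasurable]
  refine (add_le_add b1 b1).trans ?_
  rw [← ENNReal.ofReal_add (by positivity) (by positivity)]
  apply ENNReal.ofReal_le_ofReal; apply le_of_eq; ring

end Part19

section Part20
open scoped ENNReal

section A4
variable {γ β : ℝ} {f0 : R3 → ℝ} {f : ℝ → R3 → ℝ} {N : ENNReal} {M E : ℝ}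

theorem Sol.low (hf : Sol γ β f0 f N (ENNReal.ofReal M) (ENNReal.ofReal E)) (h0 : 0 ≤ γ) (h1 : γ ≤ 1) (hM : 0 < M) (hE : 0 ≤ E) :
    ∃ R0 c : ℝ, 1 ≤ R0 ∧ 0 < c ∧ ∀ t, 0 ≤ t → ∀ v : R3, R0 ≤ ‖v‖ → ENNReal.ofReal (c * ‖v‖^γ) ≤ LE' γ (f t) v := by
  obtain ⟨K, R1, R0, c, hK, hR1, hR, hR0, hc, H⟩ := lower_bound γ h0 h1 M E hM hE
  refine ⟨R0, c, hR0, hc, ?_⟩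
  intro t ht v hv
  refine (H (f t) (hf.reg.adm t ht) (hf.mass t ht) (hf.energy t ht).le v hv).trans ?_
  refine CC_mono (fun w σ => ?_)
  exact mul_le_of_le_one_left zero_le (BX_le_one _ _ _ _ _)

theorem exp_lint (β lam t : ℝ) (hβ : 0 < β) (hl : 0 < lam) (ht : 0 ≤ t) :
    ∫⁻ τ in Ioc 0 t, ENNReal.ofReal (β * Real.exp (lam * (τ - t))) ≤ ENNReal.ofReal (β / lam) := by
  have hc : Continuous (fun τ => β * Real.exp (lam * (τ - t))) := by fun_prop
  rw [← ofReal_integral_eq_lintegral_ofReal]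
  · apply ENNReal.ofReal_le_ofReal
    rw [← intervalIntegral.integral_of_le ht]
    rw [intervalIntegral.integral_eq_sub_of_hasDerivAt (f := fun τ => β / lam * Real.exp (lam * (τ - t)))]
    · simp
      positivity
    · intro x _
      have : HasDerivAt (fun τ => lam * (τ - t)) lam x := by
        simpa using ((hasDerivAt_id x).sub_const t).const_mul lam
      have h2 := this.exp.const_mul (β/lam)
      have e : β / lam * (Real.exp (lam * (x - t)) * lam) = β * Real.exp (lam * (x - t)) := by field_simp
      rw [e] at h2
      exact h2
    · exact hc.intervalIntegrable _ _
  · exact (hc.integrableOn_Icc).mono_set Ioc_subset_Icc_self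
  · filter_upwards with τ; positivity

theorem Sol.duh2 (hf : Sol γ β f0 f N (ENNReal.ofReal M) (ENNReal.ofReal E)) (h0 : 0 ≤ γ) (h1 : γ ≤ 1) (hβ : 0 < β)
    (R0 c : ℝ) (hc : 0 < c) (hR0 : 1 ≤ R0) (hlow : ∀ t, 0 ≤ t → ∀ v : R3, R0 ≤ ‖v‖ → ENNReal.ofReal (c * ‖v‖^γ) ≤ LE' γ (f t) v) :
    ∀ᵐ v, ∀ t, 0 ≤ t → ∀ R, R0 ≤ R → R ≤ ‖v‖ →
      ENNReal.ofReal (f t v) ≤ ENNReal.ofReal (f0 v) + ∫⁻ τ in Ioc 0 t, ENNReal.ofReal (β * Real.exp (β * (c * R^γ) * (τ - t))) * GE γ (f τ) v := by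
  filter_upwards [hf.duh h0 h1 hβ] with v hv t ht R hR hRv
  have hR' : 0 < R := by linarith
  obtain ⟨lam, hlam⟩ : ∃ lam, lam = β * (c * R^γ) := ⟨_, rfl⟩
  have hl0 : 0 < lam := by rw [hlam]; positivity
  rw [← hlam]
  have h := hv t ht lam ?_
  · have h2 := mul_le_mul_right h (ENNReal.ofReal (Real.exp (-(lam * t))))
    rw [← ENNReal.ofReal_mul (by positivity), ← mul_assoc (Real.exp _), ← Real.exp_add, neg_add_cancel, Real.exp_zero, one_mul, mul_add,
      ← lintegral_const_mul' _ _ ENNReal.ofReal_ne_top] at h2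
    refine h2.trans (add_le_add ?_ (le_of_eq ?_))
    · refine mul_le_of_le_one_left zero_le ?_
      rw [ENNReal.ofReal_le_one, Real.exp_le_one_iff]
      have : 0 ≤ lam * t := by positivity
      linarith
    · congr 1; ext τ
      rw [← mul_assoc, ← ENNReal.ofReal_mul (by positivity)]
      congr 2
      rw [mul_left_comm, ← Real.exp_add]; congr 2; ring
  · intro τ hτ _
    rw [hlam, ENNReal.ofReal_mul hβ.le]
    refine mul_le_mul_right (le_trans (ENNReal.ofReal_le_ofReal ?_) (hlow τ hτ v (hR.trans hRv))) _
    gcongr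

theorem E2_scale (R S : ℝ) (hR : 0 < R) :
    ∫⁻ z : E2, ENNReal.ofReal ((R + ‖z‖)^(-S)) = ENNReal.ofReal (R^(2-S)) * ∫⁻ z : E2, ENNReal.ofReal ((1 + ‖z‖)^(-S)) := by
  have hm : Measurable (fun z : E2 => ENNReal.ofReal ((R + ‖z‖)^(-S))) := by fun_prop
  have h := lintegral_map (μ := (volume : Measure E2)) (f := fun z : E2 => ENNReal.ofReal ((R + ‖z‖)^(-S))) (g := fun z => R • z) hm (by fun_prop)
  rw [Measure.map_addHaar_smul _ hR.ne', lintegral_smul_measure] at h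
  have h2 : ∀ z : E2, ENNReal.ofReal ((R + ‖R • z‖)^(-S)) = ENNReal.ofReal (R^(-S)) * ENNReal.ofReal ((1 + ‖z‖)^(-S)) := by
    intro z
    rw [norm_smul, Real.norm_of_nonneg hR.le, ← ENNReal.ofReal_mul (by positivity), ← Real.mul_rpow hR.le (by positivity)]
    congr 2; ring
  simp_rw [h2] at h
  rw [lintegral_const_mul _ (by fun_prop)] at h
  rw [show 2 - S = 2 + (-S) by ring, Real.rpow_add hR, ENNReal.ofReal_mul (by positivity), mul_assoc, ← h, smul_eq_mul, ← mul_assoc, ← ENNReal.ofReal_mul (by positivity)]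
  simp [abs_of_pos hR]
  rw [mul_inv_cancel₀ (by positivity)]; simp

theorem plane_f0 (S : ℝ) (hS : 2 < S) (C0 : ℝ) (hC0 : 0 ≤ C0) (f0 : R3 → ℝ)
    (hf0 : ∀ᵐ v, f0 v ≤ C0 * (1 + ‖v‖)^(-S)) :
    ∃ C, 0 ≤ C ∧ ∀ R, 1 ≤ R → ∀ (a : S2) (ψ : ℝ → ENNReal), Measurable ψ →
      ∫⁻ q : R3, ψ ⟪(a:R3), q⟫ * ({q : R3 | R ≤ ‖q‖}.indicator 1 q * ENNReal.ofReal (f0 q)) ≤ ENNReal.ofReal (C * R^(2-S)) * ∫⁻ s, ψ s := by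
  have hfin : ∫⁻ z : E2, ENNReal.ofReal ((1 + ‖z‖)^(-S)) < ⊤ := finite_integral_one_add_norm (by simpa using hS)
  obtain ⟨I, hI⟩ : ∃ I : ℝ, I = (∫⁻ z : E2, ENNReal.ofReal ((1 + ‖z‖)^(-S))).toReal := ⟨_, rfl⟩
  have hI' : ∫⁻ z : E2, ENNReal.ofReal ((1 + ‖z‖)^(-S)) = ENNReal.ofReal I := by rw [hI, ENNReal.ofReal_toReal hfin.ne]
  have hI0 : 0 ≤ I := by rw [hI]; positivity
  refine ⟨C0 * 2^S * I, by positivity, ?_⟩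
  intro R hR a ψ hψ
  have hR0 : 0 < R := by linarith
  have mJ : Measurable ({y : R3 | R ≤ ‖y‖}.indicator (1 : R3 → ENNReal)) := measurable_one.indicator (measurableSet_le (by fun_prop) (by fun_prop))
  have mio := measurable_iota a
  calc _ ≤ ∫⁻ q : R3, ψ ⟪(a:R3), q⟫ * ({q : R3 | R ≤ ‖q‖}.indicator 1 q * ENNReal.ofReal (C0 * (1 + ‖q‖)^(-S))) := by
        apply lintegral_mono_ae
        filter_upwards [hf0] with q hq
        gcongr
    _ = ∫⁻ s : ℝ, ∫⁻ z : E2, ψ s * ({q : R3 | R ≤ ‖q‖}.indicator 1 (s • (a:R3) + iota a z) * ENNReal.ofReal (C0 * (1 + ‖s • (a:R3) + iota a z‖)^(-S))) := by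
        rw [lintegral_decomp a _ (by fun_prop)]
        simp_rw [inner_decomp]
    _ ≤ ∫⁻ s : ℝ, ∫⁻ z : E2, ψ s * (ENNReal.ofReal (C0 * 2^S) * ENNReal.ofReal ((R + ‖z‖)^(-S))) := by
        refine lintegral_mono (fun s => lintegral_mono (fun z => mul_le_mul_right ?_ _))
        by_cases h : R ≤ ‖s • (a:R3) + iota a z‖
        · rw [indicator_of_mem (show _ ∈ {q : R3 | R ≤ ‖q‖} from h), Pi.one_apply, one_mul, ← ENNReal.ofReal_mul (by positivity)]
          apply ENNReal.ofReal_le_ofReal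
          have hz : ‖z‖ ≤ ‖s • (a:R3) + iota a z‖ := by
            rw [norm_decomp]; apply Real.le_sqrt_of_sq_le; nlinarith [sq_nonneg s]
          have : (1 + ‖s • (a:R3) + iota a z‖)^(-S) ≤ ((R + ‖z‖)/2)^(-S) :=
            Real.rpow_le_rpow_of_nonpos (by positivity) (by linarith) (by linarith)
          rw [Real.div_rpow (by positivity) (by norm_num), Real.rpow_neg (by norm_num : (0:ℝ) ≤ 2), div_inv_eq_mul] at this
          calc _ ≤ C0 * ((R + ‖z‖)^(-S) * 2^S) := by gcongr
            _ = _ := by ring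
        · rw [indicator_of_notMem (show _ ∉ {q : R3 | R ≤ ‖q‖} from h), zero_mul]; exact zero_le
    _ = ∫⁻ s : ℝ, ENNReal.ofReal (C0 * 2^S * I * R^(2-S)) * ψ s := by
        congr 1; ext s
        rw [lintegral_const_mul _ (by fun_prop), lintegral_const_mul _ (by fun_prop), E2_scale R S hR0, hI', ← ENNReal.ofReal_mul (by positivity), ← ENNReal.ofReal_mul (by positivity), mul_comm]
        congr 2; ring
    _ = _ := by rw [lintegral_const_mul _ hψ]

theorem jcomp {α β : Type*} [MeasurableSpace α] [MeasurableSpace β] (G : α → β → ENNReal) (h : Measurable (fun p : α × β => G p.1 p.2)) :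
    (∀ v, Measurable (fun τ => G τ v)) ∧ (∀ τ, Measurable (fun v => G τ v)) ∧ Measurable (fun p : β × α => G p.2 p.1) :=
  ⟨fun _ => h.comp (measurable_id.prodMk measurable_const), fun _ => h.comp (measurable_const.prodMk measurable_id), h.comp measurable_swap⟩

theorem A4 (hf : Sol γ β f0 f N (ENNReal.ofReal M) (ENNReal.ofReal E)) (h0 : 0 < γ) (h1 : γ ≤ 1) (hβ : 0 < β)
    (hM : 0 < M) (hE : 0 ≤ E) (hf0m : Measurable f0) (S : ℝ) (hS : 2 < S) (C0 : ℝ) (hC0 : 0 ≤ C0) 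
    (hf0 : ∀ᵐ v, f0 v ≤ C0 * (1 + ‖v‖)^(-S)) (q Q : ℝ) (hq : 0 ≤ q) (hQ : 0 ≤ Q) (hqS : S - 3 ≤ q)
    (hmom : ∀ t, 0 ≤ t → ∫⁻ v, ENNReal.ofReal (f t v * ‖v‖^q) ≤ ENNReal.ofReal Q)
    (R0 c : ℝ) (hR0 : 2 ≤ R0) (hc : 0 < c) (hlow : ∀ t, 0 ≤ t → ∀ v : R3, R0 ≤ ‖v‖ → ENNReal.ofReal (c * ‖v‖^γ) ≤ LE' γ (f t) v) :
    ∃ C, 0 ≤ C ∧ ∀ R, R0 ≤ R → ∀ t, 0 ≤ t → ∀ (a : S2) (ψ : ℝ → ENNReal), Measurable ψ →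
      ∫⁻ q : R3, ψ ⟪(a:R3), q⟫ * ({q : R3 | R ≤ ‖q‖}.indicator 1 q * ENNReal.ofReal (f t q)) ≤ ENNReal.ofReal (C * R^(2-S)) * ∫⁻ s, ψ s := by
  obtain ⟨C1, hC1, H1⟩ := plane_f0 S hS C0 hC0 f0 hf0
  obtain ⟨C2, hC2, H2⟩ := pot2_bound γ h0 h1 M E hM.le hE q Q hq hQ
  refine ⟨C1 + 256 * C2 / c, by positivity, ?_⟩
  intro R hR t ht a ψ hψ
  have hRp : 0 < R := by linarith
  have mJ : Measurable ({y : R3 | R ≤ ‖y‖}.indicator (1 : R3 → ENNReal)) := measurable_one.indicator (measurableSet_le (by fun_prop) (by fun_prop))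
  have jG := hf.jG
  obtain ⟨lam, hlam⟩ : ∃ lam, lam = β * (c * R^γ) := ⟨_, rfl⟩
  have hl0 : 0 < lam := by rw [hlam]; positivity
  let k : ℝ → ENNReal := fun τ => ENNReal.ofReal (β * Real.exp (lam * (τ - t)))
  have mk : Measurable k := by simp only [k]; fun_prop
  have jG' : ∀ v, Measurable (fun τ => GE γ (f τ) v) := (jcomp (fun τ v => GE γ (f τ) v) jG).1
  have jG2 : Measurable (fun p : R3 × ℝ => GE γ (f p.2) p.1) := (jcomp (fun τ v => GE γ (f τ) v) jG).2.2
  have step1 : ∫⁻ q : R3, ψ ⟪(a:R3), q⟫ * ({q : R3 | R ≤ ‖q‖}.indicator 1 q * ENNReal.ofReal (f t q)) ≤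
      (∫⁻ q : R3, ψ ⟪(a:R3), q⟫ * ({q : R3 | R ≤ ‖q‖}.indicator 1 q * ENNReal.ofReal (f0 q))) +
      ∫⁻ q : R3, ∫⁻ τ in Ioc 0 t, k τ * (ψ ⟪(a:R3), q⟫ * ({q : R3 | R ≤ ‖q‖}.indicator 1 q * GE γ (f τ) q)) := by
    rw [← lintegral_add_left (by fun_prop)]
    apply lintegral_mono_ae
    filter_upwards [hf.duh2 h0.le h1 hβ R0 c hc (by linarith) hlow] with v hv
    by_cases h : R ≤ ‖v‖
    · rw [indicator_of_mem (show v ∈ {q : R3 | R ≤ ‖q‖} from h)]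
      simp only [Pi.one_apply, one_mul]
      have := mul_le_mul_right (hv t ht R hR h) (ψ ⟪(a:R3), v⟫)
      rw [mul_add, ← hlam] at this
      refine this.trans (add_le_add_right ?_ _)
      have jGv := jG' v
      rw [← lintegral_const_mul _ (by fun_prop)]
      apply le_of_eq
      congr 1; ext τ; simp only [k]; ring
    · rw [indicator_of_notMem (show v ∉ {q : R3 | R ≤ ‖q‖} from h), zero_mul, mul_zero]; exact zero_le
  have step2 : ∫⁻ q : R3, ∫⁻ τ in Ioc 0 t, k τ * (ψ ⟪(a:R3), q⟫ * ({q : R3 | R ≤ ‖q‖}.indicator 1 q * GE γ (f τ) q)) ≤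
      ENNReal.ofReal (β / lam) * (ENNReal.ofReal 256 * (∫⁻ s, ψ s) * ENNReal.ofReal (C2 * R^(γ-1-q))) := by
    rw [lintegral_lintegral_swap (by
      apply Measurable.aemeasurable
      simp only [Function.uncurry_def]
      fun_prop)]
    refine le_trans (b := ∫⁻ τ in Ioc 0 t, k τ * (ENNReal.ofReal 256 * (∫⁻ s, ψ s) * ENNReal.ofReal (C2 * R^(γ-1-q)))) ?_ ?_
    · apply setLIntegral_mono' measurableSet_Ioc
      intro τ hτ
      have ad := hf.reg.adm τ hτ.1.le
      have mG : Measurable (fun q => GE γ (f τ) q) := (jcomp (fun τ v => GE γ (f τ) v) jG).2.1 τ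
      rw [lintegral_const_mul _ (by fun_prop)]
      refine mul_le_mul_right ?_ _
      refine le_trans (lintegral_mono (fun v => mul_le_mul_right (mul_le_mul_right (GE_le_GF γ (f τ) ad v) _) _)) ?_
      refine (pl_lemma γ h0 a ψ hψ R hRp.le (f τ) ad).trans (mul_le_mul_right ?_ _)
      exact H2 (f τ) ad (hf.mass τ hτ.1.le).le (hf.energy τ hτ.1.le).le (hmom τ hτ.1.le) R (by linarith)
    · rw [lintegral_mul_const _ mk]
      exact mul_le_mul_left (exp_lint β lam t hβ hl0 ht) _
  refine step1.trans ((add_le_add (H1 R (by linarith) a ψ hψ) step2).trans ?_)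
  have : ENNReal.ofReal (β / lam) * (ENNReal.ofReal 256 * (∫⁻ s, ψ s) * ENNReal.ofReal (C2 * R^(γ-1-q))) ≤ ENNReal.ofReal (256 * C2 / c * R^(2-S)) * ∫⁻ s, ψ s := by
    calc _ = ENNReal.ofReal (β / lam) * ENNReal.ofReal 256 * ENNReal.ofReal (C2 * R^(γ-1-q)) * ∫⁻ s, ψ s := by ring
      _ ≤ _ := by
        refine mul_le_mul_left ?_ _
        rw [← ENNReal.ofReal_mul (by positivity), ← ENNReal.ofReal_mul (by positivity)]
        apply ENNReal.ofReal_le_ofReal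
        have e : β / lam * 256 * (C2 * R^(γ-1-q)) = 256 * C2 / c * R^(-1-q) := by
          rw [show -1 - q = (γ-1-q) - γ by ring, Real.rpow_sub hRp (γ-1-q) γ, hlam]; field_simp
        rw [e]
        exact mul_le_mul_of_nonneg_left (Real.rpow_le_rpow_of_exponent_le (by linarith) (by linarith)) (by positivity)
  refine (add_le_add_right this _).trans (le_of_eq ?_)
  rw [← add_mul, ← ENNReal.ofReal_add (by positivity) (by positivity), add_mul]

end A4

end Part20

section Part21
open scoped ENNReal

theorem floor_facts (R0 : ℝ) (hR0 : 1 ≤ R0) (r : ℝ) (hr : 4 * R0 ≤ r) : ∃ n : ℕ, R0 ≤ n ∧ 2 * (n:ℝ) ≤ r ∧ r ≤ 4 * n := by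
  refine ⟨⌊r/2⌋₊, ?_, ?_, ?_⟩
  · have := Nat.lt_floor_add_one (r/2); linarith
  · have := Nat.floor_le (show 0 ≤ r/2 by linarith); linarith
  · have := Nat.lt_floor_add_one (r/2); linarith

def PlaneB (F : R3 → ℝ) (R0 Cp S : ℝ) : Prop :=
  ∀ n : ℕ, R0 ≤ n → ∀ᵐ v : R3, ∀ᵐ a : S2 ∂sphMeasure, ∫⁻ z : E2, {q : R3 | (n:ℝ) ≤ ‖q‖}.indicator 1 (v + iota a z) * ENNReal.ofReal (F (v + iota a z)) ≤ ENNReal.ofReal (Cp * (n:ℝ)^(2-S))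

theorem PlaneB.all {F : R3 → ℝ} {R0 Cp S : ℝ} (hP : PlaneB F R0 Cp S) : ∀ᵐ v : R3, ∀ n : ℕ, R0 ≤ n → ∀ᵐ a : S2 ∂sphMeasure, ∫⁻ z : E2, {q : R3 | (n:ℝ) ≤ ‖q‖}.indicator 1 (v + iota a z) * ENNReal.ofReal (F (v + iota a z)) ≤ ENNReal.ofReal (Cp * (n:ℝ)^(2-S)) := by
  refine ae_all_iff.2 fun n => ?_
  by_cases h : R0 ≤ (n:ℝ)
  · filter_upwards [hP n h] with v hv _ using hv
  · exact Filter.Eventually.of_forall (fun v h' => absurd h' h)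

theorem CC_p (v : R3) (γ : ℝ) (hγ : 0 ≤ γ) (hγ1 : γ ≤ 1) (h g : R3 → ENNReal) (hh : Measurable h) (hg : Measurable g) (Λ : ENNReal)
    (hΛ : ∀ᵐ a : S2 ∂sphMeasure, ∫⁻ z : E2, g (v + iota a z) ≤ Λ) :
    CC γ v (fun w σ => h (vOut v w σ) * g (vOutStar v w σ)) ≤ 4 * Λ * ∫⁻ x, ENNReal.ofReal (‖x - v‖^(γ-2)) * h x := by
  refine le_trans (le_of_eq ?_) (plemma v γ hγ hγ1 h g hh hg Λ hΛ)
  unfold CC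
  simp_rw [mul_assoc]

theorem CC_sym2 (γ : ℝ) (v : R3) (F : R3 → ENNReal) (T : R3 → R3 → ENNReal) (hT : Measurable (fun p : R3 × R3 => T p.1 p.2))
    (h : ∀ w σ, F (vOut v w σ) * F (vOutStar v w σ) ≤ T (vOut v w σ) (vOutStar v w σ) + T (vOutStar v w σ) (vOut v w σ)) :
    CC γ v (fun w σ => F (vOut v w σ) * F (vOutStar v w σ)) ≤ 2 * CC γ v (fun w σ => T (vOut v w σ) (vOutStar v w σ)) := by
  refine (CC_mono h).trans ?_
  have m1 : Measurable (fun p : R3 × S2 => T (vOut v p.1 p.2) (vOutStar v p.1 p.2)) :=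
    hT.comp (g := fun p : R3 × R3 => T p.1 p.2) (f := fun p : R3 × S2 => (vOut v p.1 p.2, vOutStar v p.1 p.2)) (by fun_prop)
  rw [CC_add m1, ← CC_swap γ v (fun w x y => T x y), two_mul]
  exact hT.comp (g := fun p : R3 × R3 => T p.1 p.2) (f := fun p : R3 × R3 × R3 => p.2) (by fun_prop)

theorem two_ofReal (x : ℝ) : 2 * ENNReal.ofReal x = ENNReal.ofReal (2 * x) := by
  rw [ENNReal.ofReal_mul (by norm_num)]; simp
theorem four_ofReal (x : ℝ) : 4 * ENNReal.ofReal x = ENNReal.ofReal (4 * x) := by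
  rw [ENNReal.ofReal_mul (by norm_num)]; simp

theorem static1 (γ : ℝ) (h0 : 0 < γ) (h1 : γ ≤ 1) (M E : ℝ) (hM : 0 ≤ M) (hE : 0 ≤ E) (R0 Cp S : ℝ) (hR0 : 1 ≤ R0) (hCp : 0 ≤ Cp) (hS : 2 < S) :
    ∃ A, 0 ≤ A ∧ ∀ F : R3 → ℝ, Adm F → ∫⁻ v, ENNReal.ofReal (F v) ≤ ENNReal.ofReal M →
      ∫⁻ v, ENNReal.ofReal (F v * ‖v‖^2) ≤ ENNReal.ofReal E → PlaneB F R0 Cp S →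
      ∀ᵐ v : R3, 4 * R0 ≤ ‖v‖ → GF γ F v ≤ ENNReal.ofReal (A * ‖v‖^(γ-2)) := by
  obtain ⟨A1, hA1⟩ : ∃ A1, A1 = AK γ 1 := ⟨_, rfl⟩
  have hA10 : 0 ≤ A1 := by rw [hA1]; unfold AK; positivity
  refine ⟨2 * (A1 * 5 * E + 4 * Cp * M) * 4^(2-γ), by positivity, ?_⟩
  intro F hF hFM hFE hP
  have hm := hF.m
  filter_upwards [hP.all] with v hv hvR
  obtain ⟨n, hn1, hn2, hn3⟩ := floor_facts R0 hR0 ‖v‖ hvR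
  have hn : (1:ℝ) ≤ n := hR0.trans hn1
  have hnp : (0:ℝ) < n := by linarith
  have hΛ := hv n hn1
  have mJ : Measurable ({y : R3 | (n:ℝ) ≤ ‖y‖}.indicator (1 : R3 → ENNReal)) := measurable_one.indicator (measurableSet_le (by fun_prop) (by fun_prop))
  have mJ2 : Measurable ({y : R3 | (n:ℝ) ≤ ‖y - v‖}.indicator (1 : R3 → ENNReal)) := measurable_one.indicator (measurableSet_le (by fun_prop) (by fun_prop))
  have mJ3 := mJi 1 v
  let T1 : R3 → R3 → ENNReal := fun x y => ({y : R3 | (n:ℝ) ≤ ‖y‖}.indicator 1 x * ENNReal.ofReal (F x)) * (Jset 1 v).indicator 1 (x,y)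
  let T2 : R3 → R3 → ENNReal := fun x y => ({y : R3 | (n:ℝ) ≤ ‖y - v‖}.indicator 1 x * ENNReal.ofReal (F x)) * ({y : R3 | (n:ℝ) ≤ ‖y‖}.indicator 1 y * ENNReal.ofReal (F y))
  have mT1 : Measurable (fun p : R3 × R3 => T1 p.1 p.2) := by simp only [T1]; fun_prop
  have mT2 : Measurable (fun p : R3 × R3 => T2 p.1 p.2) := by simp only [T2]; fun_prop
  have key0 : ∀ x y : R3, ‖v‖^2 ≤ ‖x‖^2 + ‖y‖^2 → ‖y - v‖ ≤ ‖x - v‖ → ENNReal.ofReal (F x) * ENNReal.ofReal (F y) ≤ T1 x y + T2 x y := by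
    intro x y hxy hd
    by_cases hx : (n:ℝ) ≤ ‖x‖
    · refine le_add_right ?_
      simp only [T1]
      rw [indicator_of_mem (show x ∈ {y : R3 | (n:ℝ) ≤ ‖y‖} from hx), indicator_of_mem (show (x,y) ∈ Jset 1 v from by simpa [Jset] using hd)]
      simp only [Pi.one_apply, one_mul, mul_one]
      exact mul_le_of_le_one_right zero_le (by simpa using hF.l y)
    · refine le_add_left (le_of_eq ?_)
      push Not at hx
      have hy : (n:ℝ) ≤ ‖y‖ := by
        by_contra hy
        push Not at hy
        nlinarith [norm_nonneg x, norm_nonneg y]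
      have hxv : (n:ℝ) ≤ ‖x - v‖ := by
        have := norm_sub_norm_le v x
        rw [norm_sub_rev] at this; linarith
      simp only [T2]
      rw [indicator_of_mem (show x ∈ {y : R3 | (n:ℝ) ≤ ‖y - v‖} from hxv), indicator_of_mem (show y ∈ {y : R3 | (n:ℝ) ≤ ‖y‖} from hy)]
      simp
  have key : GF γ F v ≤ 2 * CC γ v (fun w σ => T1 (vOut v w σ) (vOutStar v w σ) + T2 (vOut v w σ) (vOutStar v w σ)) := by
    unfold GF
    refine CC_sym2 γ v (fun x => ENNReal.ofReal (F x)) (fun x y => T1 x y + T2 x y) (mT1.add mT2) ?_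
    intro w σ
    have hen := col_energy v w σ
    rcases le_total ‖vOutStar v w σ - v‖ ‖vOut v w σ - v‖ with h | h
    · exact le_add_right (key0 _ _ (by nlinarith [sq_nonneg ‖w‖]) h)
    · refine le_add_left ?_
      rw [mul_comm]
      exact key0 _ _ (by nlinarith [sq_nonneg ‖w‖]) h
  have m1 : Measurable (fun p : R3 × S2 => T1 (vOut v p.1 p.2) (vOutStar v p.1 p.2)) :=
    mT1.comp (g := fun p : R3 × R3 => T1 p.1 p.2) (f := fun p : R3 × S2 => (vOut v p.1 p.2, vOutStar v p.1 p.2)) (by fun_prop)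
  rw [CC_add m1] at key
  have b1 : CC γ v (fun w σ => T1 (vOut v w σ) (vOutStar v w σ)) ≤ ENNReal.ofReal (A1 * 5 * E * (n:ℝ)^(γ-2)) := by
    refine (CC_J γ h0.le v 1 zero_le_one (fun x => {y : R3 | (n:ℝ) ≤ ‖y‖}.indicator 1 x * ENNReal.ofReal (F x)) (by fun_prop)).trans ?_
    rw [← hA1]
    have : ∀ x : R3, ENNReal.ofReal (‖x - v‖^γ) * ({y : R3 | (n:ℝ) ≤ ‖y‖}.indicator 1 x * ENNReal.ofReal (F x)) ≤ ENNReal.ofReal (5 * (n:ℝ)^(γ-2)) * ENNReal.ofReal (F x * ‖x‖^2) := by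
      intro x
      by_cases hx : (n:ℝ) ≤ ‖x‖
      · rw [indicator_of_mem (show x ∈ {y : R3 | (n:ℝ) ≤ ‖y‖} from hx)]
        simp only [Pi.one_apply, one_mul]
        have hF0 := hF.n x
        rw [← ENNReal.ofReal_mul (by positivity), ← ENNReal.ofReal_mul (by positivity)]
        apply ENNReal.ofReal_le_ofReal
        have hx0 : 0 < ‖x‖ := by linarith
        have e1 : ‖x - v‖^γ ≤ (5 * ‖x‖)^γ := Real.rpow_le_rpow (norm_nonneg _) (by have := norm_sub_le x v; linarith) h0.le
        have e2 : (5 * ‖x‖)^γ ≤ 5 * ((n:ℝ)^(γ-2) * ‖x‖^2) := by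
          rw [Real.mul_rpow (by norm_num) hx0.le]
          have e3 : ‖x‖^γ = ‖x‖^(γ-2) * ‖x‖^2 := by rw [Real.rpow_sub hx0, Real.rpow_two]; field_simp
          have e4 : (5:ℝ)^γ ≤ 5 := by
            calc (5:ℝ)^γ ≤ 5^(1:ℝ) := Real.rpow_le_rpow_of_exponent_le (by norm_num) h1
              _ = 5 := Real.rpow_one 5
          rw [e3]
          have := Real.rpow_le_rpow_of_nonpos hnp hx (show γ - 2 ≤ 0 by linarith)
          gcongr
        calc _ ≤ (5 * ((n:ℝ)^(γ-2) * ‖x‖^2)) * F x := by gcongr; exact e1.trans e2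
          _ = _ := by ring
      · rw [indicator_of_notMem (show x ∉ {y : R3 | (n:ℝ) ≤ ‖y‖} from hx), zero_mul, mul_zero]; exact zero_le
    refine (mul_le_mul_right (lintegral_mono this) _).trans ?_
    rw [lintegral_const_mul _ (by fun_prop)]
    refine (mul_le_mul_right (mul_le_mul_right hFE _) _).trans ?_
    rw [← ENNReal.ofReal_mul (by positivity), ← ENNReal.ofReal_mul hA10]
    apply ENNReal.ofReal_le_ofReal; apply le_of_eq; ring
  have b2 : CC γ v (fun w σ => T2 (vOut v w σ) (vOutStar v w σ)) ≤ ENNReal.ofReal (4 * Cp * M * (n:ℝ)^(γ-2)) := by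
    refine (CC_p v γ h0.le h1 (fun x => {y : R3 | (n:ℝ) ≤ ‖y - v‖}.indicator 1 x * ENNReal.ofReal (F x)) (fun y => {y : R3 | (n:ℝ) ≤ ‖y‖}.indicator 1 y * ENNReal.ofReal (F y)) (by fun_prop) (by fun_prop) _ hΛ).trans ?_
    have : ∀ x : R3, ENNReal.ofReal (‖x - v‖^(γ-2)) * ({y : R3 | (n:ℝ) ≤ ‖y - v‖}.indicator 1 x * ENNReal.ofReal (F x)) ≤ ENNReal.ofReal ((n:ℝ)^(γ-2)) * ENNReal.ofReal (F x) := by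
      intro x
      by_cases hx : (n:ℝ) ≤ ‖x - v‖
      · rw [indicator_of_mem (show x ∈ {y : R3 | (n:ℝ) ≤ ‖y - v‖} from hx)]
        simp only [Pi.one_apply, one_mul]
        exact mul_le_mul_left (ENNReal.ofReal_le_ofReal (Real.rpow_le_rpow_of_nonpos hnp hx (by linarith))) _
      · rw [indicator_of_notMem (show x ∉ {y : R3 | (n:ℝ) ≤ ‖y - v‖} from hx), zero_mul, mul_zero]; exact zero_le
    refine (mul_le_mul_right (lintegral_mono this) _).trans ?_
    rw [lintegral_const_mul _ (by fun_prop)]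
    refine (mul_le_mul_right (mul_le_mul_right hFM _) _).trans ?_
    rw [show (4:ENNReal) = ENNReal.ofReal 4 by simp, ← ENNReal.ofReal_mul (by positivity), ← ENNReal.ofReal_mul (by positivity), ← ENNReal.ofReal_mul (by positivity)]
    apply ENNReal.ofReal_le_ofReal
    have e : (n:ℝ)^(2-S) ≤ 1 := Real.rpow_le_one_of_one_le_of_nonpos hn (by linarith)
    calc _ = (n:ℝ)^(2-S) * (4 * Cp * M * (n:ℝ)^(γ-2)) := by ring
      _ ≤ 1 * (4 * Cp * M * (n:ℝ)^(γ-2)) := by gcongr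
      _ = _ := by ring
  refine key.trans ((mul_le_mul_right (add_le_add b1 b2) _).trans ?_)
  rw [← ENNReal.ofReal_add (by positivity) (by positivity), two_ofReal]
  apply ENNReal.ofReal_le_ofReal
  have e : (n:ℝ)^(γ-2) ≤ 4^(2-γ) * ‖v‖^(γ-2) := by
    have := Real.rpow_le_rpow_of_nonpos (show 0 < ‖v‖/4 by linarith) (show ‖v‖/4 ≤ n by linarith) (show γ - 2 ≤ 0 by linarith)
    rw [Real.div_rpow (norm_nonneg _) (by norm_num), show γ - 2 = -(2-γ) by ring, Real.rpow_neg (by norm_num : (0:ℝ) ≤ 4), div_inv_eq_mul, mul_comm] at this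
    rw [show γ - 2 = -(2-γ) by ring]; exact this
  calc _ = 2 * (A1 * 5 * E + 4 * Cp * M) * (n:ℝ)^(γ-2) := by ring
    _ ≤ 2 * (A1 * 5 * E + 4 * Cp * M) * (4^(2-γ) * ‖v‖^(γ-2)) := by gcongr
    _ = _ := by ring

theorem static2 (γ : ℝ) (h0 : 0 < γ) (h1 : γ ≤ 1) (M E : ℝ) (hM : 0 ≤ M) (hE : 0 ≤ E) (R0 R2 Cp S D : ℝ) (hR0 : 1 ≤ R0) (hR2 : R0 ≤ R2) (hCp : 0 ≤ Cp) (hS : 2 < S) (hD : 0 ≤ D) :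
    ∃ A, 0 ≤ A ∧ ∀ F : R3 → ℝ, Adm F → ∫⁻ v, ENNReal.ofReal (F v) ≤ ENNReal.ofReal M →
      ∫⁻ v, ENNReal.ofReal (F v * ‖v‖^2) ≤ ENNReal.ofReal E → PlaneB F R0 Cp S → (∀ᵐ v : R3, R2 ≤ ‖v‖ → F v ≤ D * ‖v‖^(-2:ℝ)) →
      ∀ᵐ v : R3, 4 * R2 ≤ ‖v‖ → GF γ F v ≤ ENNReal.ofReal (A * ‖v‖^(γ-S)) := by
  haveI := sph_fin
  obtain ⟨W, hW0, hW⟩ : ∃ W : ℝ, 0 ≤ W ∧ sphMeasure univ = ENNReal.ofReal W :=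
    ⟨(sphMeasure univ).toReal, by positivity, (ENNReal.ofReal_toReal (measure_ne_top _ _)).symm⟩
  refine ⟨2 * (4 * Cp * (M + E + D * W)) * 4^(S-γ), by positivity, ?_⟩
  intro F hF hFM hFE hP hFD
  have hm := hF.m
  filter_upwards [hP.all] with v hv hvR
  obtain ⟨n, hn1, hn2, hn3⟩ := floor_facts R2 (hR0.trans hR2) ‖v‖ hvR
  have hn : (1:ℝ) ≤ n := (hR0.trans hR2).trans hn1
  have hnp : (0:ℝ) < n := by linarith
  have hΛ := hv n (hR2.trans hn1)
  have mJ : Measurable ({y : R3 | (n:ℝ) ≤ ‖y‖}.indicator (1 : R3 → ENNReal)) := measurable_one.indicator (measurableSet_le (by fun_prop) (by fun_prop))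
  have mJ2 : Measurable ({y : R3 | ‖y - v‖ < 1}.indicator (1 : R3 → ENNReal)) := measurable_one.indicator (measurableSet_lt (by fun_prop) (by fun_prop))
  let T : R3 → R3 → ENNReal := fun x y => ENNReal.ofReal (F x) * ({y : R3 | (n:ℝ) ≤ ‖y‖}.indicator 1 y * ENNReal.ofReal (F y))
  have mT : Measurable (fun p : R3 × R3 => T p.1 p.2) := by simp only [T]; fun_prop
  have key : GF γ F v ≤ 2 * CC γ v (fun w σ => T (vOut v w σ) (vOutStar v w σ)) := by
    unfold GF
    refine CC_sym2 γ v (fun x => ENNReal.ofReal (F x)) T mT ?_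
    intro w σ
    have hen := col_energy v w σ
    by_cases hy : (n:ℝ) ≤ ‖vOutStar v w σ‖
    · refine le_add_right (le_of_eq ?_)
      simp only [T]
      rw [indicator_of_mem (show vOutStar v w σ ∈ {y : R3 | (n:ℝ) ≤ ‖y‖} from hy)]; simp
    · push Not at hy
      have hx : (n:ℝ) ≤ ‖vOut v w σ‖ := by
        by_contra hx
        push Not at hx
        nlinarith [norm_nonneg (vOut v w σ), norm_nonneg (vOutStar v w σ), sq_nonneg ‖w‖]
      refine le_add_left (le_of_eq ?_)
      simp only [T]
      rw [indicator_of_mem (show vOut v w σ ∈ {y : R3 | (n:ℝ) ≤ ‖y‖} from hx)]; simp [mul_comm]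
  have b : CC γ v (fun w σ => T (vOut v w σ) (vOutStar v w σ)) ≤ ENNReal.ofReal (4 * Cp * (M + E + D * W) * ((n:ℝ)^(2-S) * (n:ℝ)^(γ-2))) := by
    refine (CC_p v γ h0.le h1 (fun x => ENNReal.ofReal (F x)) (fun y => {y : R3 | (n:ℝ) ≤ ‖y‖}.indicator 1 y * ENNReal.ofReal (F y)) (by fun_prop) (by fun_prop) _ hΛ).trans ?_
    have : ∀ᵐ x : R3, ENNReal.ofReal (‖x - v‖^(γ-2)) * ENNReal.ofReal (F x) ≤ 
        (ENNReal.ofReal ((n:ℝ)^(γ-2)) * ENNReal.ofReal (F x) + {y : R3 | (n:ℝ) ≤ ‖y‖}.indicator 1 x * ENNReal.ofReal (F x)) + 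
        ENNReal.ofReal (D * (n:ℝ)^(-2:ℝ)) * ({y : R3 | ‖y - v‖ < 1}.indicator 1 x * ENNReal.ofReal (‖x - v‖^(-2:ℝ)) * ENNReal.ofReal ((fun _ => (1:ℝ)) x)) := by
      filter_upwards [hFD, compl_mem_ae_iff.2 (measure_singleton v)] with x hx hxv
      have hxv : 0 < ‖x - v‖ := by
        rw [norm_pos_iff]; exact sub_ne_zero.2 hxv
      by_cases c1 : (n:ℝ) ≤ ‖x - v‖
      · refine le_add_right (le_add_right ?_)
        exact mul_le_mul_left (ENNReal.ofReal_le_ofReal (Real.rpow_le_rpow_of_nonpos hnp c1 (by linarith))) _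
      push Not at c1
      have hxn : (n:ℝ) ≤ ‖x‖ := by
        have := norm_sub_norm_le v x
        rw [norm_sub_rev] at this; linarith
      by_cases c2 : ‖x - v‖ < 1
      · refine le_add_left ?_
        rw [indicator_of_mem (show x ∈ {y : R3 | ‖y - v‖ < 1} from c2)]
        simp only [Pi.one_apply, one_mul, ENNReal.ofReal_one, mul_one]
        rw [mul_comm]
        refine mul_le_mul' (ENNReal.ofReal_le_ofReal ?_) (ENNReal.ofReal_le_ofReal ?_)
        · refine (hx (hn1.trans hxn)).trans ?_
          exact mul_le_mul_of_nonneg_left (Real.rpow_le_rpow_of_nonpos hnp hxn (by norm_num)) hD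
        · exact Real.rpow_le_rpow_of_exponent_ge hxv c2.le (by linarith)
      · refine le_add_right (le_add_left ?_)
        rw [indicator_of_mem (show x ∈ {y : R3 | (n:ℝ) ≤ ‖y‖} from hxn)]
        refine mul_le_mul_left ?_ _
        simpa using Real.rpow_le_one_of_one_le_of_nonpos (not_lt.1 c2) (show γ - 2 ≤ 0 by linarith)
    have i : ∫⁻ x, ENNReal.ofReal (‖x - v‖^(γ-2)) * ENNReal.ofReal (F x) ≤ ENNReal.ofReal ((M + E + D * W) * (n:ℝ)^(γ-2)) := by
      refine (lintegral_mono_ae this).trans ?_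
      rw [lintegral_add_left (by fun_prop), lintegral_add_left (by fun_prop), lintegral_const_mul' _ _ ENNReal.ofReal_ne_top, lintegral_const_mul' _ _ ENNReal.ofReal_ne_top]
      have e1 := tail_le F hF E n hnp hFE
      have e2 := ball_pot' 1 zero_le_one v (fun _ => (1:ℝ)) ⟨measurable_const, fun _ => zero_le_one, fun _ => le_rfl⟩
      refine (add_le_add (add_le_add (mul_le_mul_right hFM _) e1) (mul_le_mul_right e2 _)).trans ?_
      rw [hW, ENNReal.ofReal_one, one_mul, ← ENNReal.ofReal_mul (by positivity), ← ENNReal.ofReal_mul (by positivity), ← ENNReal.ofReal_add (by positivity) (by positivity), ← ENNReal.ofReal_add (by positivity) (by positivity)]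
      apply ENNReal.ofReal_le_ofReal
      have e3 : (n:ℝ)^(-2:ℝ) ≤ (n:ℝ)^(γ-2) := Real.rpow_le_rpow_of_exponent_le hn (by linarith)
      have e4 : E / (n:ℝ)^2 = E * (n:ℝ)^(-2:ℝ) := by rw [Real.rpow_neg hnp.le, Real.rpow_two]; rfl
      rw [e4]
      calc _ ≤ (n:ℝ)^(γ-2) * M + E * (n:ℝ)^(γ-2) + D * (n:ℝ)^(γ-2) * W := by gcongr
        _ = _ := by ring
    refine (mul_le_mul_right i _).trans ?_
    rw [mul_assoc, ← ENNReal.ofReal_mul (by positivity), four_ofReal]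
    apply ENNReal.ofReal_le_ofReal; apply le_of_eq; ring
  refine key.trans ((mul_le_mul_right b _).trans ?_)
  rw [two_ofReal]
  apply ENNReal.ofReal_le_ofReal
  rw [← Real.rpow_add hnp, show 2 - S + (γ - 2) = γ - S by ring]
  have e : (n:ℝ)^(γ-S) ≤ 4^(S-γ) * ‖v‖^(γ-S) := by
    have := Real.rpow_le_rpow_of_nonpos (show 0 < ‖v‖/4 by linarith) (show ‖v‖/4 ≤ n by linarith) (show γ - S ≤ 0 by linarith)
    rw [Real.div_rpow (norm_nonneg _) (by norm_num), show γ - S = -(S-γ) by ring, Real.rpow_neg (by norm_num : (0:ℝ) ≤ 4), div_inv_eq_mul, mul_comm] at this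
    rw [show γ - S = -(S-γ) by ring]; exact this
  calc _ = 2 * (4 * Cp * (M + E + D * W)) * (n:ℝ)^(γ-S) := by ring
    _ ≤ 2 * (4 * Cp * (M + E + D * W)) * (4^(S-γ) * ‖v‖^(γ-S)) := by gcongr
    _ = _ := by ring

section A5
variable {γ β : ℝ} {f0 : R3 → ℝ} {f : ℝ → R3 → ℝ} {N : ENNReal} {M E : ℝ}

theorem gain_to_f (hf : Sol γ β f0 f N (ENNReal.ofReal M) (ENNReal.ofReal E)) (h0 : 0 < γ) (h1 : γ ≤ 1) (hβ : 0 < β)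
    (R0 c : ℝ) (hc : 0 < c) (hR0 : 1 ≤ R0) (hlow : ∀ t, 0 ≤ t → ∀ v : R3, R0 ≤ ‖v‖ → ENNReal.ofReal (c * ‖v‖^γ) ≤ LE' γ (f t) v)
    (R2 A p : ℝ) (hR2 : R0 ≤ R2) (hA : 0 ≤ A) 
    (hG : ∀ t, 0 ≤ t → ∀ᵐ v : R3, R2 ≤ ‖v‖ → GF γ (f t) v ≤ ENNReal.ofReal (A * ‖v‖^(γ-p))) :
    ∀ᵐ v : R3, ∀ t, 0 ≤ t → R2 ≤ ‖v‖ → ENNReal.ofReal (f t v) ≤ ENNReal.ofReal (f0 v) + ENNReal.ofReal (A / c * ‖v‖^(-p)) := by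
  have hq : ∀ᵐ v : R3, ∀ r : ℚ, 0 ≤ (r:ℝ) → R2 ≤ ‖v‖ → (GE γ (f r) v).toReal ≤ A * ‖v‖^(γ-p) := by
    refine ae_all_iff.2 fun r => ?_
    by_cases hr : 0 ≤ (r:ℝ)
    · filter_upwards [hG r hr] with v hv _ hvR
      refine ENNReal.toReal_le_of_le_ofReal (by positivity) ((GE_le_GF γ (f r) (hf.reg.adm r hr) v).trans (hv hvR))
    · exact Filter.Eventually.of_forall (fun v h' => absurd h' hr)
  filter_upwards [hq, hf.duh2 h0.le h1 hβ R0 c hc hR0 hlow] with v hv hd t ht hvR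
  have hvp : 0 < ‖v‖ := by linarith
  have hall : ∀ τ, 0 ≤ τ → GE γ (f τ) v ≤ ENNReal.ofReal (A * ‖v‖^(γ-p)) := by
    intro τ hτ
    rw [← ENNReal.ofReal_toReal (hf.reg.GE_fin γ h0.le h1 v τ hτ)]
    apply ENNReal.ofReal_le_ofReal
    have hcont := hf.reg.GE_cont γ h0.le h1 v
    by_contra hlt
    push Not at hlt
    have := (hcont τ hτ).eventually (lt_mem_nhds hlt)
    have h2 : ∀ᶠ x in nhdsWithin τ (Ioi τ), A * ‖v‖^(γ-p) < (GE γ (f x) v).toReal :=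
      this.filter_mono (nhdsWithin_mono _ (fun x hx => hτ.trans (le_of_lt hx)))
    obtain ⟨u, hu, hsub⟩ := mem_nhdsGT_iff_exists_Ioo_subset.1 h2
    obtain ⟨r, hr1, hr2⟩ := exists_rat_btwn (show τ < u from hu)
    have h3 : A * ‖v‖^(γ-p) < (GE γ (f r) v).toReal := hsub ⟨hr1, hr2⟩
    exact absurd (hv r (hτ.trans hr1.le) hvR) (not_le.2 h3)
  refine (hd t ht ‖v‖ (hR2.trans hvR) le_rfl).trans (add_le_add_right ?_ _)
  have hl : 0 < β * (c * ‖v‖^γ) := by positivity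
  calc _ ≤ ∫⁻ τ in Ioc 0 t, ENNReal.ofReal (β * Real.exp (β * (c * ‖v‖^γ) * (τ - t))) * ENNReal.ofReal (A * ‖v‖^(γ-p)) := by
        refine setLIntegral_mono' measurableSet_Ioc fun τ hτ => ?_
        exact mul_le_mul_right (hall τ hτ.1.le) _
    _ ≤ ENNReal.ofReal (β / (β * (c * ‖v‖^γ))) * ENNReal.ofReal (A * ‖v‖^(γ-p)) := by
        rw [lintegral_mul_const' _ _ ENNReal.ofReal_ne_top]
        exact mul_le_mul_left (exp_lint β _ t hβ hl ht) _
    _ ≤ _ := by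
        rw [← ENNReal.ofReal_mul (by positivity)]
        apply ENNReal.ofReal_le_ofReal; apply le_of_eq
        rw [show γ - p = γ + -p by ring, Real.rpow_add hvp]
        field_simp

theorem A5 (hf : Sol γ β f0 f N (ENNReal.ofReal M) (ENNReal.ofReal E)) (h0 : 0 < γ) (h1 : γ ≤ 1) (hβ : 0 < β)
    (hM : 0 < M) (hE : 0 ≤ E) (hf0m : Measurable f0) (S : ℝ) (hS : 2 < S) (C0 : ℝ) (hC0 : 0 ≤ C0) 
    (hf0 : ∀ᵐ v, f0 v ≤ C0 * (1 + ‖v‖)^(-S)) (q Q : ℝ) (hq : 0 ≤ q) (hQ : 0 ≤ Q) (hqS : S - 3 ≤ q)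
    (hmom : ∀ t, 0 ≤ t → ∫⁻ v, ENNReal.ofReal (f t v * ‖v‖^q) ≤ ENNReal.ofReal Q) :
    ∃ C, 0 < C ∧ ∀ t, 0 ≤ t → ∀ᵐ v : R3, (1 + ‖v‖)^S * f t v ≤ C := by
  obtain ⟨R0', c, hR0', hc, hlow'⟩ := hf.low h0.le h1 hM hE
  obtain ⟨R0, hR0d⟩ : ∃ R0, R0 = max R0' 2 := ⟨_, rfl⟩
  have hR0 : 2 ≤ R0 := by rw [hR0d]; exact le_max_right _ _
  have hR01 : 1 ≤ R0 := by linarith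
  have hlow : ∀ t, 0 ≤ t → ∀ v : R3, R0 ≤ ‖v‖ → ENNReal.ofReal (c * ‖v‖^γ) ≤ LE' γ (f t) v :=
    fun t ht v hv => hlow' t ht v (le_trans (by rw [hR0d]; exact le_max_left _ _) hv)
  obtain ⟨Cp, hCp, H4⟩ := A4 hf h0 h1 hβ hM hE hf0m S hS C0 hC0 hf0 q Q hq hQ hqS hmom R0 c hR0 hc hlow
  have hP : ∀ t, 0 ≤ t → PlaneB (f t) R0 Cp S := by
    intro t ht n hn
    have mJ : Measurable ({y : R3 | (n:ℝ) ≤ ‖y‖}.indicator (1 : R3 → ENNReal)) := measurable_one.indicator (measurableSet_le (by fun_prop) (by fun_prop))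
    have hm := (hf.reg.adm t ht).m
    exact plane_ae (fun q => {q : R3 | (n:ℝ) ≤ ‖q‖}.indicator 1 q * ENNReal.ofReal (f t q)) (by fun_prop) _ (fun a ψ hψ => H4 n hn t ht a ψ hψ)
  obtain ⟨A1, hA1, H1⟩ := static1 γ h0 h1 M E hM.le hE R0 Cp S hR01 hCp hS
  have G1 := gain_to_f hf h0 h1 hβ R0 c hc hR01 hlow (4*R0) A1 2 (by linarith) hA1
    (fun t ht => H1 (f t) (hf.reg.adm t ht) (hf.mass t ht).le (hf.energy t ht).le (hP t ht))
  have hF1 : ∀ t, 0 ≤ t → ∀ᵐ v : R3, 4 * R0 ≤ ‖v‖ → f t v ≤ (C0 + A1 / c) * ‖v‖^(-2:ℝ) := by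
    intro t ht
    filter_upwards [G1, hf0] with v hv h00 hvR
    have hvp : 1 ≤ ‖v‖ := by linarith
    have := hv t ht hvR
    have e : f0 v ≤ C0 * ‖v‖^(-2:ℝ) := by
      refine h00.trans (mul_le_mul_of_nonneg_left ?_ hC0)
      calc _ ≤ ‖v‖^(-S) := Real.rpow_le_rpow_of_nonpos (by linarith) (by linarith) (by linarith)
        _ ≤ _ := Real.rpow_le_rpow_of_exponent_le hvp (by linarith)
    have h2 := this.trans (add_le_add_left (ENNReal.ofReal_le_ofReal e) _)
    rw [← ENNReal.ofReal_add (by positivity) (by positivity), ENNReal.ofReal_le_ofReal_iff (by positivity)] at h2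
    linarith
  obtain ⟨A2, hA2, H2⟩ := static2 γ h0 h1 M E hM.le hE R0 (4*R0) Cp S (C0 + A1/c) hR01 (by linarith) hCp hS (by positivity)
  have G2 := gain_to_f hf h0 h1 hβ R0 c hc hR01 hlow (4*(4*R0)) A2 S (by linarith) hA2
    (fun t ht => H2 (f t) (hf.reg.adm t ht) (hf.mass t ht).le (hf.energy t ht).le (hP t ht) (hF1 t ht))
  refine ⟨(1 + 4*(4*R0))^S + (C0 + A2 / c * 2^S), by positivity, ?_⟩
  intro t ht
  filter_upwards [G2, hf0] with v hv h00
  have hF := hf.reg.adm t ht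
  rcases lt_or_ge ‖v‖ (4*(4*R0)) with hlt | hge
  · have e : (1 + ‖v‖)^S ≤ (1 + 4*(4*R0))^S := Real.rpow_le_rpow (by positivity) (by linarith) (by linarith)
    calc _ ≤ (1 + 4*(4*R0))^S * 1 := mul_le_mul e (hF.l v) (hF.n v) (by positivity)
      _ ≤ _ := by
        have : 0 ≤ C0 + A2 / c * 2^S := by positivity
        linarith
  · have hvp : 1 ≤ ‖v‖ := by linarith
    have h2 := (hv t ht hge).trans (add_le_add_left (ENNReal.ofReal_le_ofReal h00) _)
    rw [← ENNReal.ofReal_add (by positivity) (by positivity), ENNReal.ofReal_le_ofReal_iff (by positivity)] at h2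
    have e1 : (1 + ‖v‖)^S * (1 + ‖v‖)^(-S) = 1 := by
      rw [← Real.rpow_add (by positivity)]; simp
    have e2 : (1 + ‖v‖)^S * ‖v‖^(-S) ≤ 2^S := by
      calc _ ≤ (2*‖v‖)^S * ‖v‖^(-S) := by gcongr; linarith
        _ = 2^S * (‖v‖^S * ‖v‖^(-S)) := by rw [Real.mul_rpow (by norm_num) (by positivity)]; ring
        _ = 2^S := by rw [← Real.rpow_add (by positivity)]; simp
    have h3 := mul_le_mul_of_nonneg_left h2 (show 0 ≤ (1 + ‖v‖)^S by positivity)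
    have e3 : (0:ℝ) < (1 + 4*(4*R0))^S := by positivity
    have e4 := mul_le_mul_of_nonneg_left e2 (show 0 ≤ A2 / c by positivity)
    calc _ ≤ _ := h3
      _ = C0 * ((1 + ‖v‖)^S * (1 + ‖v‖)^(-S)) + A2 / c * ((1 + ‖v‖)^S * ‖v‖^(-S)) := by ring
      _ ≤ _ := by rw [e1]; linarith
end A5

end Part21

section Part22
open scoped ENNReal

/-- convex power truncated linearly beyond `A` -/
def psi (p A x : ℝ) : ℝ := p * x * (min x A)^(p-1) - (p-1) * (min x A)^p
/-- `psi` minus its tangent line at `A` -/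
def chi (p A x : ℝ) : ℝ := psi p A x - p * A^(p-1) * x + (p-1) * A^p

theorem pow_young (p : ℝ) (hp : 1 < p) (x m : ℝ) (hx : 0 ≤ x) (hm : 0 ≤ m) : p * x * m^(p-1) - (p-1) * m^p ≤ x^p := by
  have hc : p.HolderConjugate (p/(p-1)) := Real.HolderConjugate.conjExponent hp
  have h := Real.young_inequality_of_nonneg hx (show 0 ≤ m^(p-1) by positivity) hc
  have hp1 : 0 < p - 1 := by linarith
  rw [← Real.rpow_mul hm, mul_div_cancel₀ _ hp1.ne'] at h
  have h2 := mul_le_mul_of_nonneg_left h (show 0 ≤ p by linarith)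
  have e : p * (x^p / p + m^p / (p/(p-1))) = x^p + (p-1) * m^p := by field_simp
  rw [e] at h2
  linarith

theorem rpow_succ1 (p : ℝ) (m : ℝ) (hm : 0 ≤ m) (hp : 1 < p) : m * m^(p-1) = m^p := by
  rcases hm.eq_or_lt with h | h
  · rw [← h, Real.zero_rpow (by linarith), zero_mul, ]
    rw [Real.zero_rpow (by linarith)]
  · rw [Real.rpow_sub h, Real.rpow_one]; field_simp

theorem psi_ge (p A : ℝ) (hp : 1 < p) (hA : 0 ≤ A) (b m : ℝ) (hb : 0 ≤ b) (hm : 0 ≤ m) (hmA : m ≤ A) :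
    p * b * m^(p-1) - (p-1) * m^p ≤ psi p A b := by
  unfold psi
  rcases le_total b A with h | h
  · rw [min_eq_left h]
    have := pow_young p hp b m hb hm
    have e := rpow_succ1 p b hb hp
    have : p * b * b^(p-1) = p * b^p := by rw [mul_assoc, e]
    linarith
  · rw [min_eq_right h]
    have h1 := pow_young p hp A m hA hm
    have e := rpow_succ1 p A hA hp
    have e2 : m^(p-1) ≤ A^(p-1) := Real.rpow_le_rpow hm hmA (by linarith)
    have e3 : p * A * (A^(p-1) - m^(p-1)) ≤ p * b * (A^(p-1) - m^(p-1)) := by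
      apply mul_le_mul_of_nonneg_right _ (by linarith)
      nlinarith
    have : p * A * A^(p-1) = p * A^p := by rw [mul_assoc, e]
    nlinarith

theorem min_nn {x A : ℝ} (hx : 0 ≤ x) (hA : 0 ≤ A) : 0 ≤ min x A := le_min hx hA

theorem psi_scale (p A : ℝ) (hp : 1 < p) (hA : 0 ≤ A) (l z : ℝ) (hl : 0 ≤ l) (hz : 0 ≤ z) :
    psi p A (l*z) + (1-l) * (p-1) * (min (l*z) A)^p ≤ l * psi p A z := by
  have h := psi_ge p A hp hA z (min (l*z) A) hz (min_nn (by positivity) hA) (min_le_right _ _)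
  have h2 := mul_le_mul_of_nonneg_left h hl
  unfold psi at *
  linarith

theorem psi_le_pow (p A : ℝ) (hp : 1 < p) (hA : 0 ≤ A) (x : ℝ) (hx : 0 ≤ x) : psi p A x ≤ x^p :=
  pow_young p hp x _ hx (min_nn hx hA)

theorem pow_le_psi (p A : ℝ) (hp : 1 < p) (hA : 0 ≤ A) (x : ℝ) (hx : 0 ≤ x) : (min x A)^p ≤ psi p A x := by
  have h := psi_ge p A hp hA x (min x A) hx (min_nn hx hA) (min_le_right _ _)
  have e := rpow_succ1 p _ (min_nn hx hA) hp
  have : p * (min x A) * (min x A)^(p-1) ≤ p * x * (min x A)^(p-1) := by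
    have := min_nn hx hA
    gcongr
    exact min_le_left _ _
  rw [mul_assoc, e] at this
  unfold psi; linarith

theorem chi_nn (p A : ℝ) (hp : 1 < p) (hA : 0 ≤ A) (x : ℝ) (hx : 0 ≤ x) : 0 ≤ chi p A x := by
  have h := psi_ge p A hp hA x A hx hA le_rfl
  unfold chi; linarith

theorem chi_le (p A : ℝ) (hp : 1 < p) (hA : 0 ≤ A) (x : ℝ) (hx : 0 ≤ x) : chi p A x ≤ (p-1) * A^p := by
  unfold chi psi
  have e : p * x * (min x A)^(p-1) ≤ p * x * A^(p-1) := by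
    have := min_nn hx hA
    gcongr
    exact min_le_right _ _
  have : 0 ≤ (p-1) * (min x A)^p := mul_nonneg (by linarith) (Real.rpow_nonneg (min_nn hx hA) _)
  nlinarith

theorem psi_add_le (p A : ℝ) (hp : 1 < p) (hA : 0 ≤ A) (x y : ℝ) (hx : 0 ≤ x) (hy : 0 ≤ y) (hyx : y ≤ x) :
    psi p A (x+y) ≤ psi p A x + psi p A y + p * 2^(p-1) * (y * (min x A)^(p-1)) := by
  have h := psi_ge p A hp hA x (min (x+y) A) hx (min_nn (by positivity) hA) (min_le_right _ _)
  have h2 := pow_le_psi p A hp hA y hy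
  have h3 : 0 ≤ (min y A)^p := Real.rpow_nonneg (min_nn hy hA) _
  have e : min (x+y) A ≤ 2 * min x A := by
    have := min_le_right (x+y) A
    rcases le_total x A with h | h
    · rw [min_eq_left h]; linarith [min_le_left (x+y) A]
    · rw [min_eq_right h]; linarith
  have e2 : (min (x+y) A)^(p-1) ≤ 2^(p-1) * (min x A)^(p-1) := by
    rw [← Real.mul_rpow (by norm_num) (min_nn hx hA)]
    exact Real.rpow_le_rpow (min_nn (by positivity) hA) e (by linarith)
  have e3 : p * y * (min (x+y) A)^(p-1) ≤ p * y * (2^(p-1) * (min x A)^(p-1)) := by gcongr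
  have : psi p A (x+y) = p * (x+y) * (min (x+y) A)^(p-1) - (p-1) * (min (x+y) A)^p := rfl
  rw [this]
  nlinarith

theorem povz (p A d : ℝ) (hp : 1 < p) (hA : 0 ≤ A) (hd : 0 ≤ d) (x y x' y' : ℝ) (hx : 0 ≤ x) (hy : 0 ≤ y) (hyx : y ≤ x) 
    (hx' : 0 ≤ x') (hy' : 0 ≤ y') (he : x' + y' = x + y) (hd1 : d * (x+y) ≤ x') (hd2 : d * (x+y) ≤ y') :
    psi p A x' + psi p A y' + (p-1) * d^(p+1) * (min x A)^p ≤ psi p A x + psi p A y + p * 2^(p-1) * (y * (min x A)^(p-1)) := by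
  have h1 := psi_add_le p A hp hA x y hx hy hyx
  rcases eq_or_lt_of_le (show 0 ≤ x + y by positivity) with h0 | h0
  · have e1 : x = 0 := by linarith
    have e2 : y = 0 := by linarith
    have e3 : x' = 0 := by linarith
    have e4 : y' = 0 := by linarith
    subst e1 e2 e3 e4
    rw [min_eq_left hA, Real.zero_rpow (by linarith : p ≠ 0)]
    simp
  obtain ⟨l, hl⟩ : ∃ l, l = x' / (x+y) := ⟨_, rfl⟩
  have hlx : x' = l * (x+y) := by rw [hl]; field_simp
  have hly : y' = (1-l) * (x+y) := by linarith
  have hl0 : d ≤ l := by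
    rw [hlx] at hd1; exact le_of_mul_le_mul_right hd1 h0
  have hl1 : d ≤ 1-l := by
    rw [hly] at hd2; exact le_of_mul_le_mul_right hd2 h0
  have s1 := psi_scale p A hp hA l (x+y) (hd.trans hl0) h0.le
  have s2 := psi_scale p A hp hA (1-l) (x+y) (hd.trans hl1) h0.le
  rw [← hlx] at s1
  rw [← hly] at s2
  have g : d^p * (min x A)^p ≤ (min x' A)^p := by
    rw [← Real.mul_rpow hd (min_nn hx hA)]
    apply Real.rpow_le_rpow (mul_nonneg hd (min_nn hx hA)) _ (by linarith)
    apply le_min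
    · refine le_trans (mul_le_mul_of_nonneg_left (min_le_left _ _) hd) (le_trans ?_ hd1)
      nlinarith
    · have : d ≤ 1 := by linarith
      calc _ ≤ 1 * A := mul_le_mul this (min_le_right _ _) (min_nn hx hA) zero_le_one
        _ = A := one_mul A
  have g2 : d * (p-1) * (d^p * (min x A)^p) ≤ (1-l) * (p-1) * (min x' A)^p := by
    have : 0 ≤ d^p * (min x A)^p := mul_nonneg (Real.rpow_nonneg hd _) (Real.rpow_nonneg (min_nn hx hA) _)
    apply mul_le_mul _ g this _
    · apply mul_le_mul_of_nonneg_right hl1 (by linarith)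
    · apply mul_nonneg (hd.trans hl1) (by linarith)
  have g3 : 0 ≤ (1-(1-l)) * (p-1) * (min y' A)^p := by
    apply mul_nonneg (mul_nonneg (by linarith) (by linarith)) (Real.rpow_nonneg (min_nn hy' hA) _)
  have g4 : (p-1) * d^(p+1) * (min x A)^p = d * (p-1) * (d^p * (min x A)^p) := by
    rw [show d^(p+1) = d * d^p by rw [← rpow_succ1 (p+1) d hd (by linarith)]; simp]; ring
  rw [g4]
  nlinarith

theorem povz_chi (p A d : ℝ) (hp : 1 < p) (hA : 0 ≤ A) (hd : 0 ≤ d) (x y x' y' : ℝ) (hx : 0 ≤ x) (hy : 0 ≤ y) (hyx : y ≤ x) 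
    (hx' : 0 ≤ x') (hy' : 0 ≤ y') (he : x' + y' = x + y) (hd1 : d * (x+y) ≤ x') (hd2 : d * (x+y) ≤ y') :
    chi p A x' + chi p A y' + (p-1) * d^(p+1) * (min x A)^p ≤ chi p A x + chi p A y + p * 2^(p-1) * (y * (min x A)^(p-1)) := by
  have h := povz p A d hp hA hd x y x' y' hx hy hyx hx' hy' he hd1 hd2
  have : p * A^(p-1) * (x' + y') = p * A^(p-1) * (x+y) := by rw [he]
  unfold chi; linarith

def mU (p A x y : ℝ) : ℝ := min x y * (min (max x y) A)^(p-1)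

theorem povz_chi0 (p A : ℝ) (hp : 1 < p) (hA : 0 ≤ A) (x y x' y' : ℝ) (hx : 0 ≤ x) (hy : 0 ≤ y)
    (hx' : 0 ≤ x') (hy' : 0 ≤ y') (he : x' + y' = x + y) :
    chi p A x' + chi p A y' ≤ chi p A x + chi p A y + p * 2^(p-1) * mU p A x y := by
  have hz : (0:ℝ)^(p+1) = 0 := Real.zero_rpow (by linarith)
  unfold mU
  rcases le_total y x with h | h
  · have := povz_chi p A 0 hp hA le_rfl x y x' y' hx hy h hx' hy' he (by simpa using hx') (by simpa using hy')
    rw [hz] at this; rw [min_eq_right h, max_eq_left h]; linarith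
  · have := povz_chi p A 0 hp hA le_rfl y x x' y' hy hx h hx' hy' (by linarith) (by simpa using hx') (by simpa using hy')
    rw [hz] at this; rw [min_eq_left h, max_eq_right h]; linarith

theorem mU_nn (p A x y : ℝ) (hA : 0 ≤ A) (hx : 0 ≤ x) (hy : 0 ≤ y) : 0 ≤ mU p A x y := by
  unfold mU
  exact mul_nonneg (le_min hx hy) (Real.rpow_nonneg (min_nn (le_max_of_le_left hx) hA) _)

theorem mU_le (γ : ℝ) (h0 : 0 < γ) (h1 : γ ≤ 1) (p A : ℝ) (hA : 0 ≤ A) (v w : R3) :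
    ‖v - w‖^γ * mU p A (‖v‖^2) (‖w‖^2) ≤ 2 * (‖v‖^γ * (min (‖v‖^2) A)^(p-1) * ‖w‖^2 + ‖w‖^γ * (min (‖w‖^2) A)^(p-1) * ‖v‖^2) := by
  have key : ∀ v w : R3, ‖w‖ ≤ ‖v‖ → ‖v - w‖^γ * (‖w‖^2 * (min (‖v‖^2) A)^(p-1)) ≤ 2 * (‖v‖^γ * (min (‖v‖^2) A)^(p-1) * ‖w‖^2) := by
    intro v w h
    have e : ‖v - w‖^γ ≤ 2 * ‖v‖^γ := by
      calc _ ≤ (2 * ‖v‖)^γ := Real.rpow_le_rpow (norm_nonneg _) (by have := norm_sub_le v w; linarith) h0.le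
        _ = 2^γ * ‖v‖^γ := Real.mul_rpow (by norm_num) (norm_nonneg _)
        _ ≤ 2 * ‖v‖^γ := by
          gcongr
          calc (2:ℝ)^γ ≤ 2^(1:ℝ) := Real.rpow_le_rpow_of_exponent_le (by norm_num) h1
            _ = 2 := Real.rpow_one 2
    have : 0 ≤ (min (‖v‖^2) A)^(p-1) := Real.rpow_nonneg (min_nn (by positivity) hA) _
    calc _ ≤ (2 * ‖v‖^γ) * (‖w‖^2 * (min (‖v‖^2) A)^(p-1)) := by gcongr
      _ = _ := by ring
  have z1 : 0 ≤ ‖v‖^γ * (min (‖v‖^2) A)^(p-1) * ‖w‖^2 := by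
    have : 0 ≤ (min (‖v‖^2) A)^(p-1) := Real.rpow_nonneg (min_nn (by positivity) hA) _
    positivity
  have z2 : 0 ≤ ‖w‖^γ * (min (‖w‖^2) A)^(p-1) * ‖v‖^2 := by
    have : 0 ≤ (min (‖w‖^2) A)^(p-1) := Real.rpow_nonneg (min_nn (by positivity) hA) _
    positivity
  unfold mU
  rcases le_total ‖w‖ ‖v‖ with h | h
  · have h2 : ‖w‖^2 ≤ ‖v‖^2 := by gcongr
    rw [min_eq_right h2, max_eq_left h2]
    linarith [key v w h]
  · have h2 : ‖v‖^2 ≤ ‖w‖^2 := by gcongr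
    rw [min_eq_left h2, max_eq_right h2, norm_sub_rev]
    linarith [key w v h]

theorem g_split (γ : ℝ) (h0 : 0 < γ) (h1 : γ ≤ 1) (p A B : ℝ) (hp : 1 < p) (hB : 1 ≤ B) (hA : B < A) (v : R3) :
    ‖v‖^γ * (min (‖v‖^2) A)^(p-1) ≤ B⁻¹ * (‖v‖^γ * (min (‖v‖^2) A)^p) + 2 * B^p := by
  have hA0 : 0 ≤ A := by linarith
  have hm := min_nn (show 0 ≤ ‖v‖^2 by positivity) hA0
  rcases le_total B (min (‖v‖^2) A) with h | h
  · have e := rpow_succ1 p _ hm hp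
    have : (min (‖v‖^2) A)^(p-1) ≤ B⁻¹ * (min (‖v‖^2) A)^p := by
      rw [← e, ← mul_assoc]
      apply le_mul_of_one_le_left (Real.rpow_nonneg hm _)
      rw [inv_mul_eq_div, le_div_iff₀ (by linarith)]; linarith
    have h2 : 0 ≤ 2 * B^p := by positivity
    calc _ ≤ ‖v‖^γ * (B⁻¹ * (min (‖v‖^2) A)^p) := by gcongr
      _ = B⁻¹ * (‖v‖^γ * (min (‖v‖^2) A)^p) := by ring
      _ ≤ _ := by linarith
  · have hv : ‖v‖^2 ≤ B := by
      by_contra hc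
      push Not at hc
      exact absurd (lt_min hc hA) (not_lt.2 h)
    have e1 : ‖v‖^γ ≤ 2 * B := by
      have : ‖v‖^γ ≤ 1 + ‖v‖^2 := by
        rcases le_total ‖v‖ 1 with h | h
        · have := Real.rpow_le_one (norm_nonneg v) h h0.le
          nlinarith [norm_nonneg v]
        · calc ‖v‖^γ ≤ ‖v‖^(1:ℝ) := Real.rpow_le_rpow_of_exponent_le h h1
            _ = ‖v‖ := Real.rpow_one _
            _ ≤ _ := by nlinarith
      linarith
    have e2 : (min (‖v‖^2) A)^(p-1) ≤ B^(p-1) := Real.rpow_le_rpow hm h (by linarith)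
    have e3 : 0 ≤ (min (‖v‖^2) A)^p := Real.rpow_nonneg hm _
    have e4 : 0 ≤ B⁻¹ * (‖v‖^γ * (min (‖v‖^2) A)^p) := by positivity
    have e5 := rpow_succ1 p B (by linarith) hp
    calc _ ≤ (2*B) * B^(p-1) := mul_le_mul e1 e2 (Real.rpow_nonneg hm _) (by positivity)
      _ = 2 * B^p := by rw [← e5]; ring
      _ ≤ _ := by linarith

end Part22

section Part23
open scoped ENNReal

def TT (Φ : R3 → R3 → R3 → R3 → ENNReal) : ENNReal :=
  ∫⁻ v : R3, ∫⁻ w : R3, (∫⁻ σ, Φ v w (vOut v w σ) (vOutStar v w σ) ∂sphMeasure)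

def M4 (Φ : R3 → R3 → R3 → R3 → ENNReal) : Prop := Measurable (fun p : R3 × R3 × R3 × R3 => Φ p.1 p.2.1 p.2.2.1 p.2.2.2)

theorem M4.comp {Φ : R3 → R3 → R3 → R3 → ENNReal} (h : M4 Φ) {α : Type} [MeasurableSpace α] {g1 g2 g3 g4 : α → R3}
    (h1 : Measurable g1) (h2 : Measurable g2) (h3 : Measurable g3) (h4 : Measurable g4) :
    Measurable (fun a => Φ (g1 a) (g2 a) (g3 a) (g4 a)) := 
  Measurable.comp (g := fun p : R3 × R3 × R3 × R3 => Φ p.1 p.2.1 p.2.2.1 p.2.2.2) (f := fun a => (g1 a, g2 a, g3 a, g4 a)) h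
    (h1.prodMk (h2.prodMk (h3.prodMk h4)))

theorem M4.j {Φ : R3 → R3 → R3 → R3 → ENNReal} (h : M4 Φ) : 
    Measurable (fun p : (R3 × R3) × S2 => Φ p.1.1 p.1.2 (vOut p.1.1 p.1.2 p.2) (vOutStar p.1.1 p.1.2 p.2)) := 
  h.comp (by fun_prop) (by fun_prop) (by fun_prop) (by fun_prop)

theorem M4.j2 {Φ : R3 → R3 → R3 → R3 → ENNReal} (h : M4 Φ) : 
    Measurable (fun p : R3 × R3 => ∫⁻ σ, Φ p.1 p.2 (vOut p.1 p.2 σ) (vOutStar p.1 p.2 σ) ∂sphMeasure) := by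
  have := sph_fin
  exact h.j.lintegral_prod_right' (ν := sphMeasure)

theorem TT_mono {Φ Ψ : R3 → R3 → R3 → R3 → ENNReal} (h : ∀ v w σ, Φ v w (vOut v w σ) (vOutStar v w σ) ≤ Ψ v w (vOut v w σ) (vOutStar v w σ)) :
    TT Φ ≤ TT Ψ := lintegral_mono fun v => lintegral_mono fun w => lintegral_mono fun σ => h v w σ

theorem TT_congr {Φ Ψ : R3 → R3 → R3 → R3 → ENNReal} (h : ∀ v w σ, Φ v w (vOut v w σ) (vOutStar v w σ) = Ψ v w (vOut v w σ) (vOutStar v w σ)) :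
    TT Φ = TT Ψ := le_antisymm (TT_mono fun v w σ => (h v w σ).le) (TT_mono fun v w σ => (h v w σ).ge)

theorem TT_add {Φ Ψ : R3 → R3 → R3 → R3 → ENNReal} (h : M4 Φ) : TT (fun v w x y => Φ v w x y + Ψ v w x y) = TT Φ + TT Ψ := by
  have := sph_fin
  unfold TT
  have e : ∀ v w, ∫⁻ σ, (Φ v w (vOut v w σ) (vOutStar v w σ) + Ψ v w (vOut v w σ) (vOutStar v w σ)) ∂sphMeasure =
      (∫⁻ σ, Φ v w (vOut v w σ) (vOutStar v w σ) ∂sphMeasure) + (∫⁻ σ, Ψ v w (vOut v w σ) (vOutStar v w σ) ∂sphMeasure) := by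
    intro v w
    exact lintegral_add_left (h.comp (by fun_prop) (by fun_prop) (by fun_prop) (by fun_prop)) _
  simp_rw [e]
  have e2 : ∀ v, ∫⁻ w, ((∫⁻ σ, Φ v w (vOut v w σ) (vOutStar v w σ) ∂sphMeasure) + (∫⁻ σ, Ψ v w (vOut v w σ) (vOutStar v w σ) ∂sphMeasure)) =
      (∫⁻ w, (∫⁻ σ, Φ v w (vOut v w σ) (vOutStar v w σ) ∂sphMeasure)) + (∫⁻ w, (∫⁻ σ, Ψ v w (vOut v w σ) (vOutStar v w σ) ∂sphMeasure)) := by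
    intro v
    have hm : Measurable (fun w => ∫⁻ σ, Φ v w (vOut v w σ) (vOutStar v w σ) ∂sphMeasure) := h.j2.comp (measurable_const.prodMk measurable_id)
    exact lintegral_add_left hm _
  simp_rw [e2]
  have hm : Measurable (fun v => ∫⁻ w, (∫⁻ σ, Φ v w (vOut v w σ) (vOutStar v w σ) ∂sphMeasure)) := h.j2.lintegral_prod_right'
  exact lintegral_add_left hm _

theorem vOut_comm (v w : R3) (σ : S2) : vOut w v σ = vOut v w σ := by
  unfold vOut; rw [norm_sub_rev, add_comm w v]
theorem vOutStar_comm (v w : R3) (σ : S2) : vOutStar w v σ = vOutStar v w σ := by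
  unfold vOutStar; rw [norm_sub_rev, add_comm w v]

theorem TT_swap {Φ : R3 → R3 → R3 → R3 → ENNReal} (h : M4 Φ) : TT Φ = TT (fun v w x y => Φ w v x y) := by
  unfold TT
  rw [lintegral_lintegral_swap h.j2.aemeasurable]
  refine lintegral_congr fun v => lintegral_congr fun w => lintegral_congr fun σ => ?_
  rw [vOut_comm, vOutStar_comm]

theorem TT_col {Φ : R3 → R3 → R3 → R3 → ENNReal} (h : M4 Φ) : TT Φ = TT (fun v w x y => Φ v w y x) := by
  unfold TT
  refine lintegral_congr fun v => lintegral_congr fun w => ?_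
  exact col_swap v w (fun x y => Φ v w x y) (h.comp measurable_const measurable_const (by fun_prop) (by fun_prop))

theorem TT_pre {Φ : R3 → R3 → R3 → R3 → ENNReal} (h : M4 Φ) : TT Φ = TT (fun v w x y => Φ x y v w) := prepost Φ h

/-- symmetric collision weight -/
def kk (γ : ℝ) (F : R3 → ℝ) (v w x y : R3) : ENNReal :=
  ENNReal.ofReal (‖v - w‖^γ) * ENNReal.ofReal (F v * F w * (1 - F x) * (1 - F y))

theorem kk_m4 (γ : ℝ) (F : R3 → ℝ) (hF : Adm F) (X : R3 → R3 → R3 → R3 → ENNReal) (hX : M4 X) : M4 (fun v w x y => X v w x y * kk γ F v w x y) := by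
  have := hF.m
  unfold M4 kk
  exact Measurable.mul hX (by fun_prop)

theorem loss_TT (γ : ℝ) (F : R3 → ℝ) (hF : Adm F) (X : R3 → ENNReal) :
    ∫⁻ v, X v * (ENNReal.ofReal (F v) * LE' γ F v) = TT (fun v w x y => X v * kk γ F v w x y) := by
  have := hF.m
  unfold TT LE'
  refine lintegral_congr fun v => ?_
  rw [← mul_assoc, ← CC_smul _ (by fun_prop)]
  unfold CC
  refine lintegral_congr fun w => lintegral_congr fun σ => ?_
  unfold kk
  beta_reduce
  rw [show F v * F w * (1 - F (vOut v w σ)) * (1 - F (vOutStar v w σ)) = F v * (F w * (1 - F (vOut v w σ)) * (1 - F (vOutStar v w σ))) by ring,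
    ENNReal.ofReal_mul (hF.n v)]
  ring

theorem gain_TT (γ : ℝ) (F : R3 → ℝ) (hF : Adm F) (X : R3 → ENNReal) (hX : Measurable X) :
    ∫⁻ v, X v * (GE γ F v * ENNReal.ofReal (1 - F v)) = TT (fun v w x y => X x * kk γ F v w x y) := by
  have := hF.m
  have e : ∫⁻ v, X v * (GE γ F v * ENNReal.ofReal (1 - F v)) = TT (fun v w x y => X v * kk γ F x y v w) := by
    unfold TT GE
    refine lintegral_congr fun v => ?_
    rw [mul_comm (CC _ _ _), ← mul_assoc, ← CC_smul _ (by fun_prop)]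
    unfold CC
    refine lintegral_congr fun w => lintegral_congr fun σ => ?_
    unfold kk
    beta_reduce
    rw [show F (vOut v w σ) * F (vOutStar v w σ) * (1 - F v) * (1 - F w) = (1 - F v) * (F (vOut v w σ) * F (vOutStar v w σ) * (1 - F w)) by ring,
      ENNReal.ofReal_mul (show 0 ≤ 1 - F v by linarith [hF.l v]), col_rel]
    ring
  rw [e, TT_pre]
  unfold M4 kk
  fun_prop

theorem pov_sym (γ : ℝ) (F : R3 → ℝ) (hF : Adm F) (X : R3 → ENNReal) (hX : Measurable X) (D U : R3 → R3 → R3 → R3 → ENNReal)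
    (h : ∀ v w σ, X (vOut v w σ) + X (vOutStar v w σ) + D v w (vOut v w σ) (vOutStar v w σ) ≤ X v + X w + U v w (vOut v w σ) (vOutStar v w σ)) :
    2 * (∫⁻ v, X v * (GE γ F v * ENNReal.ofReal (1 - F v))) + TT (fun v w x y => D v w x y * kk γ F v w x y) ≤
    2 * (∫⁻ v, X v * (ENNReal.ofReal (F v) * LE' γ F v)) + TT (fun v w x y => U v w x y * kk γ F v w x y) := by
  have m1 : M4 (fun v w x y => X v * kk γ F v w x y) := kk_m4 γ F hF _ (by unfold M4; fun_prop)
  have m2 : M4 (fun v w x y => X w * kk γ F v w x y) := kk_m4 γ F hF _ (by unfold M4; fun_prop)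
  have m3 : M4 (fun v w x y => X x * kk γ F v w x y) := kk_m4 γ F hF _ (by unfold M4; fun_prop)
  have m4 : M4 (fun v w x y => X y * kk γ F v w x y) := kk_m4 γ F hF _ (by unfold M4; fun_prop)
  have s1 : TT (fun v w x y => X v * kk γ F v w x y) = TT (fun v w x y => X w * kk γ F v w x y) := by
    rw [TT_swap m1]; apply TT_congr; intro v w σ; beta_reduce; unfold kk; rw [norm_sub_rev, mul_comm (F w) (F v)]
  have s2 : TT (fun v w x y => X x * kk γ F v w x y) = TT (fun v w x y => X y * kk γ F v w x y) := by
    rw [TT_col m3]; apply TT_congr; intro v w σ; beta_reduce; unfold kk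
    rw [mul_right_comm (F v * F w)]
  rw [gain_TT γ F hF X hX, loss_TT γ F hF X]
  have t1 : 2 * TT (fun v w x y => X x * kk γ F v w x y) = TT (fun v w x y => X x * kk γ F v w x y + X y * kk γ F v w x y) := by
    rw [TT_add m3, ← s2, two_mul]
  have t2 : 2 * TT (fun v w x y => X v * kk γ F v w x y) = TT (fun v w x y => X v * kk γ F v w x y + X w * kk γ F v w x y) := by
    rw [TT_add m1, ← s1, two_mul]
  rw [t1, t2]
  rw [← TT_add (by unfold M4 at *; exact m3.add m4), ← TT_add (by unfold M4 at *; exact m1.add m2)]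
  apply TT_mono
  intro v w σ
  rw [← add_mul, ← add_mul, ← add_mul, ← add_mul]
  exact mul_le_mul_left (h v w σ) _

end Part23

section Part24
open scoped ENNReal

theorem TT_prod (a b : R3 → ENNReal) (ha : Measurable a) (hb : Measurable b) :
    TT (fun v w _ _ => a v * b w) = (∫⁻ v, a v) * (∫⁻ v, b v) * sphMeasure univ := by
  unfold TT
  simp only [lintegral_const]
  have e : ∀ v, ∫⁻ w, a v * b w * sphMeasure univ = a v * ((∫⁻ w, b w) * sphMeasure univ) := by
    intro v
    rw [lintegral_mul_const _ (by fun_prop), lintegral_const_mul _ hb, mul_assoc]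
  simp_rw [e]
  rw [lintegral_mul_const _ ha, mul_assoc]

def DX (K R1 R0 cd p A : ℝ) (v w x y : R3) : ENNReal :=
  {v : R3 | R0 ≤ ‖v‖}.indicator (fun v => ENNReal.ofReal (cd * (min (‖v‖^2) A)^p)) v *
    ({w : R3 | ‖w‖ ≤ R1}.indicator 1 w * (Band K v).indicator 1 (x, y))

def UX (p A : ℝ) (v w _x _y : R3) : ENNReal := ENNReal.ofReal (p * 2^(p-1) * mU p A (‖v‖^2) (‖w‖^2))

theorem DX_point (K R1 R0 p A : ℝ) (hK : 1 ≤ K) (hR1 : 0 < R1) (hR0 : 2 * R1 + 4 * K * R1 ≤ R0) (hp : 1 < p) (hA : 0 ≤ A)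
    (v w : R3) (σ : S2) :
    ENNReal.ofReal (chi p A (‖vOut v w σ‖^2)) + ENNReal.ofReal (chi p A (‖vOutStar v w σ‖^2)) +
      DX K R1 R0 ((p-1) * (1/(32*K^2))^(p+1)) p A v w (vOut v w σ) (vOutStar v w σ) ≤ 
    ENNReal.ofReal (chi p A (‖v‖^2)) + ENNReal.ofReal (chi p A (‖w‖^2)) + UX p A v w (vOut v w σ) (vOutStar v w σ) := by
  have hE := col_energy v w σ
  have hc : ∀ u : R3, 0 ≤ chi p A (‖u‖^2) := fun u => chi_nn p A hp hA _ (by positivity)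
  have hU : 0 ≤ p * 2^(p-1) * mU p A (‖v‖^2) (‖w‖^2) := by
    have := mU_nn p A (‖v‖^2) (‖w‖^2) hA (by positivity) (by positivity)
    have : 0 < p := by linarith
    positivity
  unfold UX
  rw [← ENNReal.ofReal_add (hc _) (hc _), ← ENNReal.ofReal_add (hc _) (hc _), ← ENNReal.ofReal_add (add_nonneg (hc _) (hc _)) hU]
  unfold DX
  by_cases h : R0 ≤ ‖v‖ ∧ ‖w‖ ≤ R1 ∧ (vOut v w σ, vOutStar v w σ) ∈ Band K v
  · obtain ⟨h1, h2, h3⟩ := h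
    rw [indicator_of_mem (show v ∈ {v : R3 | R0 ≤ ‖v‖} from h1), indicator_of_mem (show w ∈ {w : R3 | ‖w‖ ≤ R1} from h2),
      indicator_of_mem h3]
    simp only [Pi.one_apply, mul_one]
    have hm : 0 ≤ (p-1) * (1/(32*K^2))^(p+1) * (min (‖v‖^2) A)^p := by
      have : 0 ≤ p - 1 := by linarith
      have := min_nn (show 0 ≤ ‖v‖^2 by positivity) hA
      positivity
    rw [← ENNReal.ofReal_add (add_nonneg (hc _) (hc _)) hm]
    apply ENNReal.ofReal_le_ofReal
    have g1 := band_geom K R1 hK v w σ h2 (by linarith) h3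
    have hx : vOut v w (-σ) = vOutStar v w σ := by unfold vOut vOutStar; simp [sub_eq_add_neg]
    have hy : vOutStar v w (-σ) = vOut v w σ := by unfold vOut vOutStar; simp [sub_eq_add_neg]
    have g2 := band_geom K R1 hK v w (-σ) h2 (by linarith) (by rw [hx, hy]; exact ⟨h3.2, h3.1⟩)
    rw [hx] at g2
    have hKp : 0 < K := by linarith
    have hwv : ‖w‖ ≤ ‖v‖ := by nlinarith
    have hw2 : ‖w‖^2 ≤ ‖v‖^2 := by gcongr
    have hd : 1/(32*K^2) * (‖v‖^2 + ‖w‖^2) ≤ (‖v‖/(4*K))^2 := by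
      rw [show (‖v‖/(4*K))^2 = 1/(32*K^2) * (‖v‖^2 + ‖v‖^2) by field_simp; ring]
      gcongr
    have := povz_chi p A (1/(32*K^2)) hp hA (by positivity) (‖v‖^2) (‖w‖^2) (‖vOut v w σ‖^2) (‖vOutStar v w σ‖^2) (by positivity) (by positivity) hw2
      (by positivity) (by positivity) hE (hd.trans (by gcongr)) (hd.trans (by gcongr))
    rw [show mU p A (‖v‖^2) (‖w‖^2) = ‖w‖^2 * (min (‖v‖^2) A)^(p-1) by unfold mU; rw [min_eq_right hw2, max_eq_left hw2]]
    exact this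
  · have e : {v : R3 | R0 ≤ ‖v‖}.indicator (fun v => ENNReal.ofReal ((p-1) * (1/(32*K^2))^(p+1) * (min (‖v‖^2) A)^p)) v *
    ({w : R3 | ‖w‖ ≤ R1}.indicator 1 w * (Band K v).indicator 1 (vOut v w σ, vOutStar v w σ)) = 0 := by
      by_contra hne
      apply h
      refine ⟨?_, ?_, ?_⟩
      · by_contra h'
        exact hne (by rw [indicator_of_notMem (show v ∉ {v : R3 | R0 ≤ ‖v‖} from h'), zero_mul])
      · by_contra h'
        exact hne (by rw [indicator_of_notMem (show w ∉ {w : R3 | ‖w‖ ≤ R1} from h'), zero_mul, mul_zero])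
      · by_contra h'
        exact hne (by rw [indicator_of_notMem h', mul_zero, mul_zero])
    rw [e, add_zero]
    exact ENNReal.ofReal_le_ofReal (povz_chi0 p A hp hA _ _ _ _ (by positivity) (by positivity) (by positivity) (by positivity) hE)

theorem DX_low (γ : ℝ) (F : R3 → ℝ) (hF : Adm F) (K R1 R0 c cd p A : ℝ) (hcd : 0 ≤ cd) (hc : 0 ≤ c) (hA : 0 ≤ A)
    (h : ∀ v : R3, R0 ≤ ‖v‖ → ENNReal.ofReal (c * ‖v‖^γ) ≤ CC γ v (fun w σ => BX K R1 v w σ * ENNReal.ofReal (F w * (1 - F (vOut v w σ)) * (1 - F (vOutStar v w σ))))) :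
    (∫⁻ v, {v : R3 | R0 ≤ ‖v‖}.indicator (fun v => ENNReal.ofReal (cd * c * (F v * (‖v‖^γ * (min (‖v‖^2) A)^p)))) v) ≤
      TT (fun v w x y => DX K R1 R0 cd p A v w x y * kk γ F v w x y) := by
  unfold TT
  refine lintegral_mono fun v => ?_
  beta_reduce
  by_cases hv : R0 ≤ ‖v‖
  swap
  · rw [indicator_of_notMem (show v ∉ {v : R3 | R0 ≤ ‖v‖} from hv)]; exact bot_le
  rw [indicator_of_mem (show v ∈ {v : R3 | R0 ≤ ‖v‖} from hv)]
  have hm := min_nn (show 0 ≤ ‖v‖^2 by positivity) hA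
  have hn := hF.n v
  calc _ = ENNReal.ofReal (cd * (min (‖v‖^2) A)^p * F v) * ENNReal.ofReal (c * ‖v‖^γ) := by
        rw [← ENNReal.ofReal_mul (by positivity)]; congr 1; ring
    _ ≤ ENNReal.ofReal (cd * (min (‖v‖^2) A)^p * F v) * _ := mul_le_mul_right (h v hv) _
    _ ≤ _ := by
      unfold CC
      refine (lintegral_const_mul_le _ _).trans (lintegral_mono fun w => (lintegral_const_mul_le _ _).trans (lintegral_mono fun σ => ?_))
      unfold DX BX kk
      rw [indicator_of_mem (show v ∈ {v : R3 | R0 ≤ ‖v‖} from hv)]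
      rw [show F v * F w * (1 - F (vOut v w σ)) * (1 - F (vOutStar v w σ)) = F v * (F w * (1 - F (vOut v w σ)) * (1 - F (vOutStar v w σ))) by ring,
        ENNReal.ofReal_mul hn, ENNReal.ofReal_mul (show 0 ≤ cd * (min (‖v‖^2) A)^p by positivity)]
      apply le_of_eq
      ring

end Part24

section Part25
open scoped ENNReal

theorem UX_up (γ : ℝ) (h0 : 0 < γ) (h1 : γ ≤ 1) (F : R3 → ℝ) (hF : Adm F) (p A E : ℝ) (hp : 1 < p) (hA : 0 ≤ A)
    (hE : ∫⁻ v, ENNReal.ofReal (F v * ‖v‖^2) ≤ ENNReal.ofReal E) :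
    TT (fun v w x y => UX p A v w x y * kk γ F v w x y) ≤
      ENNReal.ofReal (4 * (p * 2^(p-1))) * ((∫⁻ v, ENNReal.ofReal (F v * (‖v‖^γ * (min (‖v‖^2) A)^(p-1)))) * ENNReal.ofReal E * sphMeasure univ) := by
  have hFm := hF.m
  have hp0 : 0 < p := by linarith
  obtain ⟨a, ha⟩ : ∃ a : R3 → ENNReal, a = fun v => ENNReal.ofReal (2 * (p * 2^(p-1))) * ENNReal.ofReal (F v * (‖v‖^γ * (min (‖v‖^2) A)^(p-1))) := ⟨_, rfl⟩
  obtain ⟨b, hb⟩ : ∃ b : R3 → ENNReal, b = fun v => ENNReal.ofReal (F v * ‖v‖^2) := ⟨_, rfl⟩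
  have ma : Measurable a := by rw [ha]; fun_prop
  have mb : Measurable b := by rw [hb]; fun_prop
  have e1 : TT (fun v w x y => UX p A v w x y * kk γ F v w x y) ≤ TT (fun v w _ _ => a v * b w + b v * a w) := by
    apply TT_mono
    intro v w σ
    rw [ha, hb]
    unfold UX kk
    beta_reduce
    have n1 := hF.n v; have n2 := hF.n w
    have hm1 := min_nn (show 0 ≤ ‖v‖^2 by positivity) hA
    have hm2 := min_nn (show 0 ≤ ‖w‖^2 by positivity) hA
    have hmU := mU_nn p A (‖v‖^2) (‖w‖^2) hA (by positivity) (by positivity)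
    rw [mul_comm (ENNReal.ofReal (F v * ‖v‖^2))]
    rw [← ENNReal.ofReal_mul (by positivity), ← ENNReal.ofReal_mul (by positivity), ← ENNReal.ofReal_mul (by positivity),
      ← ENNReal.ofReal_mul (by positivity), ← ENNReal.ofReal_mul (by positivity), ← ENNReal.ofReal_mul (by positivity),
      ← ENNReal.ofReal_add (by positivity) (by positivity)]
    apply ENNReal.ofReal_le_ofReal
    have k := mU_le γ h0 h1 p A hA v w
    have q : F v * F w * (1 - F (vOut v w σ)) * (1 - F (vOutStar v w σ)) ≤ F v * F w := by
      have a1 := hF.n (vOut v w σ); have a2 := hF.n (vOutStar v w σ)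
      have a3 := hF.l (vOut v w σ); have a4 := hF.l (vOutStar v w σ)
      have : (1 - F (vOut v w σ)) * (1 - F (vOutStar v w σ)) ≤ 1 := by nlinarith
      have hh : 0 ≤ F v * F w := by positivity
      nlinarith
    have k2 : ‖v-w‖^γ * mU p A (‖v‖^2) (‖w‖^2) * (F v * F w * (1 - F (vOut v w σ)) * (1 - F (vOutStar v w σ))) ≤ _ :=
      (mul_le_mul_of_nonneg_left q (by positivity)).trans (mul_le_mul_of_nonneg_right k (by positivity))
    have k3 := mul_le_mul_of_nonneg_left k2 (show 0 ≤ p * 2^(p-1) by positivity)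
    nlinarith
  refine e1.trans ?_
  rw [TT_add (by unfold M4; fun_prop), TT_prod a b ma mb, TT_prod b a mb ma, mul_comm (∫⁻ v, b v), ← two_mul]
  have e2 : ∫⁻ v, a v = ENNReal.ofReal (2 * (p * 2^(p-1))) * ∫⁻ v, ENNReal.ofReal (F v * (‖v‖^γ * (min (‖v‖^2) A)^(p-1))) := by
    rw [ha]; exact lintegral_const_mul' _ _ ENNReal.ofReal_ne_top
  have e3 : ENNReal.ofReal (4 * (p * 2^(p-1))) = 2 * ENNReal.ofReal (2 * (p * 2^(p-1))) := by
    rw [two_ofReal]; congr 1; ring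
  rw [e2, e3]
  have : ∫⁻ v, b v ≤ ENNReal.ofReal E := by rw [hb]; exact hE
  calc _ ≤ 2 * (ENNReal.ofReal (2 * (p * 2^(p-1))) * (∫⁻ v, ENNReal.ofReal (F v * (‖v‖^γ * (min (‖v‖^2) A)^(p-1)))) * ENNReal.ofReal E * sphMeasure univ) := by gcongr
    _ = _ := by ring

theorem static3 (γ : ℝ) (h0 : 0 < γ) (h1 : γ ≤ 1) (M E : ℝ) (hM : 0 < M) (hE : 0 ≤ E) (p : ℝ) (hp : 1 < p) :
    ∃ c C B : ℝ, 0 < c ∧ 0 ≤ C ∧ 1 ≤ B ∧ ∀ A, B < A → ∀ F : R3 → ℝ, Adm F →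
      ∫⁻ v, ENNReal.ofReal (F v) = ENNReal.ofReal M → ∫⁻ v, ENNReal.ofReal (F v * ‖v‖^2) ≤ ENNReal.ofReal E →
      (∫⁻ v, ENNReal.ofReal (chi p A (‖v‖^2)) * (GE γ F v * ENNReal.ofReal (1 - F v))) + 
        ENNReal.ofReal c * (∫⁻ v, ENNReal.ofReal (F v * (min (‖v‖^2) A)^p)) ≤
      (∫⁻ v, ENNReal.ofReal (chi p A (‖v‖^2)) * (ENNReal.ofReal (F v) * LE' γ F v)) + ENNReal.ofReal C := by
  have := sph_fin
  obtain ⟨K, R1, R0, c0, hK, hR1, hR0, hR01, hc0, hlow⟩ := lower_bound γ h0.le h1 M E hM hE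
  have hp0 : 0 < p := by linarith
  have hp1 : 0 < p - 1 := by linarith
  obtain ⟨cd, hcd⟩ : ∃ cd, cd = (p-1) * (1/(32*K^2))^(p+1) := ⟨_, rfl⟩
  have hcd0 : 0 < cd := by rw [hcd]; have : 0 < K := by linarith
                           positivity
  obtain ⟨S, hS⟩ : ∃ S, S = (sphMeasure univ).toReal := ⟨_, rfl⟩
  have hS0 : 0 ≤ S := by rw [hS]; positivity
  have hSe : sphMeasure univ = ENNReal.ofReal S := by rw [hS, ENNReal.ofReal_toReal (measure_ne_top _ _)]
  obtain ⟨κ, hκ⟩ : ∃ κ, κ = 4 * (p * 2^(p-1)) * E * S := ⟨_, rfl⟩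
  have hκ0 : 0 ≤ κ := by rw [hκ]; positivity
  obtain ⟨c2, hc2⟩ : ∃ c2, c2 = cd * c0 := ⟨_, rfl⟩
  have hc20 : 0 < c2 := by rw [hc2]; positivity
  obtain ⟨B, hB⟩ : ∃ B, B = 1 + 2 * κ / c2 := ⟨_, rfl⟩
  have hB1 : 1 ≤ B := by rw [hB]; have : 0 ≤ 2 * κ / c2 := by positivity
                         linarith
  have hκB : κ * B⁻¹ ≤ c2 / 2 := by
    rw [← div_eq_mul_inv, div_le_iff₀ (by linarith), hB]
    field_simp
    linarith
  have hR0p : 0 < R0 := by linarith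
  obtain ⟨C1, hC1⟩ : ∃ C1, C1 = c2 * (R0^γ * (R0^2)^p) * M := ⟨_, rfl⟩
  obtain ⟨C2, hC2⟩ : ∃ C2, C2 = κ * (2 * B^p * M) := ⟨_, rfl⟩
  have hC10 : 0 ≤ C1 := by rw [hC1]; positivity
  have hC20 : 0 ≤ C2 := by rw [hC2]; positivity
  refine ⟨c2/4, (C1 + C2)/2 + c2/4 * M, B, by positivity, by positivity, hB1, ?_⟩
  intro A hA F hF hFM hFE
  have hFm := hF.m
  have hA0 : 0 ≤ A := by linarith
  have hmn : ∀ v : R3, 0 ≤ min (‖v‖^2) A := fun v => min_nn (by positivity) hA0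
  have hpov := pov_sym γ F hF (fun v => ENNReal.ofReal (chi p A (‖v‖^2))) (by unfold chi psi; fun_prop) (DX K R1 R0 cd p A) (UX p A)
    (by rw [hcd]; exact DX_point K R1 R0 p A hK hR1 hR0 hp hA0)
  have hD := DX_low γ F hF K R1 R0 c0 cd p A hcd0.le hc0.le hA0 (hlow F hF hFM hFE)
  have hU := UX_up γ h0 h1 F hF p A E hp hA0 hFE
  rw [← hc2] at hD
  obtain ⟨G, hG⟩ : ∃ G, G = ∫⁻ v, ENNReal.ofReal (F v * (‖v‖^γ * (min (‖v‖^2) A)^p)) := ⟨_, rfl⟩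
  beta_reduce at hpov
  obtain ⟨Ga, hGa⟩ : ∃ Ga, Ga = ∫⁻ v, ENNReal.ofReal (chi p A (‖v‖^2)) * (GE γ F v * ENNReal.ofReal (1 - F v)) := ⟨_, rfl⟩
  obtain ⟨Lo, hLo⟩ : ∃ Lo, Lo = ∫⁻ v, ENNReal.ofReal (chi p A (‖v‖^2)) * (ENNReal.ofReal (F v) * LE' γ F v) := ⟨_, rfl⟩
  rw [← hGa, ← hLo] at hpov
  rw [← hGa, ← hLo]
  -- lower bound
  have s1 : ENNReal.ofReal c2 * G ≤ TT (fun v w x y => DX K R1 R0 cd p A v w x y * kk γ F v w x y) + ENNReal.ofReal C1 := by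
    have e1 : ENNReal.ofReal C1 = ∫⁻ v, ENNReal.ofReal (c2 * (R0^γ * (R0^2)^p)) * ENNReal.ofReal (F v) := by
      rw [lintegral_const_mul' _ _ ENNReal.ofReal_ne_top, hFM, ← ENNReal.ofReal_mul (by positivity), hC1]
    rw [hG, ← lintegral_const_mul' _ _ ENNReal.ofReal_ne_top, e1]
    refine le_trans ?_ (add_le_add_left hD _)
    rw [← lintegral_add_right _ (by fun_prop)]
    refine lintegral_mono fun v => ?_
    beta_reduce
    have n := hF.n v
    have m := hmn v
    by_cases hv : R0 ≤ ‖v‖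
    · rw [indicator_of_mem (show v ∈ {v : R3 | R0 ≤ ‖v‖} from hv), ← ENNReal.ofReal_mul hc20.le]
      exact le_self_add
    · rw [indicator_of_notMem (show v ∉ {v : R3 | R0 ≤ ‖v‖} from hv), zero_add, ← ENNReal.ofReal_mul hc20.le, ← ENNReal.ofReal_mul (by positivity)]
      apply ENNReal.ofReal_le_ofReal
      have hv' : ‖v‖ ≤ R0 := by linarith
      have : (min (‖v‖^2) A) ≤ R0^2 := (min_le_left _ _).trans (by gcongr)
      have : ‖v‖^γ * (min (‖v‖^2) A)^p ≤ R0^γ * (R0^2)^p := by gcongr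
      calc _ ≤ c2 * (F v * (R0^γ * (R0^2)^p)) := by gcongr
        _ = _ := by ring
  have s2 : TT (fun v w x y => UX p A v w x y * kk γ F v w x y) ≤ ENNReal.ofReal (c2/2) * G + ENNReal.ofReal C2 := by
    have e1 : (∫⁻ v, ENNReal.ofReal (F v * (‖v‖^γ * (min (‖v‖^2) A)^(p-1)))) ≤ ENNReal.ofReal B⁻¹ * G + ENNReal.ofReal (2 * B^p * M) := by
      have e2 : ENNReal.ofReal (2 * B^p * M) = ∫⁻ v, ENNReal.ofReal (2 * B^p) * ENNReal.ofReal (F v) := by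
        rw [lintegral_const_mul' _ _ ENNReal.ofReal_ne_top, hFM, ← ENNReal.ofReal_mul (by positivity)]
      rw [hG, ← lintegral_const_mul' _ _ ENNReal.ofReal_ne_top, e2, ← lintegral_add_right _ (by fun_prop)]
      refine lintegral_mono fun v => ?_
      beta_reduce
      have n := hF.n v
      have m := hmn v
      rw [← ENNReal.ofReal_mul (by positivity), ← ENNReal.ofReal_mul (by positivity), ← ENNReal.ofReal_add (by positivity) (by positivity)]
      apply ENNReal.ofReal_le_ofReal
      have := mul_le_mul_of_nonneg_left (g_split γ h0 h1 p A B hp hB1 hA v) n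
      linarith
    refine hU.trans ?_
    rw [hSe]
    calc _ ≤ ENNReal.ofReal (4 * (p * 2^(p-1))) * ((ENNReal.ofReal B⁻¹ * G + ENNReal.ofReal (2 * B^p * M)) * ENNReal.ofReal E * ENNReal.ofReal S) := by gcongr
      _ = ENNReal.ofReal κ * ENNReal.ofReal B⁻¹ * G + ENNReal.ofReal κ * ENNReal.ofReal (2 * B^p * M) := by
        rw [hκ, ENNReal.ofReal_mul (show 0 ≤ 4 * (p * 2^(p-1)) * E by positivity), ENNReal.ofReal_mul (show 0 ≤ 4 * (p * 2^(p-1)) by positivity)]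
        ring
      _ ≤ _ := by
        rw [← ENNReal.ofReal_mul hκ0, ← ENNReal.ofReal_mul hκ0, hC2]
        gcongr
  have hGf : G ≠ ⊤ := by
    apply ne_top_of_le_ne_top (b := ENNReal.ofReal (A^p) * (ENNReal.ofReal M + ENNReal.ofReal E)) (by finiteness)
    calc G ≤ ENNReal.ofReal (A^p) * ((∫⁻ v, ENNReal.ofReal (F v)) + ∫⁻ v, ENNReal.ofReal (F v * ‖v‖^2)) := by
          rw [hG, ← lintegral_add_right _ (by fun_prop), ← lintegral_const_mul' _ _ ENNReal.ofReal_ne_top]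
          refine lintegral_mono fun v => ?_
          beta_reduce
          have n := hF.n v
          have m := hmn v
          rw [← ENNReal.ofReal_add n (by positivity), ← ENNReal.ofReal_mul (by positivity)]
          apply ENNReal.ofReal_le_ofReal
          have q1 : ‖v‖^γ ≤ 1 + ‖v‖^2 := by
            rcases le_total ‖v‖ 1 with h | h
            · have := Real.rpow_le_one (norm_nonneg v) h h0.le
              nlinarith [norm_nonneg v]
            · have : ‖v‖^γ ≤ ‖v‖^(1:ℝ) := Real.rpow_le_rpow_of_exponent_le h h1
              rw [Real.rpow_one] at this
              nlinarith
          have q2 : (min (‖v‖^2) A)^p ≤ A^p := Real.rpow_le_rpow m (min_le_right _ _) hp0.le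
          calc _ ≤ F v * ((1 + ‖v‖^2) * A^p) := by gcongr
            _ = _ := by ring
      _ ≤ _ := by rw [hFM]; gcongr
  have s3 : (∫⁻ v, ENNReal.ofReal (F v * (min (‖v‖^2) A)^p)) ≤ G + ENNReal.ofReal M := by
    rw [hG, ← hFM, ← lintegral_add_right _ (by fun_prop)]
    refine lintegral_mono fun v => ?_
    beta_reduce
    have n := hF.n v
    have m := hmn v
    rw [← ENNReal.ofReal_add (by positivity) n]
    apply ENNReal.ofReal_le_ofReal
    have : (min (‖v‖^2) A)^p ≤ ‖v‖^γ * (min (‖v‖^2) A)^p + 1 := by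
      rcases le_total ‖v‖ 1 with h | h
      · have q : (min (‖v‖^2) A)^p ≤ 1 := Real.rpow_le_one m ((min_le_left _ _).trans (by nlinarith [norm_nonneg v])) hp0.le
        have : 0 ≤ ‖v‖^γ * (min (‖v‖^2) A)^p := by positivity
        linarith
      · have : 1 ≤ ‖v‖^γ := Real.one_le_rpow h h0.le
        have q : 0 ≤ (min (‖v‖^2) A)^p := by positivity
        nlinarith
    calc _ ≤ F v * (‖v‖^γ * (min (‖v‖^2) A)^p + 1) := by gcongr
      _ = _ := by ring
  -- combine
  have t1 : (2 * Ga + ENNReal.ofReal (c2/2) * G) + ENNReal.ofReal (c2/2) * G ≤ (2 * Lo + ENNReal.ofReal (C1 + C2)) + ENNReal.ofReal (c2/2) * G := by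
    calc _ = 2 * Ga + ENNReal.ofReal c2 * G := by
          rw [add_assoc, ← add_mul, ← ENNReal.ofReal_add (by positivity) (by positivity), add_halves]
      _ ≤ 2 * Ga + (TT (fun v w x y => DX K R1 R0 cd p A v w x y * kk γ F v w x y) + ENNReal.ofReal C1) := by gcongr
      _ ≤ (2 * Lo + TT (fun v w x y => UX p A v w x y * kk γ F v w x y)) + ENNReal.ofReal C1 := by
          rw [← add_assoc]; exact add_le_add_left hpov _
      _ ≤ (2 * Lo + (ENNReal.ofReal (c2/2) * G + ENNReal.ofReal C2)) + ENNReal.ofReal C1 := by gcongr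
      _ = _ := by rw [ENNReal.ofReal_add hC10 hC20]; ring
  have t2 := (ENNReal.add_le_add_iff_right (by finiteness)).1 t1
  have t3 : Ga + ENNReal.ofReal (c2/4) * G ≤ Lo + ENNReal.ofReal ((C1 + C2)/2) := by
    have : 2 * (Ga + ENNReal.ofReal (c2/4) * G) ≤ 2 * (Lo + ENNReal.ofReal ((C1 + C2)/2)) := by
      rw [mul_add, mul_add, ← mul_assoc, two_ofReal, two_ofReal, show 2 * (c2/4) = c2/2 by ring, show 2 * ((C1+C2)/2) = C1 + C2 by ring]
      exact t2
    exact (ENNReal.mul_le_mul_iff_right (by norm_num) (by norm_num)).1 this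
  calc _ ≤ Ga + ENNReal.ofReal (c2/4) * (G + ENNReal.ofReal M) := by gcongr
    _ = (Ga + ENNReal.ofReal (c2/4) * G) + ENNReal.ofReal (c2/4 * M) := by
      rw [ENNReal.ofReal_mul (by positivity)]; ring
    _ ≤ (Lo + ENNReal.ofReal ((C1 + C2)/2)) + ENNReal.ofReal (c2/4 * M) := add_le_add_left t3 _
    _ = _ := by rw [ENNReal.ofReal_add (by positivity) (by positivity), add_assoc]

end Part25

section Part26
open scoped ENNReal

section Dyn
variable {γ β : ℝ} {f0 : R3 → ℝ} {f : ℝ → R3 → ℝ} {N : ENNReal} {M E : ℝ}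

theorem Sol.weak_int {M E : ENNReal} (hf : Sol γ β f0 f N M E) (h0 : 0 ≤ γ) (h1 : γ ≤ 1) (hβ : 0 < β) (X : R3 → ENNReal) (hX : Measurable X)
    (t0 t : ℝ) (ht0 : 0 ≤ t0) (htt : t0 ≤ t) :
    (∫⁻ v, X v * ENNReal.ofReal (f t v)) + ENNReal.ofReal β * (∫⁻ τ in Ioc t0 t, ∫⁻ v, X v * (ENNReal.ofReal (f τ v) * LE' γ (f τ) v)) =
    (∫⁻ v, X v * ENNReal.ofReal (f t0 v)) + ENNReal.ofReal β * (∫⁻ τ in Ioc t0 t, ∫⁻ v, X v * (GE γ (f τ) v * ENNReal.ofReal (1 - f τ v))) := by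
  have jm := hf.jm
  have jG := hf.jG
  have jL := hf.jL
  have m1 : Measurable (fun p : ℝ × R3 => X p.2 * (ENNReal.ofReal (f p.1 p.2) * LE' γ (f p.1) p.2)) := by fun_prop
  have m2 : Measurable (fun p : ℝ × R3 => X p.2 * (GE γ (f p.1) p.2 * ENNReal.ofReal (1 - f p.1 p.2))) := by fun_prop
  obtain ⟨a1, a2, a3⟩ := jcomp (fun τ v => X v * (ENNReal.ofReal (f τ v) * LE' γ (f τ) v)) m1
  obtain ⟨b1, b2, b3⟩ := jcomp (fun τ v => X v * (GE γ (f τ) v * ENNReal.ofReal (1 - f τ v))) m2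
  have k1 : Measurable (fun v => ∫⁻ τ in Ioc t0 t, X v * (ENNReal.ofReal (f τ v) * LE' γ (f τ) v)) := 
    a3.lintegral_prod_right' (ν := volume.restrict (Ioc t0 t))
  have k2 : Measurable (fun v => ∫⁻ τ in Ioc t0 t, X v * (GE γ (f τ) v * ENNReal.ofReal (1 - f τ v))) := 
    b3.lintegral_prod_right' (ν := volume.restrict (Ioc t0 t))
  have sw1 := lintegral_lintegral_swap (μ := volume.restrict (Ioc t0 t)) (ν := volume) (f := fun τ v => X v * (ENNReal.ofReal (f τ v) * LE' γ (f τ) v)) m1.aemeasurable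
  have sw2 := lintegral_lintegral_swap (μ := volume.restrict (Ioc t0 t)) (ν := volume) (f := fun τ v => X v * (GE γ (f τ) v * ENNReal.ofReal (1 - f τ v))) m2.aemeasurable
  rw [sw1, sw2, ← lintegral_const_mul _ k1, ← lintegral_const_mul _ k2]
  rw [← lintegral_add_right _ (k1.const_mul _), ← lintegral_add_right _ (k2.const_mul _)]
  have c1 : ∀ v, Measurable (fun τ => ENNReal.ofReal (f τ v) * LE' γ (f τ) v) := 
    (jcomp (fun τ v => (ENNReal.ofReal (f τ v) * LE' γ (f τ) v)) (by fun_prop)).1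
  have c2 : ∀ v, Measurable (fun τ => GE γ (f τ) v * ENNReal.ofReal (1 - f τ v)) := 
    (jcomp (fun τ v => (GE γ (f τ) v * ENNReal.ofReal (1 - f τ v))) (by fun_prop)).1
  apply lintegral_congr_ae
  filter_upwards [hf.weak h0 h1 hβ] with v hv
  have h := hv t0 t ht0 htt
  rw [lintegral_const_mul _ (c1 v), lintegral_const_mul _ (c2 v)]
  have e1 : ∫⁻ τ in Ioc t0 t, ENNReal.ofReal (f τ v) * (ENNReal.ofReal β * LE' γ (f τ) v) = ENNReal.ofReal β * ∫⁻ τ in Ioc t0 t, ENNReal.ofReal (f τ v) * LE' γ (f τ) v := by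
    rw [← lintegral_const_mul _ (c1 v)]
    exact lintegral_congr fun τ => by ring
  have e2 : ∫⁻ τ in Ioc t0 t, ENNReal.ofReal β * GE γ (f τ) v * ENNReal.ofReal (1 - f τ v) = ENNReal.ofReal β * ∫⁻ τ in Ioc t0 t, GE γ (f τ) v * ENNReal.ofReal (1 - f τ v) := by
    rw [← lintegral_const_mul _ (c2 v)]
    exact lintegral_congr fun τ => by ring
  rw [e1, e2] at h
  have h' := congrArg (X v * ·) h
  simp only [mul_add] at h'
  rw [mul_left_comm (ENNReal.ofReal β), mul_left_comm (ENNReal.ofReal β)]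
  exact h'

theorem Sol.loss_fin {M E : ENNReal} (hf : Sol γ β f0 f N M E) (h0 : 0 ≤ γ) (h1 : γ ≤ 1) (X : R3 → ENNReal) (a : ℝ) (hX : ∀ v, X v ≤ ENNReal.ofReal a)
    (t0 t : ℝ) (ht0 : 0 ≤ t0) :
    (∫⁻ τ in Ioc t0 t, ∫⁻ v, X v * (ENNReal.ofReal (f τ v) * LE' γ (f τ) v)) ≠ ⊤ := by
  have := sph_fin
  have hb : ∀ τ, 0 ≤ τ → (∫⁻ v, X v * (ENNReal.ofReal (f τ v) * LE' γ (f τ) v)) ≤ ENNReal.ofReal a * (sphMeasure univ * N) * ENNReal.ofReal 4 * N := by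
    intro τ hτ
    have hA := hf.reg.adm τ hτ
    calc _ ≤ ∫⁻ v, ENNReal.ofReal a * (sphMeasure univ * N) * ENNReal.ofReal 4 * ENNReal.ofReal (|f τ v| * (1 + ‖v‖^2)) := by
          refine lintegral_mono fun v => ?_
          beta_reduce
          have n := hA.n v
          calc _ ≤ ENNReal.ofReal a * (ENNReal.ofReal (f τ v) * (ENNReal.ofReal (2 * (1 + ‖v‖)) * (sphMeasure univ * N))) := by
                gcongr
                · exact hX v
                · exact (hA.LE_top γ h0 h1 v).trans (by gcongr; exact hf.reg.nn τ hτ)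
            _ = ENNReal.ofReal a * (sphMeasure univ * N) * (ENNReal.ofReal (f τ v * (2 * (1 + ‖v‖)))) := by
                rw [ENNReal.ofReal_mul n]; ring
            _ ≤ ENNReal.ofReal a * (sphMeasure univ * N) * ENNReal.ofReal (4 * (|f τ v| * (1 + ‖v‖^2))) := by
                gcongr _ * ?_
                apply ENNReal.ofReal_le_ofReal
                rw [hA.abs v]
                have : 2 * (1 + ‖v‖) ≤ 4 * (1 + ‖v‖^2) := by nlinarith [sq_nonneg (‖v‖ - 1)]
                nlinarith
            _ = _ := by rw [ENNReal.ofReal_mul (by norm_num)]; ring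
      _ = ENNReal.ofReal a * (sphMeasure univ * N) * ENNReal.ofReal 4 * NN (f τ) := by
          have := hf.reg.top
          rw [lintegral_const_mul' _ _ (by finiteness)]; rfl
      _ ≤ _ := by gcongr; exact hf.reg.nn τ hτ
  have hN := hf.reg.top
  apply ne_top_of_le_ne_top (b := ∫⁻ τ in Ioc t0 t, ENNReal.ofReal a * (sphMeasure univ * N) * ENNReal.ofReal 4 * N)
  · rw [setLIntegral_const]
    have : volume (Ioc t0 t) ≠ ⊤ := by simp
    finiteness
  · exact setLIntegral_mono measurable_const fun τ hτ => hb τ (ht0.trans hτ.1.le)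

theorem chi_psi_int (p A : ℝ) (hp : 1 < p) (hA : 0 ≤ A) (F : R3 → ℝ) (hF : Adm F) (hE : 0 ≤ E) (hM : 0 ≤ M)
    (hFM : ∫⁻ v, ENNReal.ofReal (F v) = ENNReal.ofReal M) (hFE : ∫⁻ v, ENNReal.ofReal (F v * ‖v‖^2) = ENNReal.ofReal E) :
    (∫⁻ v, ENNReal.ofReal (chi p A (‖v‖^2)) * ENNReal.ofReal (F v)) + ENNReal.ofReal (p * A^(p-1) * E) =
    (∫⁻ v, ENNReal.ofReal (psi p A (‖v‖^2) * F v)) + ENNReal.ofReal ((p-1) * A^p * M) := by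
  have hm := hF.m
  have hp0 : 0 < p := by linarith
  have hp1 : 0 < p - 1 := by linarith
  rw [ENNReal.ofReal_mul (by positivity), ENNReal.ofReal_mul (show 0 ≤ (p-1) * A^p by positivity), ← hFM, ← hFE, ← lintegral_const_mul' _ _ ENNReal.ofReal_ne_top,
    ← lintegral_const_mul' _ _ ENNReal.ofReal_ne_top, ← lintegral_add_right _ (by fun_prop), ← lintegral_add_right _ (by fun_prop)]
  refine lintegral_congr fun v => ?_
  have n := hF.n v
  have c := chi_nn p A hp hA (‖v‖^2) (by positivity)
  have ps : 0 ≤ psi p A (‖v‖^2) := (Real.rpow_nonneg (min_nn (by positivity) hA) p).trans (pow_le_psi p A hp hA _ (by positivity))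
  rw [← ENNReal.ofReal_mul c, ← ENNReal.ofReal_mul (by positivity), ← ENNReal.ofReal_mul (by positivity), ← ENNReal.ofReal_add (by positivity) (by positivity),
     ← ENNReal.ofReal_add (by positivity) (by positivity)]
  congr 1
  unfold chi
  ring

/-- truncated moment inequality -/
theorem Sol.momA (hf : Sol γ β f0 f N (ENNReal.ofReal M) (ENNReal.ofReal E)) (h0 : 0 < γ) (h1 : γ ≤ 1) (hβ : 0 < β) (hM : 0 < M) (hE : 0 ≤ E) (p : ℝ) (hp : 1 < p) :
    ∃ c C B : ℝ, 0 < c ∧ 0 ≤ C ∧ 1 ≤ B ∧ ∀ A, B < A → ∀ t0 t, 0 ≤ t0 → t0 ≤ t →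
      (∫⁻ v, ENNReal.ofReal (f t v * (min (‖v‖^2) A)^p)) + ENNReal.ofReal c * (∫⁻ τ in Ioc t0 t, ∫⁻ v, ENNReal.ofReal (f τ v * (min (‖v‖^2) A)^p)) ≤
      (∫⁻ v, ENNReal.ofReal (f t0 v * (‖v‖^2)^p)) + ENNReal.ofReal (C * (t - t0)) := by
  obtain ⟨c, C, B, hc, hC, hB, hst⟩ := static3 γ h0 h1 M E hM hE p hp
  refine ⟨β * c, β * C, B, by positivity, by positivity, hB, ?_⟩
  intro A hA t0 t ht0 htt
  have hA0 : 0 ≤ A := by linarith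
  have ht : 0 ≤ t := ht0.trans htt
  have jm := hf.jm
  have hXm : Measurable (fun v : R3 => ENNReal.ofReal (chi p A (‖v‖^2))) := by unfold chi psi; fun_prop
  have hw := hf.weak_int h0.le h1 hβ (fun v => ENNReal.ofReal (chi p A (‖v‖^2))) hXm t0 t ht0 htt
  have hfin := hf.loss_fin h0.le h1 (fun v => ENNReal.ofReal (chi p A (‖v‖^2))) ((p-1) * A^p) 
    (fun v => ENNReal.ofReal_le_ofReal (chi_le p A hp hA0 _ (by positivity))) t0 t ht0
  beta_reduce at hw hfin
  have mY : Measurable (fun τ => ∫⁻ v, ENNReal.ofReal (f τ v * (min (‖v‖^2) A)^p)) := by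
    have : Measurable (fun q : ℝ × R3 => ENNReal.ofReal (f q.1 q.2 * (min (‖q.2‖^2) A)^p)) := by fun_prop
    exact this.lintegral_prod_right'
  have hi : (∫⁻ τ in Ioc t0 t, ∫⁻ v, ENNReal.ofReal (chi p A (‖v‖^2)) * (GE γ (f τ) v * ENNReal.ofReal (1 - f τ v))) + 
      ENNReal.ofReal c * (∫⁻ τ in Ioc t0 t, ∫⁻ v, ENNReal.ofReal (f τ v * (min (‖v‖^2) A)^p)) ≤
      (∫⁻ τ in Ioc t0 t, ∫⁻ v, ENNReal.ofReal (chi p A (‖v‖^2)) * (ENNReal.ofReal (f τ v) * LE' γ (f τ) v)) + ENNReal.ofReal (C * (t - t0)) := by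
    have e : ENNReal.ofReal (C * (t - t0)) = ∫⁻ τ in Ioc t0 t, ENNReal.ofReal C := by
      rw [setLIntegral_const, Real.volume_Ioc, ENNReal.ofReal_mul hC]
    rw [e, ← lintegral_const_mul _ mY, ← lintegral_add_right _ (mY.const_mul _), ← lintegral_add_right _ measurable_const]
    apply lintegral_mono_ae
    filter_upwards [ae_restrict_mem measurableSet_Ioc] with τ hτ
    have hτ0 : 0 ≤ τ := ht0.trans hτ.1.le
    exact hst A hA (f τ) (hf.reg.adm τ hτ0) (hf.mass τ hτ0) (hf.energy τ hτ0).le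
  have e1 := chi_psi_int p A hp hA0 (f t) (hf.reg.adm t ht) hE hM.le (hf.mass t ht) (hf.energy t ht)
  have e0 := chi_psi_int p A hp hA0 (f t0) (hf.reg.adm t0 ht0) hE hM.le (hf.mass t0 ht0) (hf.energy t0 ht0)
  have l1 : (∫⁻ v, ENNReal.ofReal (f t v * (min (‖v‖^2) A)^p)) ≤ ∫⁻ v, ENNReal.ofReal (psi p A (‖v‖^2) * f t v) := by
    refine lintegral_mono fun v => ENNReal.ofReal_le_ofReal ?_
    rw [mul_comm]
    exact mul_le_mul_of_nonneg_right (pow_le_psi p A hp hA0 _ (by positivity)) ((hf.reg.adm t ht).n v)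
  have l0 : (∫⁻ v, ENNReal.ofReal (psi p A (‖v‖^2) * f t0 v)) ≤ ∫⁻ v, ENNReal.ofReal (f t0 v * (‖v‖^2)^p) := by
    refine lintegral_mono fun v => ENNReal.ofReal_le_ofReal ?_
    rw [mul_comm (f t0 v)]
    exact mul_le_mul_of_nonneg_right (psi_le_pow p A hp hA0 _ (by positivity)) ((hf.reg.adm t0 ht0).n v)
  generalize (∫⁻ τ in Ioc t0 t, ∫⁻ v, ENNReal.ofReal (chi p A (‖v‖^2)) * (GE γ (f τ) v * ENNReal.ofReal (1 - f τ v))) = Ga at hw hi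
  generalize (∫⁻ τ in Ioc t0 t, ∫⁻ v, ENNReal.ofReal (chi p A (‖v‖^2)) * (ENNReal.ofReal (f τ v) * LE' γ (f τ) v)) = Lo at hw hi hfin
  generalize (∫⁻ τ in Ioc t0 t, ∫⁻ v, ENNReal.ofReal (f τ v * (min (‖v‖^2) A)^p)) = IY at hi ⊢
  generalize (∫⁻ v, ENNReal.ofReal (chi p A (‖v‖^2)) * ENNReal.ofReal (f t v)) = X1 at hw e1
  generalize (∫⁻ v, ENNReal.ofReal (chi p A (‖v‖^2)) * ENNReal.ofReal (f t0 v)) = X0 at hw e0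
  generalize (∫⁻ v, ENNReal.ofReal (psi p A (‖v‖^2) * f t v)) = P1 at e1 l1
  generalize (∫⁻ v, ENNReal.ofReal (psi p A (‖v‖^2) * f t0 v)) = P0 at e0 l0
  rw [ENNReal.ofReal_mul hβ.le, mul_assoc β, ENNReal.ofReal_mul hβ.le]
  have s1 : X1 + ENNReal.ofReal β * ENNReal.ofReal c * IY ≤ X0 + ENNReal.ofReal β * ENNReal.ofReal (C * (t - t0)) := by
    have : (X1 + ENNReal.ofReal β * ENNReal.ofReal c * IY) + ENNReal.ofReal β * Lo ≤ (X0 + ENNReal.ofReal β * ENNReal.ofReal (C * (t - t0))) + ENNReal.ofReal β * Lo := by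
      calc _ = (X1 + ENNReal.ofReal β * Lo) + ENNReal.ofReal β * ENNReal.ofReal c * IY := by ring
        _ = X0 + ENNReal.ofReal β * (Ga + ENNReal.ofReal c * IY) := by rw [hw]; ring
        _ ≤ X0 + ENNReal.ofReal β * (Lo + ENNReal.ofReal (C * (t - t0))) := by gcongr
        _ = _ := by ring
    exact (ENNReal.add_le_add_iff_right (by finiteness)).1 this
  have s2 : P1 + ENNReal.ofReal β * ENNReal.ofReal c * IY ≤ P0 + ENNReal.ofReal β * ENNReal.ofReal (C * (t - t0)) := by
    have : (P1 + ENNReal.ofReal β * ENNReal.ofReal c * IY) + ENNReal.ofReal ((p-1) * A^p * M) ≤ 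
        (P0 + ENNReal.ofReal β * ENNReal.ofReal (C * (t - t0))) + ENNReal.ofReal ((p-1) * A^p * M) := by
      calc _ = (P1 + ENNReal.ofReal ((p-1) * A^p * M)) + ENNReal.ofReal β * ENNReal.ofReal c * IY := by ring
        _ = (X1 + ENNReal.ofReal β * ENNReal.ofReal c * IY) + ENNReal.ofReal (p * A^(p-1) * E) := by rw [← e1]; ring
        _ ≤ (X0 + ENNReal.ofReal β * ENNReal.ofReal (C * (t - t0))) + ENNReal.ofReal (p * A^(p-1) * E) := add_le_add_left s1 _
        _ = (X0 + ENNReal.ofReal (p * A^(p-1) * E)) + ENNReal.ofReal β * ENNReal.ofReal (C * (t - t0)) := by ring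
        _ = _ := by rw [e0]; ring
    exact (ENNReal.add_le_add_iff_right ENNReal.ofReal_ne_top).1 this
  exact (add_le_add_left l1 _).trans (s2.trans (add_le_add_left l0 _))

end Dyn

end Part26

section Part27
open scoped ENNReal

section Dyn2
variable {γ β : ℝ} {f0 : R3 → ℝ} {f : ℝ → R3 → ℝ} {N : ENNReal} {M E : ℝ}

theorem YA_tendsto (F : R3 → ℝ) (hF : Adm F) (p B : ℝ) (hp : 1 < p) (hB : 1 ≤ B) :
    (Monotone fun n : ℕ => ∫⁻ v, ENNReal.ofReal (F v * (min (‖v‖^2) (B + 1 + n))^p)) ∧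
    Filter.Tendsto (fun n : ℕ => ∫⁻ v, ENNReal.ofReal (F v * (min (‖v‖^2) (B + 1 + n))^p)) Filter.atTop (nhds (∫⁻ v, ENNReal.ofReal (F v * (‖v‖^2)^p))) := by
  have hm := hF.m
  have hmono : ∀ v : R3, Monotone fun n : ℕ => ENNReal.ofReal (F v * (min (‖v‖^2) (B + 1 + n))^p) := by
    intro v n m hnm
    apply ENNReal.ofReal_le_ofReal
    have h : (n:ℝ) ≤ m := by exact_mod_cast hnm
    have n0 : (0:ℝ) ≤ n := by positivity
    refine mul_le_mul_of_nonneg_left ?_ (hF.n v)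
    exact Real.rpow_le_rpow (min_nn (by positivity) (by linarith)) (min_le_min_left _ (by linarith)) (by linarith)
  constructor
  · intro n m hnm
    exact lintegral_mono fun v => hmono v hnm
  · apply lintegral_tendsto_of_tendsto_of_monotone
    · intro n; fun_prop
    · exact ae_of_all _ hmono
    · refine ae_of_all _ fun v => ?_
      apply tendsto_const_nhds.congr'
      obtain ⟨k, hk⟩ := exists_nat_gt (‖v‖^2)
      filter_upwards [Filter.eventually_ge_atTop k] with n hn
      have : (k:ℝ) ≤ n := by exact_mod_cast hn
      rw [min_eq_left (by linarith)]

theorem Sol.mom (hf : Sol γ β f0 f N (ENNReal.ofReal M) (ENNReal.ofReal E)) (h0 : 0 < γ) (h1 : γ ≤ 1) (hβ : 0 < β) (hM : 0 < M) (hE : 0 ≤ E) (p : ℝ) (hp : 1 < p) :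
    ∃ c C : ℝ, 0 < c ∧ 0 ≤ C ∧ ∀ t0 t, 0 ≤ t0 → t0 ≤ t →
      (∫⁻ v, ENNReal.ofReal (f t v * (‖v‖^2)^p)) + ENNReal.ofReal c * (∫⁻ τ in Ioc t0 t, ∫⁻ v, ENNReal.ofReal (f τ v * (‖v‖^2)^p)) ≤
      (∫⁻ v, ENNReal.ofReal (f t0 v * (‖v‖^2)^p)) + ENNReal.ofReal (C * (t - t0)) := by
  obtain ⟨c, C, B, hc, hC, hB, H⟩ := hf.momA h0 h1 hβ hM hE p hp
  refine ⟨c, C, hc, hC, ?_⟩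
  intro t0 t ht0 htt
  have jm := hf.jm
  have ht := ht0.trans htt
  have T1 := (YA_tendsto (f t) (hf.reg.adm t ht) p B hp hB).2
  have T2 : Filter.Tendsto (fun n : ℕ => ∫⁻ τ in Ioc t0 t, ∫⁻ v, ENNReal.ofReal (f τ v * (min (‖v‖^2) (B + 1 + n))^p)) Filter.atTop
      (nhds (∫⁻ τ in Ioc t0 t, ∫⁻ v, ENNReal.ofReal (f τ v * (‖v‖^2)^p))) := by
    apply lintegral_tendsto_of_tendsto_of_monotone
    · intro n
      have : Measurable (fun q : ℝ × R3 => ENNReal.ofReal (f q.1 q.2 * (min (‖q.2‖^2) (B + 1 + n))^p)) := by fun_prop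
      exact this.lintegral_prod_right'.aemeasurable
    · filter_upwards [ae_restrict_mem measurableSet_Ioc] with τ hτ
      exact (YA_tendsto (f τ) (hf.reg.adm τ (ht0.trans hτ.1.le)) p B hp hB).1
    · filter_upwards [ae_restrict_mem measurableSet_Ioc] with τ hτ
      exact (YA_tendsto (f τ) (hf.reg.adm τ (ht0.trans hτ.1.le)) p B hp hB).2
  have T3 := T1.add (ENNReal.Tendsto.const_mul T2 (Or.inr (ENNReal.ofReal_ne_top (r := c))))
  refine le_of_tendsto' T3 fun n => ?_
  exact H (B + 1 + n) (by have : (0:ℝ) ≤ n := by positivity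
                          linarith) t0 t ht0 htt

theorem discrete_bd (Y : ℝ → ENNReal) (c C y0 : ℝ) (hc : 0 < c) (hC : 0 ≤ C) (hy : Y 0 ≤ ENNReal.ofReal y0)
    (H : ∀ t0 t, 0 ≤ t0 → t0 ≤ t → Y t + ENNReal.ofReal c * (∫⁻ τ in Ioc t0 t, Y τ) ≤ Y t0 + ENNReal.ofReal (C * (t - t0))) :
    ∃ Q : ℝ, 0 ≤ Q ∧ ∀ t, 0 ≤ t → Y t ≤ ENNReal.ofReal Q := by
  obtain ⟨D, hD⟩ : ∃ D, D = max y0 ((C + c * C)/c) := ⟨_, rfl⟩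
  have hD0 : 0 ≤ D := by rw [hD]; exact le_max_of_le_right (by positivity)
  have hD1 : C + c * C ≤ c * D := by
    have : (C + c * C)/c ≤ D := by rw [hD]; exact le_max_right _ _
    rw [div_le_iff₀ hc] at this; linarith
  have hstep : ∀ t0, 0 ≤ t0 → Y t0 ≤ ENNReal.ofReal D → Y (t0+1) ≤ ENNReal.ofReal D := by
    intro t0 ht0 h
    have a1 := H t0 (t0+1) ht0 (by linarith)
    rw [show C * (t0 + 1 - t0) = C by ring] at a1
    have a2 : Y (t0+1) ≤ (∫⁻ τ in Ioc t0 (t0+1), Y τ) + ENNReal.ofReal C := by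
      have e : ∀ z : ENNReal, z = ∫⁻ τ in Ioc t0 (t0+1), z := by
        intro z; rw [setLIntegral_const, Real.volume_Ioc]; simp
      rw [e (Y (t0+1))]
      rw [e (ENNReal.ofReal C)]
      rw [← lintegral_add_right _ measurable_const]
      apply lintegral_mono_ae
      filter_upwards [ae_restrict_mem measurableSet_Ioc] with τ hτ
      refine le_self_add.trans ((H τ (t0+1) (ht0.trans hτ.1.le) hτ.2).trans ?_)
      gcongr
      nlinarith [hτ.1]
    have a3 : ENNReal.ofReal (1 + c) * Y (t0+1) ≤ ENNReal.ofReal (1 + c) * ENNReal.ofReal D := by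
      calc _ = Y (t0+1) + ENNReal.ofReal c * Y (t0+1) := by rw [ENNReal.ofReal_add zero_le_one hc.le, add_mul, ENNReal.ofReal_one, one_mul]
        _ ≤ Y (t0+1) + ENNReal.ofReal c * ((∫⁻ τ in Ioc t0 (t0+1), Y τ) + ENNReal.ofReal C) := by gcongr
        _ = (Y (t0+1) + ENNReal.ofReal c * (∫⁻ τ in Ioc t0 (t0+1), Y τ)) + ENNReal.ofReal (c * C) := by rw [ENNReal.ofReal_mul hc.le]; ring
        _ ≤ (ENNReal.ofReal D + ENNReal.ofReal C) + ENNReal.ofReal (c * C) := add_le_add_left (a1.trans (add_le_add_left h _)) _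
        _ = ENNReal.ofReal (D + C + c * C) := by
          rw [← ENNReal.ofReal_add hD0 hC, ← ENNReal.ofReal_add (by positivity) (by positivity)]
        _ ≤ ENNReal.ofReal ((1+c) * D) := ENNReal.ofReal_le_ofReal (by linarith)
        _ = _ := ENNReal.ofReal_mul (by positivity)
    exact (ENNReal.mul_le_mul_iff_right (by rw [Ne, ENNReal.ofReal_eq_zero]; linarith) ENNReal.ofReal_ne_top).1 a3
  have hn : ∀ n : ℕ, Y n ≤ ENNReal.ofReal D := by
    intro n
    induction n with
    | zero => simp only [Nat.cast_zero]; exact hy.trans (ENNReal.ofReal_le_ofReal (by rw [hD]; exact le_max_left _ _))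
    | succ k ih => push_cast; exact hstep k (by positivity) ih
  refine ⟨D + C, by positivity, fun t ht => ?_⟩
  have h := H (⌊t⌋₊ : ℝ) t (by positivity) (Nat.floor_le ht)
  rw [ENNReal.ofReal_add hD0 hC]
  refine le_self_add.trans (h.trans (add_le_add (hn _) (ENNReal.ofReal_le_ofReal ?_)))
  have := Nat.lt_floor_add_one t
  nlinarith

theorem Sol.mom_bd (hf : Sol γ β f0 f N (ENNReal.ofReal M) (ENNReal.ofReal E)) (h0 : 0 < γ) (h1 : γ ≤ 1) (hβ : 0 < β) (hM : 0 < M) (hE : 0 ≤ E) 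
    (s C0 : ℝ) (hC0 : 0 ≤ C0) (hf0 : ∀ᵐ v, f0 v ≤ C0 * (1 + ‖v‖)^(-s)) (q : ℝ) (hq : 2 < q) (hqs : q + 3 < s) :
    ∃ Q : ℝ, 0 ≤ Q ∧ ∀ t, 0 ≤ t → ∫⁻ v, ENNReal.ofReal (f t v * ‖v‖^q) ≤ ENNReal.ofReal Q := by
  have ep : ∀ v : R3, (‖v‖^2)^(q/2) = ‖v‖^q := by
    intro v
    rw [← Real.rpow_natCast ‖v‖ 2, ← Real.rpow_mul (norm_nonneg v)]
    congr 1; push_cast; ring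
  obtain ⟨c, C, hc, hC, H⟩ := hf.mom h0 h1 hβ hM hE (q/2) (by linarith)
  simp_rw [ep] at H
  have hfin : ∫⁻ v, ENNReal.ofReal (f 0 v * ‖v‖^q) ≠ ⊤ := by
    have k := finite_integral_one_add_norm (E := R3) (μ := volume) (r := s - q) (by simp; linarith)
    apply ne_top_of_le_ne_top (b := ENNReal.ofReal C0 * ∫⁻ v : R3, ENNReal.ofReal ((1 + ‖v‖)^(-(s-q)))) (by finiteness)
    rw [← lintegral_const_mul' _ _ ENNReal.ofReal_ne_top]
    apply lintegral_mono_ae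
    filter_upwards [hf.init, hf0] with v h1 h2
    rw [← ENNReal.ofReal_mul hC0]
    apply ENNReal.ofReal_le_ofReal
    rw [h1]
    have hpos : 0 < 1 + ‖v‖ := by positivity
    calc _ ≤ C0 * (1 + ‖v‖)^(-s) * (1 + ‖v‖)^q := by
          gcongr
          linarith
      _ = _ := by rw [mul_assoc, ← Real.rpow_add hpos]; congr 2; ring
  exact discrete_bd (fun t => ∫⁻ v, ENNReal.ofReal (f t v * ‖v‖^q)) c C _ hc hC (ENNReal.ofReal_toReal hfin).ge H

end Dyn2

end Part27

/-- Propagation of `L^∞` polynomial moments for the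
Boltzmann–Fermi–Dirac equation with `0 < γ ≤ 1` and constant angular kernel (H4). -/
theorem Linfty_polynomial_moments_BFD
    (γ : ℝ) (hγ₀ : 0 < γ) (hγ₁ : γ ≤ 1) (b : ℝ → ℝ)
    (β : ℝ) (hβ : 0 < β) (hbconst : ∀ x : ℝ, b x = β)
    (f₀ : R3 → ℝ) (hf₀meas : Measurable f₀)
    (hf₀bd : ∀ᵐ v : R3 ∂volume, 0 ≤ f₀ v ∧ f₀ v ≤ 1) (hf₀L12 : MemL1s 2 f₀)
    (s : ℝ) (hs : 2 < s)
    (M₀ : ℝ) (hM₀ : ∀ᵐ v : R3 ∂volume, (1 + ‖v‖ ^ 2) ^ (s / 2) * f₀ v ≤ M₀)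
    (s' : ℝ) (hs' : (s ≤ 5 ∧ s' = s) ∨ (5 < s ∧ 2 < s' ∧ s' < s))
    (f : ℝ → R3 → ℝ) (hf : IsFDSolution γ b f₀ f) :
    ∃ C₄ > (0:ℝ), ∀ t : ℝ, 0 ≤ t →
      ∀ᵐ v : R3 ∂volume, (1 + ‖v‖) ^ s' * f t v ≤ C₄ := by
  have hs2 : 2 < s' := by rcases hs' with ⟨_, h⟩ | ⟨_, h, _⟩ <;> linarith
  have hss : s' ≤ s := by rcases hs' with ⟨_, h⟩ | ⟨_, _, h⟩ <;> linarith
  obtain ⟨g, N, M, E, hg, hfg⟩ := exists_Sol γ hγ₀.le hγ₁ b β hbconst f₀ f hf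
  obtain ⟨m, hm⟩ : ∃ m, m = M.toReal := ⟨_, rfl⟩
  obtain ⟨e, he⟩ : ∃ e, e = E.toReal := ⟨_, rfl⟩
  have hm0 : 0 ≤ m := by rw [hm]; exact ENNReal.toReal_nonneg
  have he0 : 0 ≤ e := by rw [he]; exact ENNReal.toReal_nonneg
  have hM : M = ENNReal.ofReal m := by rw [hm, ENNReal.ofReal_toReal hg.Mt]
  have hE : E = ENNReal.ofReal e := by rw [he, ENNReal.ofReal_toReal hg.Et]
  suffices hsuf : ∃ C₄ > (0:ℝ), ∀ t : ℝ, 0 ≤ t → ∀ᵐ v : R3 ∂volume, (1 + ‖v‖) ^ s' * g t v ≤ C₄ by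
    obtain ⟨C, hC, h⟩ := hsuf
    refine ⟨C, hC, fun t ht => ?_⟩
    filter_upwards [h t ht, hfg t ht] with v h1 h2
    rw [← h2]; exact h1
  rcases hm0.eq_or_lt with hz | hpos
  · refine ⟨1, one_pos, fun t ht => ?_⟩
    have hmass := hg.mass t ht
    rw [hM, ← hz, ENNReal.ofReal_zero, lintegral_eq_zero_iff ((hg.reg.adm t ht).m.ennreal_ofReal)] at hmass
    filter_upwards [hmass] with v hv
    have h1 : g t v ≤ 0 := by simpa using hv
    have h2 : g t v = 0 := le_antisymm h1 ((hg.reg.adm t ht).n v)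
    rw [h2, mul_zero]; exact zero_le_one
  rw [hM, hE] at hg
  obtain ⟨C0, hC0e⟩ : ∃ C0, C0 = 2^(s/2) * max M₀ 0 := ⟨_, rfl⟩
  have hC0 : 0 ≤ C0 := by rw [hC0e]; positivity
  have hdec : ∀ᵐ v : R3, f₀ v ≤ C0 * (1 + ‖v‖)^(-s) := by
    filter_upwards [hM₀, hf₀bd] with v hv hb
    have hp : 0 < 1 + ‖v‖ := by positivity
    have h1 : (1 + ‖v‖)^s ≤ 2^(s/2) * (1 + ‖v‖^2)^(s/2) := by
      rw [← Real.mul_rpow (by norm_num) (by positivity), show (1 + ‖v‖)^s = ((1 + ‖v‖)^2)^(s/2) by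
        rw [← Real.rpow_natCast (1 + ‖v‖) 2, ← Real.rpow_mul hp.le]; congr 1; push_cast; ring]
      exact Real.rpow_le_rpow (by positivity) (by nlinarith [sq_nonneg (‖v‖ - 1)]) (by linarith)
    rw [Real.rpow_neg hp.le, ← div_eq_mul_inv, le_div_iff₀ (by positivity)]
    calc _ ≤ f₀ v * (2^(s/2) * (1 + ‖v‖^2)^(s/2)) := mul_le_mul_of_nonneg_left h1 hb.1
      _ = 2^(s/2) * ((1 + ‖v‖^2)^(s/2) * f₀ v) := by ring
      _ ≤ _ := by rw [hC0e]; gcongr; exact hv.trans (le_max_left _ _)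
  have hdec' : ∀ᵐ v : R3, f₀ v ≤ C0 * (1 + ‖v‖)^(-s') := by
    filter_upwards [hdec] with v hv
    refine hv.trans (mul_le_mul_of_nonneg_left ?_ hC0)
    exact Real.rpow_le_rpow_of_exponent_le (by linarith [norm_nonneg v]) (by linarith)
  by_cases h5 : s' ≤ 5
  · refine A5 hg hγ₀ hγ₁ hβ hpos he0 hf₀meas s' hs2 C0 hC0 hdec' 2 e (by norm_num) he0 (by linarith) ?_
    intro t ht
    simp_rw [Real.rpow_two]
    exact (hg.energy t ht).le
  · push Not at h5
    have hlt : s' < s := by rcases hs' with ⟨h, h'⟩ | ⟨_, _, h⟩ <;> linarith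
    obtain ⟨Q, hQ, hmom⟩ := hg.mom_bd hγ₀ hγ₁ hβ hpos he0 s C0 hC0 hdec (s' - 3) (by linarith) (by linarith)
    exact A5 hg hγ₀ hγ₁ hβ hpos he0 hf₀meas s' hs2 C0 hC0 hdec' (s' - 3) Q (by linarith) hQ le_rfl hmom
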